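/- For every positive integer m there exists a weak Jacobi form K_m of weight 2 and index m such that: (a) C_{K_m}(Δ,ℓ) = 0 for all Δ < −1; (b) C_{K_m}(−1,r) = 1 for every r with r² ≡ 1 (mod 4m); (c) its n = 0 Fourier coefficients are c(0,0) = −2, c(0,1) = c(0,−1) = 1 and c(0,r) = 0 for |r| ≥ 2 (i.e., K_m(τ,z) = y − 2 + y^{−1} + O(q)); (d) K_m is invariant under every Atkin–Lehner involution, i.e. C_{K_m}(Δ,ℓ*) = C_{K_m}(Δ,ℓ) for every factorization m = ab with gcd(a,b) = 1, where ℓ* ≡ −ℓ (mod 2a) and ℓ* ≡ ℓ (mod 2b); and (e) K_m is primitive, i.e. K_m|u_p = 0 for every prime p with p² | m. Moreover, for every weak Jacobi form φ of weight 2 and index m with optimal growth there is a unique λ ∈ ℂ such that φ − λ·K_m is a holomorphic Jacobi form of weight 2 and index m; in particular K_m is not itself holomorphic, and the space of weight-2 index-m weak Jacobi forms with optimal growth contains the holomorphic Jacobi forms with codimension exactly 1. -/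

import Mathlib

noncomputable section

open Complex Filter Topology MeasureTheory
open scoped Classical

/-- `ee x = e^{2πix}`. -/
def ee (x : ℂ) : ℂ := Complex.exp (2 * (Real.pi : ℂ) * Complex.I * x)

/-- The index-`m` elliptic transformation law on `ℍ × ℂ`. -/
def EllipticLaw (m : ℕ) (φ : ℂ → ℂ → ℂ) : Prop :=
  ∀ τ : ℂ, 0 < τ.im → ∀ z : ℂ, ∀ lam mu : ℤ,
    φ τ (z + (lam : ℂ) * τ + (mu : ℂ)) =
      ee (-(m : ℂ) * ((lam : ℂ) ^ 2 * τ + 2 * (lam : ℂ) * z)) * φ τ z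

/-- The weight-`k` index-`m` modular transformation law on `ℍ × ℂ`. -/
def ModularLaw (k : ℤ) (m : ℕ) (φ : ℂ → ℂ → ℂ) : Prop :=
  ∀ τ : ℂ, 0 < τ.im → ∀ z : ℂ, ∀ a b c d : ℤ, a * d - b * c = 1 →
    φ (((a : ℂ) * τ + (b : ℂ)) / ((c : ℂ) * τ + (d : ℂ))) (z / ((c : ℂ) * τ + (d : ℂ))) =
      ((c : ℂ) * τ + (d : ℂ)) ^ k *
        ee ((m : ℂ) * (c : ℂ) * z ^ 2 / ((c : ℂ) * τ + (d : ℂ))) * φ τ z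

/-- The theta function `θ_{m,ℓ}(τ,z) = ∑_{r ≡ ℓ (mod 2m)} q^{r²/4m} y^r`. -/
def jTheta (m : ℕ) (l : ℤ) (τ z : ℂ) : ℂ :=
  ∑' n : ℤ, ee (((l : ℂ) + 2 * (m : ℂ) * (n : ℂ)) ^ 2 / (4 * (m : ℂ)) * τ +
      ((l : ℂ) + 2 * (m : ℂ) * (n : ℂ)) * z)

/-- The point `z_s = ατ + β` for `s = (α,β) ∈ ℚ²`. -/
def zpt (s : ℚ × ℚ) (τ : ℂ) : ℂ := (s.1 : ℚ) * τ + (s.2 : ℚ)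

/-- A holomorphic function on `ℍ × ℂ` satisfying the index-`m` elliptic transformation law,
together with its Fourier coefficient data `coeff Δ ℓ = C(Δ,ℓ)` (so that
`c(n,r) = C(4nm - r², r)`, `C(Δ,ℓ)` depends on `ℓ` only modulo `2m`, and `C(Δ,ℓ) = 0` on
pairs with `Δ + ℓ² ≢ 0 (mod 4m)`). -/
structure EllFormData (m : ℕ) where
  toFun : ℂ → ℂ → ℂ
  coeff : ℤ → ℤ → ℂ
  holo : ∀ τ z : ℂ, 0 < τ.im → DifferentiableAt ℂ (fun p : ℂ × ℂ => toFun p.1 p.2) (τ, z)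
  elliptic : EllipticLaw m toFun
  expansion : ∀ τ z : ℂ, 0 < τ.im →
    HasSum (fun p : ℤ × ℤ => coeff (4 * (m : ℤ) * p.1 - p.2 ^ 2) p.2 *
      ee ((p.1 : ℂ) * τ + (p.2 : ℂ) * z)) (toFun τ z)
  periodic : ∀ Δ l : ℤ, coeff Δ (l + 2 * (m : ℤ)) = coeff Δ l
  support : ∀ Δ l : ℤ, ¬ (4 * (m : ℤ)) ∣ (Δ + l ^ 2) → coeff Δ l = 0

/-- An elliptic form is weak if `c(n,r) = 0` for `n < 0`. -/
def IsWeakC (m : ℕ) (C : ℤ → ℤ → ℂ) : Prop :=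
  ∀ n r : ℤ, n < 0 → C (4 * (m : ℤ) * n - r ^ 2) r = 0

/-- Even coefficients: `C(Δ,-ℓ) = C(Δ,ℓ)`. -/
def IsEvenC (C : ℤ → ℤ → ℂ) : Prop := ∀ Δ l : ℤ, C Δ (-l) = C Δ l

/-- Holomorphic (as opposed to weak): `C(Δ,ℓ) = 0` for `Δ < 0`. -/
def IsHolC (C : ℤ → ℤ → ℂ) : Prop := ∀ Δ l : ℤ, Δ < 0 → C Δ l = 0

/-- Cuspidal: `C(Δ,ℓ) = 0` for `Δ ≤ 0`. -/
def IsCuspC (C : ℤ → ℤ → ℂ) : Prop := ∀ Δ l : ℤ, Δ ≤ 0 → C Δ l = 0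

/-- Optimal growth: `C(Δ,ℓ) = 0` for `Δ < -1`. -/
def IsOGC (C : ℤ → ℤ → ℂ) : Prop := ∀ Δ l : ℤ, Δ < -1 → C Δ l = 0


notation:max "Zt" n:max => ZMod (2 * n)

lemma ee_add (x y : Complex) : ee (x + y) = ee x * ee y := by
  simp only [ee, ← Complex.exp_add]; ring_nf
lemma ee_zero : ee 0 = 1 := by simp [ee]
lemma ee_ne (x : Complex) : ee x ≠ 0 := Complex.exp_ne_zero _
lemma ee_int (n : Int) : ee n = 1 := by
  rw [ee, Complex.exp_eq_one_iff]; exact ⟨n, by ring⟩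
lemma ee_int_mul (n : Int) (x : Complex) : ee (n * x) = ee x ^ n := by
  simp only [ee, ← Complex.exp_int_mul]; ring_nf
lemma ee_nat_mul (n : Nat) (x : Complex) : ee (n * x) = ee x ^ n := by
  simp only [ee, ← Complex.exp_nat_mul]; ring_nf
lemma norm_ee (x : Complex) : ‖ee x‖ = Real.exp (-(2 * Real.pi * x.im)) := by
  rw [ee, Complex.norm_exp]
  congr 1
  simp
lemma norm_ee_real (x : Real) : ‖ee x‖ = 1 := by simp [norm_ee]
lemma continuous_ee : Continuous ee := by unfold ee; fun_prop
lemma fourier_unique (c : Int → Complex) (hc : Summable c)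
    (h0 : ∀ x : Real, ∑' r : Int, c r * ee (r * x) = 0) (s : Int) : c s = 0 := by
  have hfc : ∀ r : Int, ∀ x : Real, ‖c r * ee (r * x) * ee (-s * x)‖ = ‖c r‖ := by
    intro r x
    rw [norm_mul, norm_mul]
    have h1 := norm_ee_real (r * x)
    have h2 := norm_ee_real (-s * x)
    simp_all
  have hs := intervalIntegral.hasSum_intervalIntegral_of_summable_norm (a := 0) (b := 1)
    (f := fun r : Int => (⟨fun x : Real => c r * ee (r * x) * ee (-s * x), by
      have := continuous_ee; fun_prop⟩ : C(Real, Complex))) ?_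
  · have e1 : ∀ r : Int, ∫ x in (0:Real)..1, (c r * ee (r * x) * ee (-s * x)) = if r = s then c s else 0 := by
      intro r
      by_cases hrs : r = s
      · subst hrs
        have : ∀ x : Real, c r * ee (r * x) * ee (-r * x) = c r := by
          intro x; rw [mul_assoc, ← ee_add]; ring_nf; rw [ee_zero, mul_one]
        simp only [this]; simp
      · have : ∀ x : Real, c r * ee (r * x) * ee (-s * x)
            = c r * Complex.exp ((2 * Real.pi * I * ((r:Complex) - s)) * x) := by
          intro x; rw [mul_assoc, ← ee_add, ee]; ring_nf
        simp only [this, hrs, if_false]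
        rw [intervalIntegral.integral_const_mul, integral_exp_mul_complex]
        · have h := ee_int (r - s)
          rw [ee] at h; push_cast at h
          simp [h]
        · have : (r:Complex) - s ≠ 0 := sub_ne_zero.2 (by exact_mod_cast hrs)
          simp_all
    have e2 : ∀ x : Real, ∑' r : Int, c r * ee (r * x) * ee (-s * x) = 0 := by
      intro x; rw [tsum_mul_right, h0 x, zero_mul]
    simp only [ContinuousMap.coe_mk] at hs
    simp only [e1, e2, intervalIntegral.integral_zero] at hs
    have := hs.unique (hasSum_ite_eq s (c s))
    exact this.symm
  · refine Summable.of_nonneg_of_le (fun _ => norm_nonneg _) (fun r => ?_) hc.norm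
    rw [ContinuousMap.norm_le _ (norm_nonneg _)]
    simp_all
lemma fourier_unique' (c d : Int → Complex) (hc : Summable c) (hd : Summable d)
    (h0 : ∀ x : Real, ∑' r : Int, c r * ee (r * x) = ∑' r : Int, d r * ee (r * x)) (s : Int) : c s = d s := by
  have key : ∀ c : Int → Complex, Summable c → ∀ x : Real, Summable fun r : Int => c r * ee (r * x) := by
    intro c hc x
    refine Summable.of_norm_bounded hc.norm fun r => ?_
    have h1 := norm_ee_real (r * x)
    simp_all
  have := fourier_unique (fun r => c r - d r) (hc.sub hd) (fun x => by
    simp only [sub_mul]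
    rw [(key c hc x).tsum_sub (key d hd x), h0, sub_self]) s
  exact sub_eq_zero.1 this
lemma double_unique (c d : Int × Int → Complex)
    (hc : ∀ τ z : Complex, 0 < τ.im → Summable fun p : Int × Int => c p * ee (p.1 * τ + p.2 * z))
    (hd : ∀ τ z : Complex, 0 < τ.im → Summable fun p : Int × Int => d p * ee (p.1 * τ + p.2 * z))
    (h : ∀ τ z : Complex, 0 < τ.im → ∑' p : Int × Int, c p * ee (p.1 * τ + p.2 * z)
      = ∑' p : Int × Int, d p * ee (p.1 * τ + p.2 * z)) : c = d := by
  have key : ∀ c : Int × Int → Complex,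
      (∀ τ z : Complex, 0 < τ.im → Summable fun p : Int × Int => c p * ee (p.1 * τ + p.2 * z)) →
      ∀ τ : Complex, 0 < τ.im → (Summable fun r : Int => ∑' n : Int, c (n, r) * ee (n * τ)) ∧
        (∀ r, Summable fun n : Int => c (n, r) * ee (n * τ)) ∧
        ∀ z : Real, ∑' p : Int × Int, c p * ee (p.1 * τ + p.2 * z)
         = ∑' r : Int, (∑' n : Int, c (n, r) * ee (n * τ)) * ee (r * z) := by
    intro c hc τ hτ
    have h0 : Summable fun p : Int × Int => c (p.2, p.1) * ee (p.2 * τ + p.1 * 0) :=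
      (Equiv.prodComm Int Int).summable_iff.2 (hc τ 0 hτ)
    simp only [mul_zero, add_zero] at h0
    refine ⟨h0.prod, fun r => h0.prod_factor r, fun z => ?_⟩
    have h1 : Summable fun p : Int × Int => c (p.2, p.1) * ee (p.2 * τ + p.1 * z) :=
      (Equiv.prodComm Int Int).summable_iff.2 (hc τ z hτ)
    rw [← (Equiv.prodComm Int Int).tsum_eq]
    simp only [Equiv.prodComm_apply, Prod.fst_swap, Prod.snd_swap]
    have h2 := h1.tsum_prod
    simp only [] at h2
    refine h2.trans (tsum_congr fun r => ?_)
    rw [← tsum_mul_right]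
    refine tsum_congr fun n => ?_
    rw [ee_add]; ring
  have h2 : ∀ τ : Complex, 0 < τ.im → ∀ r, ∑' n : Int, c (n, r) * ee (n * τ) = ∑' n : Int, d (n, r) * ee (n * τ) := by
    intro τ hτ r
    refine fourier_unique' _ _ (key c hc τ hτ).1 (key d hd τ hτ).1 (fun x => ?_) r
    rw [← (key c hc τ hτ).2.2, ← (key d hd τ hτ).2.2, h _ _ hτ]
  funext p
  obtain ⟨n, r⟩ := p
  have hi : ∀ x : Real, 0 < ((x:Complex) + I).im := by intro x; simp
  have hi0 : (0:Real) < I.im := by simp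
  have h3 := fourier_unique' (fun n => c (n, r) * ee (n * I)) (fun n => d (n, r) * ee (n * I))
    ((key c hc I hi0).2.1 r) ((key d hd I hi0).2.1 r) (fun x => by
      have := h2 (x + I) (hi x) r
      have e : ∀ n : Int, ∀ t : Complex, t * ee (n * I) * ee (n * x) = t * ee (n * (x + I)) := by
        intro n t; rw [mul_assoc, ← ee_add]; ring_nf
      simpa only [e] using this) n
  exact mul_right_cancel₀ (ee_ne _) h3
def ga (m : Nat) (r : Int) (τ z : Complex) : Complex := ee ((r:Complex) ^ 2 / (4 * m) * τ + r * z)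
def kap (m : Nat) (τ : Complex) : Complex := (-I * (τ / (2 * m))) ^ (1 / 2 : Complex)
lemma im_S_pos {τ : Complex} (hτ : 0 < τ.im) : 0 < (-1 / τ).im := by
  rw [neg_div, neg_im, one_div, inv_im, neg_div, neg_neg]
  exact div_pos hτ (normSq_pos.2 (by rintro rfl; simp at hτ))
lemma ne_zero_of_im {τ : Complex} (hτ : 0 < τ.im) : τ ≠ 0 := by rintro rfl; simp at hτ
lemma ga_eq_term (m : Nat) [NeZero m] (r : Int) (τ z : Complex) :
    ga m r τ z = jacobiTheta₂_term r z (τ / (2 * m)) := by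
  have : (m:Complex) ≠ 0 := NeZero.ne _
  rw [ga, ee, jacobiTheta₂_term]; congr 1; field_simp; ring
lemma im_div_pos (m : Nat) [NeZero m] {τ : Complex} (hτ : 0 < τ.im) : 0 < (τ / (2 * m)).im := by
  have : (τ / (2 * m)) = τ * ((1 / (2 * m) : Real) : Complex) := by push_cast; ring
  rw [this, Complex.im_mul_ofReal]
  have : (0:Real) < m := by exact_mod_cast Nat.pos_of_ne_zero (NeZero.ne m)
  positivity
lemma summable_ga (m : Nat) [NeZero m] {τ : Complex} (hτ : 0 < τ.im) (z : Complex) :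
    Summable fun r : Int => ga m r τ z := by
  simp only [ga_eq_term]
  exact (summable_jacobiTheta₂_term_iff _ _).2 (im_div_pos m hτ)
lemma kap_ne (m : Nat) [NeZero m] {τ : Complex} (hτ : 0 < τ.im) : kap m τ ≠ 0 := by
  have : (m:Complex) ≠ 0 := NeZero.ne _
  have := ne_zero_of_im hτ
  rw [kap, Complex.cpow_ne_zero_iff]
  left
  simp [*]
lemma kap_sq (m : Nat) (τ : Complex) : kap m τ ^ 2 = -I * (τ / (2 * m)) := by
  rw [kap, ← Complex.cpow_nat_mul]; norm_num
lemma chi_ee (N : Nat) [NeZero N] (j : Int) : ZMod.stdAddChar (j : ZMod N) = ee (j / N) := by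
  rw [ZMod.stdAddChar_coe, ee]; congr 1; ring
lemma tsum_residue (N : Nat) [NeZero N] (f : Int → Complex) (l : Int) :
    ∑' r : Int, (if (r : ZMod N) = (l : ZMod N) then f r else 0) = ∑' n : Int, f (l + N * n) := by
  have hinj : Function.Injective fun n : Int => l + N * n := by
    intro a b h
    have : (N:Int) ≠ 0 := by exact_mod_cast NeZero.ne N
    simp_all
  rw [← hinj.tsum_eq (f := fun r : Int => if (r : ZMod N) = (l : ZMod N) then f r else 0)]
  · refine tsum_congr fun n => ?_
    simp
  · intro r hr
    simp only [Function.mem_support, ne_eq, ite_eq_right_iff, Classical.not_imp] at hr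
    have := (ZMod.intCast_eq_intCast_iff_dvd_sub _ _ _).1 hr.1.symm
    obtain ⟨n, hn⟩ := this
    exact ⟨n, by simp only; linarith⟩
lemma theta_S (m : Nat) [NeZero m] {τ : Complex} (hτ : 0 < τ.im) (z : Complex) (ll : Zt m) :
    ∑' r : Int, (if (r : Zt m) = ll then ga m r (-1 / τ) (z / τ) else 0) =
      kap m τ * ee (m * z ^ 2 / τ) * ∑' r : Int, ZMod.stdAddChar (-(ll * (r : Zt m))) * ga m r τ z := by
  obtain ⟨l, rfl⟩ := ZMod.intCast_surjective ll
  rw [tsum_residue]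
  have hm : (m:Complex) ≠ 0 := NeZero.ne _
  have hτ0 := ne_zero_of_im hτ
  have h1 : ∀ n : Int, ga m (l + (2 * m : Nat) * n) (-1 / τ) (z / τ) =
      ee (-(l:Complex) ^ 2 / (4 * m * τ) + l * z / τ) *
        jacobiTheta₂_term n ((z - l / (2 * m)) / (τ / (2 * m))) (-1 / (τ / (2 * m))) := by
    intro n
    rw [ga, jacobiTheta₂_term, ee, ee, ← Complex.exp_add]; congr 1
    push_cast; field_simp; ring
  simp only [h1]
  rw [tsum_mul_left]
  have h2 : ∀ r : Int, ZMod.stdAddChar (-((l : Zt m) * (r : Zt m))) * ga m r τ z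
      = jacobiTheta₂_term r (z - l / (2 * m)) (τ / (2 * m)) := by
    intro r
    have : (-((l : Zt m) * (r : Zt m))) = ((-(l * r) : Int) : Zt m) := by push_cast; rfl
    rw [this, chi_ee, ga, ← ee_add, ee, jacobiTheta₂_term]; congr 1
    push_cast; field_simp; ring
  simp only [h2]
  change _ * jacobiTheta₂ _ _ = _ * _ * jacobiTheta₂ _ _
  rw [jacobiTheta₂_functional_equation (z - l / (2 * m)) (τ / (2 * m))]
  have h3 : kap m τ * (1 / (-I * (τ / (2 * m))) ^ (1 / 2 : Complex)) = 1 := by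
    rw [mul_one_div]; exact div_self (kap_ne m hτ)
  have h4 : ee (-(l:Complex) ^ 2 / (4 * m * τ) + l * z / τ) =
      ee (m * z ^ 2 / τ) * cexp (-Real.pi * I * (z - l / (2 * m)) ^ 2 / (τ / (2 * m))) := by
    rw [ee, ee, ← Complex.exp_add]; congr 1; field_simp; ring
  grind
def hh (m : Nat) (C : Int → Zt m → Complex) (ll : Zt m) (τ : Complex) : Complex :=
  ∑' Δ : Int, C Δ ll * ee (Δ / (4 * m) * τ)
structure PreVV (m : Nat) (C : Int → Zt m → Complex) : Prop where
  supp : ∀ Δ l : Int, C Δ (l : Zt m) ≠ 0 → (4 * (m:Int)) ∣ Δ + l ^ 2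
  bdd : ∃ B : Int, ∀ Δ ll, Δ < -B → C Δ ll = 0
  conv : ∀ ll τ, 0 < τ.im → Summable fun Δ : Int => C Δ ll * ee (Δ / (4 * m) * τ)
structure IsVV (k : Int) (m : Nat) [NeZero m] (C : Int → Zt m → Complex) : Prop extends PreVV m C where
  slaw : ∀ τ, 0 < τ.im → ∀ ll', kap m τ * ∑ ll, ZMod.stdAddChar (-(ll * ll')) * hh m C ll (-1 / τ) =
    τ ^ k * hh m C ll' τ
def Phi (m : Nat) (C : Int → Zt m → Complex) (τ z : Complex) : Complex := ∑' r : Int, hh m C r τ * ga m r τ z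
lemma pre_summable (m : Nat) [NeZero m] {C : Int → Zt m → Complex} (h : PreVV m C) {τ : Complex} (hτ : 0 < τ.im)
    (z : Complex) : Summable fun p : Int × Int => C p.1 p.2 * ee (p.1 / (4 * m) * τ) * ga m p.2 τ z := by
  have h1 : Summable fun Δ : Int => ∑ ll : Zt m, ‖C Δ ll * ee (Δ / (4 * m) * τ)‖ :=
    summable_sum fun ll _ => (h.conv ll τ hτ).norm
  refine Summable.of_norm_bounded (h1.mul_of_nonneg (summable_ga m hτ z).norm (fun _ => by positivity)
    (fun _ => norm_nonneg _)) fun p => ?_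
  rw [norm_mul]
  gcongr
  exact Finset.single_le_sum (f := fun ll => ‖C p.1 ll * ee (p.1 / (4 * m) * τ)‖) (fun _ _ => norm_nonneg _) (Finset.mem_univ _)
lemma Phi_hasSum' (m : Nat) [NeZero m] {C : Int → Zt m → Complex} (h : PreVV m C) {τ : Complex} (hτ : 0 < τ.im)
    (z : Complex) : HasSum (fun p : Int × Int => C p.1 p.2 * ee (p.1 / (4 * m) * τ) * ga m p.2 τ z) (Phi m C τ z) := by
  have h1 := pre_summable m h hτ z
  have h2 := (Equiv.prodComm Int Int).summable_iff.2 h1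
  refine (Equiv.prodComm Int Int).hasSum_iff.1 ?_
  rw [Phi]
  have h3 := h2.hasSum
  rw [h2.tsum_prod] at h3
  convert h3 using 1
  refine tsum_congr fun r => ?_
  simp only [Function.comp, Equiv.prodComm_apply, Prod.swap, hh]
  rw [tsum_mul_right]
lemma summable_hh_ga (m : Nat) [NeZero m] (a : Zt m → Complex) {τ : Complex} (hτ : 0 < τ.im) (z : Complex) :
    Summable fun r : Int => a r * ga m r τ z := by
  refine Summable.of_norm_bounded ((summable_ga m hτ z).norm.mul_left (∑ ll, ‖a ll‖)) fun r => ?_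
  rw [norm_mul]
  gcongr
  exact Finset.single_le_sum (f := fun ll => ‖a ll‖) (fun _ _ => norm_nonneg _) (Finset.mem_univ _)
lemma Phi_hasSum (m : Nat) [NeZero m] {C : Int → Zt m → Complex} (h : PreVV m C) {τ : Complex} (hτ : 0 < τ.im)
    (z : Complex) : HasSum (fun p : Int × Int => C (4 * m * p.1 - p.2 ^ 2) p.2 * ee (p.1 * τ + p.2 * z)) (Phi m C τ z) := by
  have hm : (m:Int) ≠ 0 := by exact_mod_cast NeZero.ne m
  have hm' : (m:Complex) ≠ 0 := NeZero.ne _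
  have hinj : Function.Injective fun p : Int × Int => (4 * (m:Int) * p.1 - p.2 ^ 2, p.2) := by
    rintro ⟨a, b⟩ ⟨c, d⟩ h
    simp only [Prod.mk.injEq] at h
    obtain ⟨h1, rfl⟩ := h
    simp_all
  have h1 := (hinj.hasSum_iff (f := fun p : Int × Int => C p.1 p.2 * ee (p.1 / (4 * m) * τ) * ga m p.2 τ z)
    (a := Phi m C τ z) ?_).2 (Phi_hasSum' m h hτ z)
  · convert h1 using 2 with p
    simp only [Function.comp]
    rw [ga, mul_assoc (C _ _), ← ee_add]
    congr 2
    push_cast; field_simp; ring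
  · rintro ⟨Δ, r⟩ hr
    by_contra hne
    have : C Δ r ≠ 0 := by
      intro h0; apply hne; simp [h0]
    obtain ⟨n, hn⟩ := h.supp _ _ this
    exact hr ⟨(n, r), by simp only [Prod.mk.injEq, and_true]; linarith⟩
lemma Phi_S (m : Nat) [NeZero m] (C : Int → Zt m → Complex) {τ : Complex} (hτ : 0 < τ.im) (z : Complex) :
    Phi m C (-1 / τ) (z / τ) = ee (m * z ^ 2 / τ) *
      ∑' r : Int, (kap m τ * ∑ ll, ZMod.stdAddChar (-(ll * (r : Zt m))) * hh m C ll (-1 / τ)) * ga m r τ z := by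
  have hS := im_S_pos hτ
  have h1 : Phi m C (-1 / τ) (z / τ) = ∑ ll : Zt m, hh m C ll (-1 / τ) *
      ∑' r : Int, (if (r : Zt m) = ll then ga m r (-1 / τ) (z / τ) else 0) := by
    simp only [← tsum_mul_left]
    rw [← Summable.tsum_finsetSum]
    · rw [Phi]
      refine tsum_congr fun r => ?_
      simp
    · intro ll _
      apply Summable.mul_left
      exact Summable.of_norm_bounded (summable_ga m hS (z / τ)).norm fun r => by
        split_ifs <;> simp
  rw [h1]
  simp only [theta_S m hτ]
  have h2 : ∀ ll : Zt m, Summable fun r : Int => ZMod.stdAddChar (-(ll * (r : Zt m))) * ga m r τ z :=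
    fun ll => summable_hh_ga m (fun r => ZMod.stdAddChar (-(ll * r))) hτ z
  have h3 : ∀ r : Int, (kap m τ * ∑ ll, ZMod.stdAddChar (-(ll * (r : Zt m))) * hh m C ll (-1 / τ)) * ga m r τ z
     = ∑ ll, (kap m τ * hh m C ll (-1 / τ)) * (ZMod.stdAddChar (-(ll * (r : Zt m))) * ga m r τ z) := by
    intro r
    rw [Finset.mul_sum, Finset.sum_mul]
    grind
  simp only [h3]
  rw [Summable.tsum_finsetSum (fun ll _ => (h2 ll).mul_left _), Finset.mul_sum]
  refine Finset.sum_congr rfl fun ll _ => ?_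
  rw [tsum_mul_left]; ring
lemma theta_indep (m : Nat) [NeZero m] (a b : Zt m → Complex) {τ : Complex} (hτ : 0 < τ.im)
    (h : ∀ z, ∑' r : Int, a r * ga m r τ z = ∑' r : Int, b r * ga m r τ z) : a = b := by
  have e : ∀ (r : Int) (t z : Complex), t * ga m r τ 0 * ee (r * z) = t * ga m r τ z := by
    intro r t z; rw [ga, ga, mul_assoc, ← ee_add]; ring_nf
  funext ll
  obtain ⟨l, rfl⟩ := ZMod.intCast_surjective ll
  have := fourier_unique' (fun r : Int => a r * ga m r τ 0) (fun r : Int => b r * ga m r τ 0)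
    (summable_hh_ga m a hτ 0) (summable_hh_ga m b hτ 0) (fun x => by simp only [e]; exact h x) l
  exact mul_right_cancel₀ (ee_ne _) this
def SLaw (k : Int) (m : Nat) (φ : Complex → Complex → Complex) : Prop :=
  ∀ τ z : Complex, 0 < τ.im → φ (-1 / τ) (z / τ) = τ ^ k * ee (m * z ^ 2 / τ) * φ τ z
lemma IsVV.sLaw {k : Int} {m : Nat} [NeZero m] {C : Int → Zt m → Complex} (h : IsVV k m C) : SLaw k m (Phi m C) := by
  intro τ z hτ
  rw [Phi_S m C hτ z]
  simp only [h.slaw τ hτ]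
  rw [Phi, mul_comm (τ ^ k), mul_assoc]
  simp only [mul_assoc, tsum_mul_left]
lemma PreVV.isVV {k : Int} {m : Nat} [NeZero m] {C : Int → Zt m → Complex} (h : PreVV m C)
    (hS : SLaw k m (Phi m C)) : IsVV k m C where
  toPreVV := h
  slaw := by
    intro τ hτ ll'
    have := theta_indep m (fun r => kap m τ * ∑ ll, ZMod.stdAddChar (-(ll * r)) * hh m C ll (-1 / τ))
      (fun r => τ ^ k * hh m C r τ) hτ (fun z => by
        have h1 := Phi_S m C hτ z
        rw [hS τ z hτ] at h1
        have h2 : ee (m * z ^ 2 / τ) ≠ 0 := ee_ne _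
        have h3 : τ ^ k * Phi m C τ z = _ := mul_left_cancel₀ h2 (by rw [← h1]; ring)
        rw [← h3, Phi, ← tsum_mul_left]
        simp only [mul_assoc])
    exact congrFun this ll'
lemma norm_ee_le_add (a : Real) {τ : Complex} {s t : Real} (h1 : s < τ.im) (h2 : τ.im < t) :
    ‖ee (a * τ)‖ ≤ ‖ee (a * (s * I))‖ + ‖ee (a * (t * I))‖ := by
  rcases le_total 0 a with ha | ha
  · refine le_add_of_le_of_nonneg ?_ (norm_nonneg _)
    simp only [norm_ee, Real.exp_le_exp]
    simp only [mul_im, ofReal_re, ofReal_im, zero_mul, add_zero, I_im, mul_one, I_re, mul_zero, mul_re]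
    have := Real.pi_pos
    gcongr
  · refine le_add_of_nonneg_of_le (norm_nonneg _) ?_
    simp only [norm_ee, Real.exp_le_exp]
    simp only [mul_im, ofReal_re, ofReal_im, zero_mul, add_zero, I_im, mul_one, I_re, mul_zero, mul_re]
    have h3 : a * t ≤ a * τ.im := mul_le_mul_of_nonpos_left h2.le ha
    have := mul_le_mul_of_nonneg_left h3 (by positivity : 0 ≤ 2 * Real.pi)
    linarith
lemma differentiableAt_expsum {ι : Type*} (c : ι → Complex) (a : ι → Real)
    (hc : ∀ τ : Complex, 0 < τ.im → Summable fun i => c i * ee (a i * τ)) {τ : Complex} (hτ : 0 < τ.im) :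
    DifferentiableAt Complex (fun τ : Complex => ∑' i, c i * ee (a i * τ)) τ := by
  set U : Set Complex := {w | τ.im / 2 < w.im ∧ w.im < τ.im + 1}
  have hU : IsOpen U := (isOpen_lt continuous_const continuous_im).inter (isOpen_lt continuous_im continuous_const)
  have h1 := (hc ((τ.im / 2 : Real) * I) (by simpa using hτ)).norm.add
    (hc ((τ.im + 1 : Real) * I) (by simp only [mul_im, ofReal_re, I_im, mul_one, ofReal_im, I_re, mul_zero, add_zero]; linarith)).norm
  refine (Complex.differentiableOn_tsum_of_summable_norm h1 (fun i => ?_) hU (fun i w hw => ?_)).differentiableAt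
    (hU.mem_nhds ⟨by linarith, by linarith⟩)
  · unfold ee; fun_prop
  · simp only [norm_mul]
    rw [← mul_add]
    exact mul_le_mul_of_nonneg_left (norm_ee_le_add _ hw.1 hw.2) (norm_nonneg _)
lemma hh_diff (m : Nat) {C : Int → Zt m → Complex} (h : PreVV m C) (ll : Zt m) {τ : Complex} (hτ : 0 < τ.im) :
    DifferentiableAt Complex (hh m C ll) τ := by
  have := differentiableAt_expsum (fun Δ : Int => C Δ ll) (fun Δ : Int => (Δ / (4 * m) : Real))
    (fun τ hτ => by push_cast; exact h.conv ll τ hτ) hτ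
  push_cast at this
  exact this
lemma ga_residue (m : Nat) [NeZero m] (l : Int) (τ z : Complex) :
    ∑' r : Int, (if (r : Zt m) = (l : Zt m) then ga m r τ z else 0) =
      ee (l ^ 2 / (4 * m) * τ + l * z) * jacobiTheta₂ (2 * m * z + l * τ) (2 * m * τ) := by
  have hm : (m:Complex) ≠ 0 := NeZero.ne _
  rw [tsum_residue (2 * m) (fun r => ga m r τ z), jacobiTheta₂, ← tsum_mul_left]
  refine tsum_congr fun n => ?_
  rw [ga, jacobiTheta₂_term, ee, ee, ← Complex.exp_add]; congr 1; push_cast; field_simp; ring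
lemma Phi_eq_sum (m : Nat) [NeZero m] (C : Int → Zt m → Complex) {τ : Complex} (hτ : 0 < τ.im) (z : Complex) :
    Phi m C τ z = ∑ ll : Zt m, hh m C ll τ *
      ∑' r : Int, (if (r : Zt m) = ll then ga m r τ z else 0) := by
  simp only [← tsum_mul_left]
  rw [← Summable.tsum_finsetSum]
  · rw [Phi]
    refine tsum_congr fun r => ?_
    simp
  · intro ll _
    apply Summable.mul_left
    exact Summable.of_norm_bounded (summable_ga m hτ z).norm fun r => by
      split_ifs <;> simp
lemma Phi_diff (m : Nat) [NeZero m] {C : Int → Zt m → Complex} (h : PreVV m C) {τ : Complex} (hτ : 0 < τ.im) (z : Complex) :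
    DifferentiableAt Complex (fun p : Complex × Complex => Phi m C p.1 p.2) (τ, z) := by
  have hm : (0:Real) < m := by exact_mod_cast Nat.pos_of_ne_zero (NeZero.ne m)
  have h1 : DifferentiableAt Complex (fun p : Complex × Complex => ∑ ll : Zt m, hh m C ll p.1 *
      ∑' r : Int, (if (r : Zt m) = ll then ga m r p.1 p.2 else 0)) (τ, z) := by
    refine DifferentiableAt.fun_sum fun ll _ => ?_
    refine DifferentiableAt.mul ?_ ?_
    · exact DifferentiableAt.comp (τ, z) (f := Prod.fst) (hh_diff m h ll hτ) differentiableAt_fst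
    · obtain ⟨l, rfl⟩ := ZMod.intCast_surjective ll
      simp only [ga_residue]
      refine DifferentiableAt.mul (by unfold ee; fun_prop) ?_
      refine DifferentiableAt.comp (τ, z) (g := fun q : Complex × Complex => jacobiTheta₂ q.1 q.2)
        (f := fun p : Complex × Complex => (2 * m * p.2 + l * p.1, 2 * m * p.1)) ?_ (by fun_prop)
      refine (hasFDerivAt_jacobiTheta₂ _ ?_).differentiableAt
      simp_all
  refine h1.congr_of_eventuallyEq ?_
  have : {p : Complex × Complex | 0 < p.1.im} ∈ 𝓝 (τ, z) :=
    (isOpen_lt continuous_const (continuous_im.comp continuous_fst)).mem_nhds hτ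
  filter_upwards [this] with p hp
  exact Phi_eq_sum m C hp _
lemma Phi_elliptic (m : Nat) [NeZero m] (C : Int → Zt m → Complex) : EllipticLaw m (Phi m C) := by
  intro τ hτ z lam mu
  have hm : (m:Complex) ≠ 0 := NeZero.ne _
  rw [Phi, Phi, ← tsum_mul_left]
  conv_rhs => rw [← (Equiv.addRight (2 * (m:Int) * lam)).tsum_eq]
  refine tsum_congr fun r => ?_
  have h1 : ((r + 2 * (m:Int) * lam : Int) : Zt m) = r := by
    have : ((2 * m : Nat) : Zt m) = 0 := ZMod.natCast_self _
    push_cast at this ⊢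
    rw [this]; ring
  simp only [Equiv.coe_addRight, h1]
  rw [mul_left_comm]; congr 1
  have h2 : ga m r τ (z + lam * τ + mu) = ga m r τ (z + lam * τ) := by
    rw [ga, ga, mul_add, ← add_assoc, ee_add, show (r:Complex) * mu = ((r * mu : Int) : Complex) by push_cast; rfl,
      ee_int, mul_one]
  rw [h2, ga, ga, ← ee_add]; congr 1; push_cast; field_simp; ring
lemma Phi_T (m : Nat) [NeZero m] {C : Int → Zt m → Complex} (h : PreVV m C) (τ z : Complex) (hτ : 0 < τ.im) :
    Phi m C (τ + 1) z = Phi m C τ z := by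
  have h1 := Phi_hasSum m h (τ := τ + 1) (by simpa using hτ) z
  refine h1.unique ?_
  convert Phi_hasSum m h hτ z using 3 with p
  rw [show (p.1:Complex) * (τ + 1) + p.2 * z = p.1 + (p.1 * τ + p.2 * z) by ring, ee_add, ee_int, one_mul]
def GLaw (k : Int) (m : Nat) (φ : Complex → Complex → Complex) (a b c d : Int) : Prop :=
  ∀ τ : Complex, 0 < τ.im → ∀ z : Complex, φ ((a * τ + b) / (c * τ + d)) (z / (c * τ + d)) =
      ((c : Complex) * τ + d) ^ k * ee (m * c * z ^ 2 / (c * τ + d)) * φ τ z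
lemma den_ne {a b c d : Int} (h : a * d - b * c = 1) {τ : Complex} (hτ : 0 < τ.im) : (c : Complex) * τ + d ≠ 0 := by
  intro h0
  have h1 := congrArg Complex.im h0
  simp only [add_im, mul_im, intCast_re, intCast_im, zero_mul, add_zero, zero_im] at h1
  have hc : (c:Real) = 0 := by
    grind
  simp_all
lemma mob_im {a b c d : Int} (h : a * d - b * c = 1) {τ : Complex} (hτ : 0 < τ.im) :
    0 < ((a * τ + b) / (c * τ + d)).im := by
  have hd := den_ne h hτ
  have h1 : ((a * τ + b) / (c * τ + d)).im = τ.im / normSq (c * τ + d) := by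
    rw [Complex.div_im]
    have hR : ((a:Real) * d - b * c = 1) := by exact_mod_cast h
    simp only [add_im, mul_im, intCast_re, intCast_im, zero_mul, add_zero, add_re, mul_re, sub_zero]
    grind
  simp_all
lemma modularLaw_of {k : Int} {m : Nat} {φ : Complex → Complex → Complex} (hS : SLaw k m φ)
    (hT : ∀ τ z : Complex, 0 < τ.im → φ (τ + 1) z = φ τ z) : ModularLaw k m φ := by
  suffices H : ∀ g : Matrix.SpecialLinearGroup (Fin 2) Int, GLaw k m φ (g 0 0) (g 0 1) (g 1 0) (g 1 1) by
    intro τ hτ z a b c d h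
    have := H ⟨!![a, b; c, d], by rw [Matrix.det_fin_two_of]; exact h⟩ τ hτ z
    simpa using this
  intro g
  have hg : g ∈ Subgroup.closure ({ModularGroup.S, ModularGroup.T} : Set (Matrix.SpecialLinearGroup (Fin 2) Int)) := by
    rw [_root_.SpecialLinearGroup.SL2Z_generators]; trivial
  have hdet : ∀ g : Matrix.SpecialLinearGroup (Fin 2) Int, g 0 0 * g 1 1 - g 0 1 * g 1 0 = 1 := by
    intro g; rw [← Matrix.det_fin_two]; exact g.2
  induction hg using Subgroup.closure_induction with
  | mem x hx =>
    rcases hx with rfl | rfl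
    · intro τ hτ z
      have := hS τ z hτ
      simp only [ModularGroup.S, Matrix.SpecialLinearGroup.coe_mk, Matrix.of_apply, Matrix.cons_val', Matrix.cons_val_zero,
        Matrix.cons_val_one, Matrix.cons_val_fin_one]
      simpa using this
    · intro τ hτ z
      have := hT τ z hτ
      simp only [ModularGroup.T, Matrix.SpecialLinearGroup.coe_mk, Matrix.of_apply, Matrix.cons_val', Matrix.cons_val_zero,
        Matrix.cons_val_one, Matrix.cons_val_fin_one]
      simpa [ee_zero] using this
  | one => intro τ hτ z; simp [ee_zero]
  | mul x y _ _ hx hy =>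
    intro τ hτ z
    have h1 := hy τ hτ z
    have hdy := den_ne (hdet y) hτ
    have him := mob_im (hdet y) hτ
    have h2 := hx _ him (z / ((y 1 0 : Complex) * τ + (y 1 1 : Complex)))
    have hdx := den_ne (hdet x) him
    rw [h1] at h2
    have hdR : ((y 0 0 : Complex) * y 1 1 - y 0 1 * y 1 0 = 1) := by exact_mod_cast hdet y
    simp only [Matrix.SpecialLinearGroup.coe_mul, Matrix.mul_apply, Fin.sum_univ_two]
    push_cast
    set A := (y 0 0 : Complex); set B := (y 0 1 : Complex); set C := (y 1 0 : Complex); set D := (y 1 1 : Complex)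
    set a := (x 0 0 : Complex); set b := (x 0 1 : Complex); set c := (x 1 0 : Complex); set d := (x 1 1 : Complex)
    have ej : (c * A + d * C) * τ + (c * B + d * D) = (c * ((A * τ + B) / (C * τ + D)) + d) * (C * τ + D) := by
      field_simp; ring
    have en : (a * A + b * C) * τ + (a * B + b * D) = (a * ((A * τ + B) / (C * τ + D)) + b) * (C * τ + D) := by
      field_simp; ring
    rw [ej, en, mul_div_mul_right _ _ hdy, mul_comm (c * ((A * τ + B) / (C * τ + D)) + d) (C * τ + D), ← div_div, h2,
      mul_zpow]
    have h3 : ee (m * (c * A + d * C) * z ^ 2 / ((C * τ + D) * (c * ((A * τ + B) / (C * τ + D)) + d))) =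
       ee (m * c * (z / (C * τ + D)) ^ 2 / (c * ((A * τ + B) / (C * τ + D)) + d)) * ee (m * C * z ^ 2 / (C * τ + D)) := by
      rw [← ee_add]; congr 1
      have hdx' : c * (A * τ + B) + d * (C * τ + D) ≠ 0 := by
        grind
      grind
    rw [h3]; ring
  | inv x _ hx =>
    intro τ hτ z
    have hd := hdet x
    have hd' : (x 1 1) * (x 0 0) - (-(x 0 1)) * (-(x 1 0)) = 1 := by linarith
    have e00 : (x⁻¹) 0 0 = x 1 1 := by simp [Matrix.SpecialLinearGroup.SL2_inv_expl]
    have e01 : (x⁻¹) 0 1 = - x 0 1 := by simp [Matrix.SpecialLinearGroup.SL2_inv_expl]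
    have e10 : (x⁻¹) 1 0 = - x 1 0 := by simp [Matrix.SpecialLinearGroup.SL2_inv_expl]
    have e11 : (x⁻¹) 1 1 = x 0 0 := by simp [Matrix.SpecialLinearGroup.SL2_inv_expl]
    rw [e00, e01, e10, e11]
    have him := mob_im hd' hτ
    have hdn := den_ne hd' hτ
    have h2 := hx _ him (z / (((-(x 1 0) : Int) : Complex) * τ + (x 0 0 : Complex)))
    have hdx := den_ne hd him
    have hdR : ((x 0 0 : Complex) * x 1 1 - x 0 1 * x 1 0 = 1) := by exact_mod_cast hd
    push_cast at h2 hdn hdx ⊢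
    set a := (x 0 0 : Complex); set b := (x 0 1 : Complex); set c := (x 1 0 : Complex); set d := (x 1 1 : Complex)
    have ej : c * ((d * τ + -b) / (-c * τ + a)) + d = 1 / (-c * τ + a) := by
      grind
    have en : a * ((d * τ + -b) / (-c * τ + a)) + b = τ / (-c * τ + a) := by
      grind
    rw [ej, en, div_div_div_cancel_right₀ hdn, div_one, div_div_div_cancel_right₀ hdn, div_one] at h2
    rw [h2]
    have h3 : ee (m * -c * z ^ 2 / (-c * τ + a)) * ee (m * c * (z / (-c * τ + a)) ^ 2 / (1 / (-c * τ + a))) = 1 := by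
      rw [← ee_add]; convert ee_zero using 2
      grind
    have h4 : (-c * τ + a) ^ k * (1 / (-c * τ + a)) ^ k = 1 := by
      rw [← mul_zpow, mul_one_div_cancel hdn, one_zpow]
    linear_combination (-φ ((d * τ + -b) / (-c * τ + a)) (z / (-c * τ + a)) ) * h4 * (ee (m * -c * z ^ 2 / (-c * τ + a)) * ee (m * c * (z / (-c * τ + a)) ^ 2 / (1 / (-c * τ + a)))) - φ ((d * τ + -b) / (-c * τ + a)) (z / (-c * τ + a)) * h3
lemma IsVV.modular {k : Int} {m : Nat} [NeZero m] {C : Int → Zt m → Complex} (h : IsVV k m C) :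
    ModularLaw k m (Phi m C) := modularLaw_of h.sLaw (fun τ z hτ => Phi_T m h.toPreVV τ z hτ)
def PreVV.toEll {m : Nat} [NeZero m] {C : Int → Zt m → Complex} (h : PreVV m C) : EllFormData m where
  toFun := Phi m C
  coeff := fun Δ l => C Δ l
  holo := fun _ z hτ => Phi_diff m h hτ z
  elliptic := Phi_elliptic m C
  expansion := fun _ z hτ => Phi_hasSum m h hτ z
  periodic := by
    intro Δ l
    have : ((2 * m : Nat) : Zt m) = 0 := ZMod.natCast_self _
    push_cast at this ⊢
    rw [this, add_zero]
  support := by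
    intro Δ l hl
    by_contra hne
    exact hl (h.supp Δ l hne)
lemma mkVV {k : Int} {m : Nat} [NeZero m] (c : Int → Int → Complex) (φ : Complex → Complex → Complex)
    (hexp : ∀ τ z : Complex, 0 < τ.im → HasSum (fun p : Int × Int => c p.1 p.2 * ee (p.1 * τ + p.2 * z)) (φ τ z))
    (hE : EllipticLaw m φ) (hS : SLaw k m φ) (hb : ∃ M : Int, ∀ n r, n < -M → c n r = 0) :
    ∃ C : Int → Zt m → Complex, IsVV k m C ∧ (∀ n r : Int, C (4 * m * n - r ^ 2) r = c n r) ∧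
      ∀ τ z, 0 < τ.im → Phi m C τ z = φ τ z := by
  have hm : (m:Int) ≠ 0 := by exact_mod_cast NeZero.ne m
  have hm' : (m:Complex) ≠ 0 := NeZero.ne _
  have hell : ∀ lam n r : Int, c (n - lam * r) r = c (n + m * lam ^ 2) (r + 2 * m * lam) := by
    intro lam n r
    have key : (fun p : Int × Int => c (p.1 - lam * p.2) p.2) =
        (fun p : Int × Int => c (p.1 + m * lam ^ 2) (p.2 + 2 * m * lam)) := by
      have H1 : ∀ τ z : Complex, 0 < τ.im → HasSum (fun p : Int × Int => c (p.1 - lam * p.2) p.2 * ee (p.1 * τ + p.2 * z))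
          (φ τ (z + lam * τ + (0:Int))) := by
        intro τ z hτ
        have h1 := hexp τ (z + lam * τ + (0:Int)) hτ
        let e : Int × Int ≃ Int × Int := ⟨fun p => (p.1 - lam * p.2, p.2), fun p => (p.1 + lam * p.2, p.2),
          fun p => by simp, fun p => by simp⟩
        rw [← e.hasSum_iff] at h1
        convert h1 using 1
        funext p
        change _ = c (p.1 - lam * p.2) p.2 * _
        congr 2; simp only [e, Equiv.coe_fn_mk]; push_cast; ring
      have H2 : ∀ τ z : Complex, 0 < τ.im → HasSum (fun p : Int × Int => c (p.1 + m * lam ^ 2) (p.2 + 2 * m * lam) * ee (p.1 * τ + p.2 * z))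
          (φ τ (z + lam * τ + (0:Int))) := by
        intro τ z hτ
        rw [hE τ hτ z lam 0]
        have h1 := (hexp τ z hτ).mul_left (ee (-(m : Complex) * ((lam : Complex) ^ 2 * τ + 2 * (lam : Complex) * z)))
        let e : Int × Int ≃ Int × Int := ⟨fun p => (p.1 + m * lam ^ 2, p.2 + 2 * m * lam),
          fun p => (p.1 - m * lam ^ 2, p.2 - 2 * m * lam), fun p => by simp, fun p => by simp⟩
        rw [← e.hasSum_iff] at h1
        refine (Eq.subst (motive := fun f => HasSum f _) ?_ h1)
        funext p
        symm
        change _ = _ * (c (p.1 + m * lam ^ 2) (p.2 + 2 * m * lam) * _)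
        rw [mul_left_comm, ← ee_add]
        congr 2; simp only [e, Equiv.coe_fn_mk]; push_cast; ring
      refine double_unique _ _ (fun τ z hτ => (H1 τ z hτ).summable) (fun τ z hτ => (H2 τ z hτ).summable)
        (fun τ z hτ => ?_)
      exact (H1 τ z hτ).tsum_eq.trans (H2 τ z hτ).tsum_eq.symm
    exact congrFun key (n, r)
  let C : Int → Zt m → Complex := fun Δ ll =>
    if (4 * (m:Int)) ∣ Δ + (ll.val:Int) ^ 2 then c ((Δ + (ll.val:Int) ^ 2) / (4 * m)) ll.val else 0
  have hmod : ∀ r : Int, ∃ lam : Int, r = ((r : Zt m).val : Int) + 2 * m * lam := by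
    intro r
    have h1 : (((r : Zt m).val : Int) : Zt m) = (r : Zt m) := by simp
    obtain ⟨lam, hl⟩ := (ZMod.intCast_eq_intCast_iff_dvd_sub _ _ _).1 h1
    grind
  have hC : ∀ n r : Int, C (4 * m * n - r ^ 2) r = c n r := by
    intro n r
    obtain ⟨lam, hl⟩ := hmod r
    simp only [C]
    set v := ((r : Zt m).val : Int)
    have h1 : 4 * (m:Int) * n - r ^ 2 + v ^ 2 = 4 * m * (n - m * lam ^ 2 - lam * v) := by
      rw [hl]; ring
    simp_all
  have hpre : PreVV m C := by
    refine ⟨?_, ?_, ?_⟩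
    · intro Δ l hne
      simp only [C, ne_eq, ite_eq_right_iff, Classical.not_imp] at hne
      obtain ⟨lam, hl⟩ := hmod l
      set v := ((l : Zt m).val : Int)
      rw [hl, show Δ + (v + 2 * m * lam) ^ 2 = (Δ + v ^ 2) + 4 * m * (lam * v + m * lam ^ 2) by ring]
      simp_all
    · obtain ⟨M, hM⟩ := hb
      refine ⟨4 * m * (|M| + m), fun Δ ll hΔ => ?_⟩
      simp only [C, ite_eq_right_iff]
      rintro ⟨n, hn⟩
      rw [hn, Int.mul_ediv_cancel_left _ (mul_ne_zero four_ne_zero hm)]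
      apply hM
      have hv : (ll.val:Int) < 2 * m := by exact_mod_cast ZMod.val_lt ll
      have hv0 : (0:Int) ≤ ll.val := by positivity
      have hmp : (0:Int) < m := lt_of_le_of_ne (by positivity) hm.symm
      by_contra hcon
      push Not at hcon
      have h1 : -|M| ≤ n := by have := le_abs_self M; linarith
      nlinarith
    · intro ll τ hτ
      have h1 := (hexp τ 0 hτ).summable
      simp only [mul_zero, add_zero] at h1
      have h2 : Summable fun n : Int => c n ll.val * ee (n * τ) :=
        ((Equiv.prodComm Int Int).summable_iff.2 h1).prod_factor (ll.val:Int)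
      have hinj : Function.Injective fun n : Int => 4 * (m:Int) * n - (ll.val:Int) ^ 2 := by
        intro a b h
        simp_all
      rw [← hinj.summable_iff]
      · refine (h2.mul_right (ee (-(ll.val:Complex) ^ 2 / (4 * m) * τ))).congr fun n => ?_
        have := hC n ll.val
        rw [show (((ll.val : Nat) : Int) : Zt m) = ll by simp] at this
        simp only [Function.comp]
        rw [this, mul_assoc, ← ee_add]; congr 2; push_cast; field_simp; ring
      · intro Δ hΔ
        have : C Δ ll = 0 := by
          simp only [C, ite_eq_right_iff]
          rintro ⟨n, hn⟩
          exact absurd ⟨n, by simp only; linarith⟩ hΔ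
        rw [this, zero_mul]
  have hPhi : ∀ τ z, 0 < τ.im → Phi m C τ z = φ τ z := by
    intro τ z hτ
    have := Phi_hasSum m hpre hτ z
    simp only [hC] at this
    exact this.unique (hexp τ z hτ)
  refine ⟨C, hpre.isVV ?_, hC, hPhi⟩
  intro τ z hτ
  rw [hPhi _ _ hτ, hPhi _ _ (im_S_pos hτ), hS τ z hτ]
lemma sLaw_of_modular {k : Int} {m : Nat} {φ : Complex → Complex → Complex} (h : ModularLaw k m φ) : SLaw k m φ := by
  intro τ z hτ
  have := h τ hτ z 0 (-1) 1 0 (by norm_num)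
  simpa using this
lemma ell_toVV {k : Int} {m : Nat} [NeZero m] (F : EllFormData m) (hM : ModularLaw k m F.toFun)
    (hW : IsWeakC m F.coeff) : ∃ C, IsVV k m C ∧ ∀ Δ l : Int, C Δ l = F.coeff Δ l := by
  obtain ⟨C, h1, h2, -⟩ := mkVV (fun n r => F.coeff (4 * m * n - r ^ 2) r) F.toFun F.expansion F.elliptic
    (sLaw_of_modular hM) ⟨0, fun n r hn => hW n r (by simpa using hn)⟩
  refine ⟨C, h1, fun Δ l => ?_⟩
  by_cases hd : (4 * (m:Int)) ∣ Δ + l ^ 2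
  · obtain ⟨n, hn⟩ := hd
    have := h2 n l
    grind
  · rw [F.support Δ l hd]
    by_contra hne
    exact hd (h1.supp Δ l hne)
lemma IsVV.even {k : Int} {m : Nat} [NeZero m] {C : Int → Zt m → Complex} (h : IsVV k m C) (hk : Even k)
    (Δ : Int) (ll : Zt m) : C Δ (-ll) = C Δ ll := by
  have hev : ∀ τ z : Complex, 0 < τ.im → Phi m C τ (-z) = Phi m C τ z := by
    intro τ z hτ
    have := h.modular τ hτ z (-1) 0 0 (-1) (by norm_num)
    simpa [hk.neg_one_zpow, div_neg, ee_zero] using this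
  have key : (fun p : Int × Int => C (4 * m * p.1 - p.2 ^ 2) ((-p.2 : Int) : Zt m)) =
      fun p : Int × Int => C (4 * m * p.1 - p.2 ^ 2) p.2 := by
    have H1 : ∀ τ z : Complex, 0 < τ.im → HasSum (fun p : Int × Int => C (4 * m * p.1 - p.2 ^ 2) ((-p.2 : Int) : Zt m)
        * ee (p.1 * τ + p.2 * z)) (Phi m C τ z) := by
      intro τ z hτ
      have h1 := Phi_hasSum m h.toPreVV hτ (-z)
      rw [hev τ z hτ] at h1
      rw [← ((Equiv.refl Int).prodCongr (Equiv.neg Int)).hasSum_iff] at h1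
      convert h1 using 2 with p
      simp
    have H2 := fun τ z hτ => Phi_hasSum m h.toPreVV (τ := τ) hτ z
    refine double_unique _ _ (fun τ z hτ => (H1 τ z hτ).summable) (fun τ z hτ => (H2 τ z hτ).summable)
      (fun τ z hτ => (H1 τ z hτ).tsum_eq.trans (H2 τ z hτ).tsum_eq.symm)
  obtain ⟨l, rfl⟩ := ZMod.intCast_surjective ll
  by_cases hd : (4 * (m:Int)) ∣ Δ + l ^ 2
  · obtain ⟨n, hn⟩ := hd
    have := congrFun key (n, l)
    simp only [show 4 * m * n - l ^ 2 = Δ by linarith, Int.cast_neg] at this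
    exact this
  · have e1 : C Δ l = 0 := by
      by_contra hne
      exact hd (h.supp Δ l hne)
    have e2 : C Δ ((-l : Int) : Zt m) = 0 := by
      by_contra hne
      exact hd (by simpa using h.supp Δ (-l) hne)
    rw [e1, ← e2]; simp
lemma PreVV.hh_add {m : Nat} {C C' : Int → Zt m → Complex} (h : PreVV m C) (h' : PreVV m C') (ll : Zt m)
    {τ : Complex} (hτ : 0 < τ.im) :
    hh m (fun Δ ll => C Δ ll + C' Δ ll) ll τ = hh m C ll τ + hh m C' ll τ := by
  rw [hh, hh, hh, ← (h.conv ll τ hτ).tsum_add (h'.conv ll τ hτ)]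
  exact tsum_congr fun Δ => by ring
lemma PreVV.add {m : Nat} {C C' : Int → Zt m → Complex} (h : PreVV m C) (h' : PreVV m C') :
    PreVV m (fun Δ ll => C Δ ll + C' Δ ll) where
  supp := by
    intro Δ l h0
    by_contra hd
    apply h0
    rw [not_not.1 (mt (h.supp Δ l) hd), not_not.1 (mt (h'.supp Δ l) hd), add_zero]
  bdd := by
    obtain ⟨B, hB⟩ := h.bdd
    obtain ⟨B', hB'⟩ := h'.bdd
    refine ⟨max B B', fun Δ ll hΔ => ?_⟩
    grind
  conv := by
    intro ll τ hτ
    refine ((h.conv ll τ hτ).add (h'.conv ll τ hτ)).congr fun Δ => by ring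
lemma IsVV.add {k : Int} {m : Nat} [NeZero m] {C C' : Int → Zt m → Complex} (h : IsVV k m C) (h' : IsVV k m C') :
    IsVV k m (fun Δ ll => C Δ ll + C' Δ ll) where
  toPreVV := h.toPreVV.add h'.toPreVV
  slaw := by
    intro τ hτ ll'
    simp only [h.toPreVV.hh_add h'.toPreVV _ hτ, h.toPreVV.hh_add h'.toPreVV _ (im_S_pos hτ), mul_add,
      Finset.sum_add_distrib, h.slaw τ hτ, h'.slaw τ hτ]
lemma hh_smul {m : Nat} (a : Complex) (C : Int → Zt m → Complex) (ll : Zt m) (τ : Complex) :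
    hh m (fun Δ ll => a * C Δ ll) ll τ = a * hh m C ll τ := by
  rw [hh, hh, ← tsum_mul_left]
  exact tsum_congr fun Δ => by ring
lemma PreVV.smul {m : Nat} {C : Int → Zt m → Complex} (a : Complex) (h : PreVV m C) :
    PreVV m (fun Δ ll => a * C Δ ll) where
  supp := fun Δ l h0 => h.supp Δ l (right_ne_zero_of_mul h0)
  bdd := by
    obtain ⟨B, hB⟩ := h.bdd
    exact ⟨B, fun Δ ll hΔ => by rw [hB Δ ll hΔ, mul_zero]⟩
  conv := by
    intro ll τ hτ
    exact ((h.conv ll τ hτ).mul_left a).congr fun Δ => by ring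
lemma IsVV.smul {k : Int} {m : Nat} [NeZero m] {C : Int → Zt m → Complex} (a : Complex) (h : IsVV k m C) :
    IsVV k m (fun Δ ll => a * C Δ ll) where
  toPreVV := h.toPreVV.smul a
  slaw := by
    intro τ hτ ll'
    simp only [hh_smul]
    rw [mul_left_comm, ← h.slaw τ hτ, Finset.mul_sum, Finset.mul_sum, Finset.mul_sum]
    grind
lemma isVV_zero (k : Int) (m : Nat) [NeZero m] : IsVV k m (fun _ _ => 0) where
  supp := fun _ _ h => absurd rfl h
  bdd := ⟨0, fun _ _ _ => rfl⟩
  conv := fun _ _ _ => by simpa using summable_zero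
  slaw := fun _ _ _ => by simp [hh]
lemma IsVV.sum {k : Int} {m : Nat} [NeZero m] {ι : Type*} (s : Finset ι) (C : ι → Int → Zt m → Complex)
    (h : ∀ i ∈ s, IsVV k m (C i)) : IsVV k m (fun Δ ll => ∑ i ∈ s, C i Δ ll) := by
  induction s using Finset.induction_on with
  | empty => simpa using isVV_zero k m
  | insert a s ha ih =>
    simp only [Finset.sum_insert ha]
    exact (h a (Finset.mem_insert_self _ _)).add (ih fun i hi => h i (Finset.mem_insert_of_mem hi))
lemma IsVV.mat {k : Int} {m : Nat} [NeZero m] {C : Int → Zt m → Complex} (h : IsVV k m C)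
    (M : Zt m → Zt m → Complex)
    (hM : ∀ l l2 : Int, M l l2 ≠ 0 → (4 * (m:Int)) ∣ l ^ 2 - l2 ^ 2)
    (hc : ∀ ll'' ll', ∑ ll, ZMod.stdAddChar (-(ll * ll')) * M ll ll'' =
      ∑ ll, M ll' ll * (ZMod.stdAddChar (-(ll'' * ll)) : Complex)) :
    IsVV k m (fun Δ ll => ∑ ll2, M ll ll2 * C Δ ll2) := by
  have hhh : ∀ ll τ, 0 < τ.im → hh m (fun Δ ll => ∑ ll2, M ll ll2 * C Δ ll2) ll τ = ∑ ll2, M ll ll2 * hh m C ll2 τ := by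
    intro ll τ hτ
    simp only [hh, ← tsum_mul_left]
    rw [← Summable.tsum_finsetSum (fun ll2 _ => (h.conv ll2 τ hτ).mul_left _)]
    refine tsum_congr fun Δ => ?_
    rw [Finset.sum_mul]
    grind
  refine ⟨⟨?_, ?_, ?_⟩, ?_⟩
  · intro Δ l h0
    obtain ⟨ll2, -, h2⟩ := Finset.exists_ne_zero_of_sum_ne_zero h0
    obtain ⟨l2, rfl⟩ := ZMod.intCast_surjective ll2
    have h3 := hM l l2 (left_ne_zero_of_mul h2)
    have h4 := h.supp Δ l2 (right_ne_zero_of_mul h2)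
    have := dvd_add h4 h3
    grind
  · obtain ⟨B, hB⟩ := h.bdd
    exact ⟨B, fun Δ ll hΔ => Finset.sum_eq_zero fun ll2 _ => by rw [hB Δ ll2 hΔ, mul_zero]⟩
  · intro ll τ hτ
    refine (summable_sum (s := Finset.univ) fun ll2 _ => (h.conv ll2 τ hτ).mul_left (M ll ll2)).congr fun Δ => ?_
    rw [Finset.sum_mul]
    grind
  · intro τ hτ ll'
    simp only [hhh _ _ hτ, hhh _ _ (im_S_pos hτ)]
    have e1 : ∀ ll, τ ^ k * (M ll' ll * hh m C ll τ) = kap m τ * ∑ ll'', M ll' ll * ((ZMod.stdAddChar (-(ll'' * ll)) : Complex) * hh m C ll'' (-1 / τ)) := by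
      intro ll
      rw [mul_left_comm, ← h.slaw τ hτ, ← Finset.mul_sum]; ring
    rw [Finset.mul_sum (a := τ ^ k), Finset.sum_congr rfl (fun ll _ => e1 ll), ← Finset.mul_sum, Finset.sum_comm]
    congr 1
    have e2 : ∀ ll'', ∑ ll, M ll' ll * ((ZMod.stdAddChar (-(ll'' * ll)) : Complex) * hh m C ll'' (-1 / τ)) =
        (∑ ll, ZMod.stdAddChar (-(ll * ll')) * M ll ll'') * hh m C ll'' (-1 / τ) := by
      intro ll''
      rw [hc, Finset.sum_mul]
      grind
    rw [Finset.sum_congr rfl (fun ll _ => e2 ll)]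
    simp only [Finset.mul_sum, Finset.sum_mul]
    rw [Finset.sum_comm]
    grind
lemma zmod_dvd_iff (m : Nat) (a : Int) : (a : Zt m) = 0 ↔ (2 * (m:Int)) ∣ a := by
  rw [ZMod.intCast_zmod_eq_zero_iff_dvd]; push_cast; rfl
lemma sq_congr (m : Nat) {a b : Int} (h : (a : Zt m) = b) : (4 * (m:Int)) ∣ a ^ 2 - b ^ 2 := by
  have : ((a - b : Int) : Zt m) = 0 := by push_cast; rw [h, sub_self]
  obtain ⟨t, ht⟩ := (zmod_dvd_iff m _).1 this
  exact ⟨t * (b + m * t), by rw [show a = b + 2 * m * t by linarith]; ring⟩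
lemma IsVV.W {k : Int} {m : Nat} [NeZero m] {C : Int → Zt m → Complex} (h : IsVV k m C) (ξ : Int)
    (hξ : (4 * (m:Int)) ∣ ξ ^ 2 - 1) : IsVV k m (fun Δ ll => C Δ (ξ * ll)) := by
  have h1 : (ξ : Zt m) * ξ = 1 := by
    have : ((ξ ^ 2 - 1 : Int) : Zt m) = 0 := (zmod_dvd_iff m _).2 (dvd_trans ⟨2, by ring⟩ hξ)
    push_cast at this
    linear_combination this
  have := h.mat (fun ll ll2 => if ll2 = ξ * ll then 1 else 0) ?_ ?_
  · simpa using this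
  · intro l l2 h0
    have h2 : (l2 : Zt m) = ((ξ * l : Int) : Zt m) := by
      grind
    have h3 := sq_congr m h2
    have h4 := dvd_add h3 (hξ.mul_right (l ^ 2))
    rw [← dvd_neg]
    convert h4 using 1
    ring
  · intro ll'' ll'
    have : ∀ ll, (ll'' = ξ * ll) ↔ (ll = ξ * ll'') := fun ll =>
      ⟨fun e => by rw [e, ← mul_assoc, h1, one_mul], fun e => by rw [e, ← mul_assoc, h1, one_mul]⟩
    simp only [this, mul_ite, mul_one, mul_zero, ite_mul, one_mul, zero_mul, Finset.sum_ite_eq', Finset.mem_univ, if_true]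
    congr 2; ring
lemma char_sum {N q : Nat} [NeZero N] (x : ZMod N) (hx : (q : ZMod N) * x = 0) :
    ∑ s ∈ Finset.range q, (ZMod.stdAddChar ((s : ZMod N) * x) : Complex) = if x = 0 then (q:Complex) else 0 := by
  split_ifs with h0
  · subst h0; simp
  · have e : ∀ s : Nat, (ZMod.stdAddChar ((s : ZMod N) * x) : Complex) = (ZMod.stdAddChar x : Complex) ^ s := by
      intro s
      rw [← AddChar.map_nsmul_eq_pow, nsmul_eq_mul]
    simp only [e]
    have h1 : (ZMod.stdAddChar x : Complex) ≠ 1 := by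
      intro h
      apply h0
      apply ZMod.injective_stdAddChar
      simp_all
    have h2 : (ZMod.stdAddChar x : Complex) ^ q = 1 := by rw [← e, hx, AddChar.map_zero_eq_one]
    rw [geom_sum_eq h1, h2, sub_self, zero_div]
def Aq (m : Nat) (t q : Nat) (C : Int → Zt m → Complex) : Int → Zt m → Complex := fun Δ ll =>
  if (t : Zt m) * ll = 0 then ∑ s ∈ Finset.range q, C Δ (ll + s * t) else 0
lemma IsVV.Aq {k : Int} {m : Nat} [NeZero m] {C : Int → Zt m → Complex} (h : IsVV k m C) {t q : Nat} (hq : 0 < q)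
    (htq : t * q = 2 * m) (hqm : q ^ 2 ∣ m) : IsVV k m (Aq m t q C) := by
  obtain ⟨w, hw⟩ := hqm
  have ht : t = 2 * w * q := by
    nlinarith
  have h0 : ((2 * m : Nat) : Zt m) = 0 := ZMod.natCast_self _
  have hqt : (q : Zt m) * t = 0 := by
    have h1 : ((t * q : Nat) : Zt m) = 0 := by rw [htq]; exact h0
    grind
  have htt : (t : Zt m) * t = 0 := by
    calc (t : Zt m) * t = 2 * w * (q * t) := by nth_rewrite 1 [ht]; push_cast; ring
      _ = 0 := by rw [hqt, mul_zero]
  have := h.mat (fun ll ll2 => if (t : Zt m) * ll = 0 then ∑ s ∈ Finset.range q, if ll2 = ll + s * t then 1 else 0 else 0) ?_ ?_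
  · convert this using 3 with Δ ll
    rw [_root_.Aq]
    split_ifs with h1
    · simp only [Finset.sum_mul]
      rw [Finset.sum_comm]
      simp
    · simp
  · intro l l2 h1
    have h2 : (t : Zt m) * l = 0 := by by_contra h2; exact h1 (if_neg h2)
    rw [if_pos h2] at h1
    obtain ⟨s, -, h3⟩ := Finset.exists_ne_zero_of_sum_ne_zero h1
    have h4 : (l2 : Zt m) = ((l + s * t : Int) : Zt m) := by
      simp_all
    have h5 := sq_congr m h4
    have h6 : (2 * (m:Int)) ∣ t * l := (zmod_dvd_iff m _).1 (by push_cast; exact h2)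
    have h7 : (4 * (m:Int)) ∣ t ^ 2 := ⟨w, by rw [ht, hw]; push_cast; ring⟩
    obtain ⟨a, ha⟩ := h5
    obtain ⟨b, hb⟩ := h6
    obtain ⟨c, hc⟩ := h7
    exact ⟨-a - s * b - s ^ 2 * c, by linear_combination (-1) * ha - 2 * s * hb - s ^ 2 * hc⟩
  · intro ll'' ll'
    have e1 : ∀ ll : Zt m, (ZMod.stdAddChar (-(ll * ll')) : Complex) * (if (t : Zt m) * ll = 0 then ∑ s ∈ Finset.range q, if ll'' = ll + s * t then (1:Complex) else 0 else 0)
        = ∑ s ∈ Finset.range q, if ll = ll'' - (s : Zt m) * t then (if (t : Zt m) * ll = 0 then (ZMod.stdAddChar (-(ll * ll')) : Complex) else 0) else 0 := by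
      intro ll
      split_ifs with h1
      · rw [Finset.mul_sum]
        grind
      · simp
    simp only [e1]
    rw [Finset.sum_comm]
    simp only [Finset.sum_ite_eq', Finset.mem_univ, if_true]
    have e2 : ∀ s : Nat, (t : Zt m) * (ll'' - s * t) = t * ll'' := by
      grind
    have e3 : ∀ s : Nat, (ZMod.stdAddChar (-((ll'' - (s : Zt m) * (t : Zt m)) * ll')) : Complex) = ZMod.stdAddChar (-(ll'' * ll')) * ZMod.stdAddChar ((s : Zt m) * ((t : Zt m) * ll')) := by
      intro s; rw [← AddChar.map_add_eq_mul]; congr 1; ring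
    simp only [e2, e3]
    have e4 : (∑ s ∈ Finset.range q, if (t : Zt m) * ll'' = 0 then (ZMod.stdAddChar (-(ll'' * ll')) : Complex) * ZMod.stdAddChar ((s : Zt m) * ((t : Zt m) * ll')) else 0)
        = if (t : Zt m) * ll'' = 0 then (if (t : Zt m) * ll' = 0 then (q:Complex) * ZMod.stdAddChar (-(ll'' * ll')) else 0) else 0 := by
      split_ifs with h1 h2
      · rw [← Finset.mul_sum, char_sum _ (by rw [← mul_assoc, hqt, zero_mul]), if_pos h2, mul_comm]
      · rw [← Finset.mul_sum, char_sum _ (by rw [← mul_assoc, hqt, zero_mul]), if_neg h2, mul_zero]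
      · simp
    rw [e4]
    by_cases h2 : (t : Zt m) * ll' = 0
    · simp only [h2, if_true]
      simp only [Finset.sum_mul]
      rw [Finset.sum_comm]
      simp only [ite_mul, one_mul, zero_mul, Finset.sum_ite_eq', Finset.mem_univ, if_true]
      have e5 : ∀ s : Nat, (ZMod.stdAddChar (-(ll'' * (ll' + (s : Zt m) * (t : Zt m)))) : Complex) = ZMod.stdAddChar (-(ll'' * ll')) * ZMod.stdAddChar ((s : Zt m) * (-((t : Zt m) * ll''))) := by
        intro s; rw [← AddChar.map_add_eq_mul]; congr 1; ring
      simp only [e5]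
      rw [← Finset.mul_sum, char_sum _ (by rw [mul_neg, ← mul_assoc, hqt, zero_mul, neg_zero])]
      grind
    · simp [h2]
def Up (m p : Nat) (C : Int → ZMod (2 * (m * p ^ 2)) → Complex) : Int → Zt m → Complex := fun Δ ll =>
  ∑ s ∈ Finset.range p, C (Δ * (p:Int) ^ 2) ((p * (ll.val + 2 * m * s) : Nat) : ZMod (2 * (m * p ^ 2)))
lemma kap_mul (m p : Nat) [NeZero m] [NeZero p] (τ : Complex) : kap (m * p ^ 2) τ * p = kap m τ := by
  have hp : (p:Complex) ≠ 0 := NeZero.ne _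
  have hm : (m:Complex) ≠ 0 := NeZero.ne _
  rw [kap, kap, show -I * (τ / (2 * m)) = (((p:Real) ^ 2 : Real) : Complex) * (-I * (τ / (2 * ((m * p ^ 2 : Nat) : Complex)))) by
    push_cast; field_simp]
  rw [mul_comm]
  by_cases h0 : (-I * (τ / (2 * ((m * p ^ 2 : Nat) : Complex)))) = 0
  · rw [h0]; simp
  have h1 : (((p:Real) ^ 2 : Real) : Complex) ≠ 0 := by push_cast; exact pow_ne_zero 2 hp
  have hp2 : (0:Real) < p := by exact_mod_cast Nat.pos_of_ne_zero (NeZero.ne p)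
  rw [cpow_def_of_ne_zero h0, cpow_def_of_ne_zero (mul_ne_zero h1 h0), log_ofReal_mul (by positivity) h0,
    Real.log_pow, add_mul, Complex.exp_add]
  congr 1
  rw [show ((((2:Nat):Real) * Real.log (p:Real) : Real) : Complex) * (1 / 2) = ((Real.log (p:Real) : Real) : Complex) by push_cast; ring, ← ofReal_exp, Real.exp_log hp2]
  simp
lemma up_dvd {m p : Nat} [NeZero m] [NeZero p] {Δ l : Int} (h : (4 * ((m * p ^ 2 : Nat) : Int)) ∣ Δ + (p * l) ^ 2) :
    ∃ Δ' : Int, Δ = Δ' * (p:Int) ^ 2 ∧ (4 * (m:Int)) ∣ Δ' + l ^ 2 := by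
  have hp : (p:Int) ≠ 0 := by exact_mod_cast NeZero.ne p
  obtain ⟨t, ht⟩ := h
  push_cast at ht
  exact ⟨4 * m * t - l ^ 2, by linear_combination ht, ⟨t, by ring⟩⟩
lemma up_hasSum {m p : Nat} [NeZero m] [NeZero p] {C : Int → ZMod (2 * (m * p ^ 2)) → Complex} (h : PreVV (m * p ^ 2) C)
    (i : Nat) {τ : Complex} (hτ : 0 < τ.im) :
    HasSum (fun Δ : Int => C (Δ * (p:Int) ^ 2) ((p * i : Nat) : ZMod (2 * (m * p ^ 2))) * ee (Δ / (4 * m) * τ))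
      (hh (m * p ^ 2) C ((p * i : Nat) : ZMod (2 * (m * p ^ 2))) τ) := by
  have hp : (p:Int) ≠ 0 := by exact_mod_cast NeZero.ne p
  have hp' : (p:Complex) ≠ 0 := NeZero.ne _
  have hm : (m:Complex) ≠ 0 := NeZero.ne _
  have hinj : Function.Injective fun Δ : Int => Δ * (p:Int) ^ 2 := fun a b hab =>
    mul_right_cancel₀ (pow_ne_zero 2 hp) hab
  have h1 := (h.conv ((p * i : Nat) : ZMod (2 * (m * p ^ 2))) τ hτ).hasSum
  rw [← hinj.hasSum_iff] at h1
  · convert h1 using 2 with Δ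
    simp only [Function.comp]
    congr 2
    push_cast
    field_simp
    rfl
  · intro Δ hΔ
    by_contra h0
    have h2 := h.supp Δ (p * i : Int) (by
      intro h3; apply h0; rw [show ((p * i : Nat) : ZMod (2 * (m * p ^ 2))) = ((p * i : Int) : ZMod (2 * (m * p ^ 2))) by push_cast; rfl, h3, zero_mul])
    obtain ⟨Δ', h4, -⟩ := up_dvd h2
    exact hΔ ⟨Δ', h4.symm⟩
lemma up_sum (m p : Nat) [NeZero m] [NeZero p] (f : ZMod (2 * (m * p ^ 2)) → Complex) :
    ∑ ll : Zt m, ∑ s ∈ Finset.range p, f ((p * (ll.val + 2 * m * s) : Nat) : ZMod (2 * (m * p ^ 2))) =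
    ∑ L : ZMod (2 * (m * p ^ 2)), if ((2 * m * p : Nat) : ZMod (2 * (m * p ^ 2))) * L = 0 then f L else 0 := by
  have hp : 0 < p := Nat.pos_of_ne_zero (NeZero.ne p)
  have hm : 0 < m := Nat.pos_of_ne_zero (NeZero.ne m)
  rw [← Finset.sum_product', ← Finset.sum_filter]
  have hlt : ∀ ll : Zt m, ∀ s < p, p * (ll.val + 2 * m * s) < 2 * (m * p ^ 2) := by
    intro ll s hs
    have h1 := ll.val_lt
    calc p * (ll.val + 2 * m * s) < p * (2 * m + 2 * m * s) := by gcongr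
      _ = p * (2 * m) * (s + 1) := by ring
      _ ≤ p * (2 * m) * p := by gcongr; omega
      _ = _ := by ring
  refine Finset.sum_bij' (fun x _ => ((p * (x.1.val + 2 * m * x.2) : Nat) : ZMod (2 * (m * p ^ 2))))
    (fun L _ => (((L.val / p : Nat) : Zt m), L.val / p / (2 * m))) ?_ ?_ ?_ ?_ ?_
  · intro x _
    simp only [Finset.mem_filter, Finset.mem_univ, true_and]
    rw [← Nat.cast_mul, ZMod.natCast_eq_zero_iff]
    exact ⟨x.1.val + 2 * m * x.2, by ring⟩
  · intro L _
    simp only [Finset.mem_product, Finset.mem_univ, true_and, Finset.mem_range]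
    have := L.val_lt
    rw [Nat.div_lt_iff_lt_mul (by positivity), Nat.div_lt_iff_lt_mul hp]
    linarith
  · intro x hx
    simp only [Finset.mem_product, Finset.mem_univ, true_and, Finset.mem_range] at hx
    have h1 := x.1.val_lt
    rw [ZMod.val_natCast, Nat.mod_eq_of_lt (hlt _ _ hx), Nat.mul_div_cancel_left _ hp,
      Nat.add_mul_div_left _ _ (by positivity), Nat.div_eq_of_lt h1, zero_add]
    simp
  · intro L hL
    simp only [Finset.mem_filter, Finset.mem_univ, true_and] at hL
    obtain ⟨j, rfl⟩ : ∃ j : Nat, (j : ZMod (2 * (m * p ^ 2))) = L := ⟨L.val, by simp⟩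
    rw [← Nat.cast_mul, ZMod.natCast_eq_zero_iff, show 2 * (m * p ^ 2) = 2 * m * p * p by ring] at hL
    have hj : p ∣ j := Nat.dvd_of_mul_dvd_mul_left (by positivity) hL
    have hj2 : p ∣ (j : ZMod (2 * (m * p ^ 2))).val := by
      rw [ZMod.val_natCast]
      exact (Nat.dvd_mod_iff ⟨2 * m * p, by ring⟩).2 hj
    simp only [ZMod.val_natCast (2 * m)]
    rw [Nat.mod_add_div, Nat.mul_div_cancel' hj2]
    simp
  · intro x _; rfl
lemma IsVV.Up {k : Int} {m p : Nat} [NeZero m] [NeZero p] {C : Int → ZMod (2 * (m * p ^ 2)) → Complex}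
    (h : IsVV k (m * p ^ 2) C) : IsVV k m (Up m p C) := by
  have hhU : ∀ ll τ, 0 < τ.im → HasSum (fun Δ : Int => _root_.Up m p C Δ ll * ee (Δ / (4 * m) * τ))
      (∑ s ∈ Finset.range p, hh (m * p ^ 2) C ((p * (ll.val + 2 * m * s) : Nat) : ZMod (2 * (m * p ^ 2))) τ) := by
    intro ll τ hτ
    simp only [_root_.Up, Finset.sum_mul]
    exact hasSum_sum fun s _ => up_hasSum h.toPreVV _ hτ
  have hp : (p:Int) ≠ 0 := by exact_mod_cast NeZero.ne p
  refine ⟨⟨?_, ?_, fun ll τ hτ => (hhU ll τ hτ).summable⟩, ?_⟩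
  · intro Δ l h0
    obtain ⟨s, -, h1⟩ := Finset.exists_ne_zero_of_sum_ne_zero h0
    have h2 := h.supp (Δ * (p:Int) ^ 2) (p * (((l : Zt m).val : Int) + 2 * m * s) : Int) (by
      convert h1 using 2; push_cast; rfl)
    obtain ⟨Δ', h3, h4⟩ := up_dvd h2
    obtain rfl : Δ = Δ' := mul_right_cancel₀ (pow_ne_zero 2 hp) h3
    have h5 : (((((l : Zt m).val : Int) + 2 * m * s : Int)) : Zt m) = l := by
      have h0 : ((2 * m : Nat) : Zt m) = 0 := ZMod.natCast_self _
      push_cast at h0 ⊢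
      simp_all
    have h6 := sq_congr m h5
    have := dvd_sub h4 h6
    grind
  · obtain ⟨B, hB⟩ := h.bdd
    refine ⟨|B|, fun Δ ll hΔ => Finset.sum_eq_zero fun s _ => hB _ _ ?_⟩
    have : (1:Int) ≤ (p:Int) ^ 2 := by
      have := sq_pos_of_ne_zero hp
      omega
    have := le_abs_self B
    have := abs_nonneg B
    nlinarith
  · intro τ hτ ll'
    have e1 : ∀ ll τ, 0 < τ.im → hh m (_root_.Up m p C) ll τ = _ := fun ll τ hτ => (hhU ll τ hτ).tsum_eq
    simp only [e1 _ _ hτ, e1 _ _ (im_S_pos hτ)]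
    conv_rhs => rw [Finset.mul_sum]
    simp only [← h.slaw τ hτ]
    rw [← Finset.mul_sum]
    conv_rhs => rw [Finset.sum_comm]
    have e2 : ∀ L : ZMod (2 * (m * p ^ 2)), ∑ s ∈ Finset.range p, ZMod.stdAddChar (-(L * ((p * (ll'.val + 2 * m * s) : Nat) : ZMod (2 * (m * p ^ 2))))) * hh (m * p ^ 2) C L (-1 / τ)
        = if ((2 * m * p : Nat) : ZMod (2 * (m * p ^ 2))) * L = 0 then p * (ZMod.stdAddChar (-(L * ((p * ll'.val : Nat) : ZMod (2 * (m * p ^ 2))))) * hh (m * p ^ 2) C L (-1 / τ)) else 0 := by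
      intro L
      have e3 : ∀ s : Nat, (ZMod.stdAddChar (-(L * ((p * (ll'.val + 2 * m * s) : Nat) : ZMod (2 * (m * p ^ 2))))) : Complex) =
          ZMod.stdAddChar (-(L * ((p * ll'.val : Nat) : ZMod (2 * (m * p ^ 2))))) * ZMod.stdAddChar ((s : ZMod (2 * (m * p ^ 2))) * (-(((2 * m * p : Nat) : ZMod (2 * (m * p ^ 2))) * L))) := by
        intro s; rw [← AddChar.map_add_eq_mul]; congr 1; push_cast; ring
      simp only [e3]
      rw [← Finset.sum_mul, ← Finset.mul_sum, char_sum]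
      · simp only [neg_eq_zero, ite_mul, zero_mul, mul_ite, mul_zero]
        split_ifs
        · ring
        · rfl
      · have hz : ((p * (2 * m * p) : Nat) : ZMod (2 * (m * p ^ 2))) = 0 := (ZMod.natCast_eq_zero_iff _ _).2 ⟨1, by ring⟩
        grind
    simp only [e2]
    rw [← up_sum m p (fun L => (p:Complex) * (ZMod.stdAddChar (-(L * ((p * ll'.val : Nat) : ZMod (2 * (m * p ^ 2))))) * hh (m * p ^ 2) C L (-1 / τ)))]
    rw [← kap_mul m p, mul_assoc]
    congr 1
    rw [Finset.mul_sum]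
    refine Finset.sum_congr rfl fun ll _ => ?_
    rw [Finset.mul_sum, Finset.mul_sum]
    refine Finset.sum_congr rfl fun s _ => ?_
    congr 2
    rw [← Nat.cast_mul]
    have h1 := chi_ee (2 * (m * p ^ 2)) (-((p * (ll.val + 2 * m * s) * (p * ll'.val) : Nat) : Int))
    have h2 := chi_ee (2 * m) (-(((ll.val + 2 * m * s) * ll'.val : Nat) : Int))
    have h3 : ((-(((ll.val + 2 * m * s) * ll'.val : Nat) : Int) : Int) : Zt m) = -(ll * ll') := by
      have h0 : ((2 * m : Nat) : Zt m) = 0 := ZMod.natCast_self _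
      push_cast at h0 ⊢
      rw [h0, zero_mul, add_zero, ZMod.natCast_val, ZMod.cast_id, ZMod.natCast_val, ZMod.cast_id]
    rw [h3] at h2
    rw [h2, show (-((p * (ll.val + 2 * m * s) * (p * ll'.val) : Nat) : ZMod (2 * (m * p ^ 2)))) = ((-((p * (ll.val + 2 * m * s) * (p * ll'.val) : Nat) : Int) : Int) : ZMod (2 * (m * p ^ 2))) by push_cast; rfl, h1]
    have hp' : (p:Complex) ≠ 0 := NeZero.ne _
    have hm : (m:Complex) ≠ 0 := NeZero.ne _
    congr 1
    push_cast
    field_simp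
lemma IsVV.Vp {m p : Nat} [NeZero m] [Fact p.Prime] {C : Int → Zt m → Complex} (h : IsVV 2 m C) :
    ∃ C' : Int → ZMod (2 * (m * p)) → Complex, IsVV 2 (m * p) C' ∧ ∀ n r : Int,
      C' (4 * (m * p : Nat) * n - r ^ 2) r = C (4 * m * (p * n) - r ^ 2) r +
        if (p:Int) ∣ n ∧ (p:Int) ∣ r then p * C (4 * m * (n / p) - (r / p) ^ 2) ((r / p : Int)) else 0 := by
  have hpp : p.Prime := Fact.out
  have hp : (p:Int) ≠ 0 := by exact_mod_cast NeZero.ne p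
  have hp' : (p:Complex) ≠ 0 := NeZero.ne _
  have hpR : (0:Real) < p := by exact_mod_cast hpp.pos
  have hm : (m:Complex) ≠ 0 := NeZero.ne _
  set φ := Phi m C with hφ
  have hM := h.modular
  have hE := Phi_elliptic m C
  rw [← hφ] at hM hE
  have hx := fun (τ z : Complex) (hτ : 0 < τ.im) => Phi_hasSum m h.toPreVV hτ z
  rw [← hφ] at hx
  have im1 : ∀ τ : Complex, 0 < τ.im → 0 < ((p:Complex) * τ).im := fun τ hτ => by
    simpa using mul_pos hpR hτ
  have im2 : ∀ (τ : Complex) (b : Int), 0 < τ.im → 0 < ((τ + b) / p).im := fun τ b hτ => by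
    simp_all
  have hTn : ∀ (b : Int) (τ z : Complex), 0 < τ.im → φ (τ + b) z = φ τ z := by
    intro b τ z hτ
    have := hM τ hτ z 1 b 0 1 (by ring)
    simpa [ee_zero] using this
  have hS : SLaw 2 (m * p) (fun τ z => p * φ (p * τ) (p * z) + (1 / p) * ∑ b : ZMod p, φ ((τ + (b.val : Int)) / p) z) := by
    intro τ z hτ
    have hτ0 := ne_zero_of_im hτ
    have hS1 := sLaw_of_modular hM
    have a1 := hS1 (τ / p) z (by simpa using im2 τ 0 hτ)
    have a2 := hS1 (p * τ) (p * z) (im1 τ hτ)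
    rw [show -1 / (τ / (p:Complex)) = p * (-1 / τ) by field_simp, show z / (τ / (p:Complex)) = p * (z / τ) by field_simp] at a1
    rw [show (p:Complex) * z / (p * τ) = z / τ by field_simp] at a2
    have a3 : ∀ b : ZMod p, b ≠ 0 → φ ((-1 / τ + (b.val : Int)) / p) (z / τ) =
        τ ^ (2:Int) * ee (m * p * z ^ 2 / τ) * φ ((τ + ((-b⁻¹ : ZMod p).val : Int)) / p) z := by
      intro b hb
      set b1 := b.val
      set b2 := (-b⁻¹ : ZMod p).val
      have hd : (p:Int) ∣ b1 * b2 + 1 := by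
        rw [← ZMod.intCast_zmod_eq_zero_iff_dvd]
        push_cast
        simp only [b1, b2, ZMod.natCast_val, ZMod.cast_id]
        field_simp; ring
      obtain ⟨t, ht⟩ := hd
      have := hM ((τ + b2) / p) (im2 τ b2 hτ) z b1 (-t) p (-b2) (by linear_combination (-1) * ht)
      have ht' : (b1:Complex) * b2 + 1 = p * t := by exact_mod_cast ht
      push_cast at this ⊢
      grind
    have hS3 : ∀ f : ZMod p → Complex, ∑ b, f b = f 0 + ∑ b ∈ Finset.univ.erase 0, f b := fun f =>
      (Finset.add_sum_erase _ _ (Finset.mem_univ _)).symm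
    simp only [hS3]
    have a4 : ∑ b ∈ (Finset.univ : Finset (ZMod p)).erase 0, φ ((-1 / τ + (b.val : Int)) / p) (z / τ) =
        τ ^ (2:Int) * ee (m * p * z ^ 2 / τ) * ∑ b ∈ (Finset.univ : Finset (ZMod p)).erase 0, φ ((τ + (b.val : Int)) / p) z := by
      rw [Finset.mul_sum]
      refine Finset.sum_bij' (fun b _ => -b⁻¹) (fun b _ => -b⁻¹) ?_ ?_ ?_ ?_ ?_
      · intro b hb; simpa using hb
      · intro b hb; simpa using hb
      · intro b hb; simp [inv_neg]
      · intro b hb; simp [inv_neg]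
      grind
    rw [a4, a1]
    simp only [ZMod.val_zero, Nat.cast_zero, Int.cast_zero, add_zero]
    rw [show -1 / τ / (p:Complex) = -1 / (p * τ) by field_simp, a2]
    rw [show (m:Complex) * z ^ 2 / (τ / p) = m * p * z ^ 2 / τ by field_simp, show (m:Complex) * (p * z) ^ 2 / (p * τ) = m * p * z ^ 2 / τ by field_simp]
    push_cast
    have z1 : (τ / (p:Complex)) ^ (2:Int) = τ ^ 2 / p ^ 2 := by rw [zpow_ofNat, div_pow]
    have z2 : ((p:Complex) * τ) ^ (2:Int) = p ^ 2 * τ ^ 2 := by rw [zpow_ofNat, mul_pow]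
    rw [z1, z2, zpow_ofNat]
    field_simp
    ring
  refine Exists.imp (fun C' h => ⟨h.1, h.2.1⟩) (mkVV (m := m * p) (k := 2) (fun n r => C (4 * m * (p * n) - r ^ 2) r +
        if (p:Int) ∣ n ∧ (p:Int) ∣ r then p * C (4 * m * (n / p) - (r / p) ^ 2) ((r / p : Int)) else 0) _ ?_ ?_ hS ?_)
  · intro τ z hτ
    simp only [add_mul]
    rw [add_comm]
    refine HasSum.add ?_ ?_
    · have hinj : Function.Injective fun x : Int × Int => ((p:Int) * x.1, x.2) := by
        rintro ⟨a, b⟩ ⟨c, d⟩ hab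
        simp_all
      have h1 := (hasSum_sum (s := (Finset.univ : Finset (ZMod p))) fun b _ => hx ((τ + (b.val : Int)) / p) z (im2 τ _ hτ)).mul_left (1 / (p:Complex))
      have h3 : ∀ x : Int × Int, 1 / (p:Complex) * ∑ b : ZMod p, C (4 * m * x.1 - x.2 ^ 2) x.2 * ee (x.1 * ((τ + (b.val : Int)) / p) + x.2 * z)
          = if (p:Int) ∣ x.1 then C (4 * m * x.1 - x.2 ^ 2) x.2 * ee (x.1 / p * τ + x.2 * z) else 0 := by
        intro x
        have e1 : ∀ b : ZMod p, ee (x.1 * ((τ + (b.val : Int)) / p) + x.2 * z) = ee (x.1 / p * τ + x.2 * z) * ZMod.stdAddChar (b * (x.1 : ZMod p)) := by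
          intro b
          have := chi_ee p (b.val * x.1)
          push_cast at this
          rw [ZMod.natCast_val, ZMod.cast_id] at this
          rw [this, ← ee_add]
          congr 1; push_cast; ring
        simp only [e1]
        rw [← Finset.mul_sum, ← Finset.mul_sum, AddChar.sum_mulShift (x.1 : ZMod p) (ZMod.isPrimitive_stdAddChar p)]
        simp only [ZMod.intCast_zmod_eq_zero_iff_dvd]
        split_ifs
        · rw [ZMod.card]; field_simp
        · simp
      simp only [h3] at h1
      rw [← hinj.hasSum_iff] at h1
      · have hc := h1
        refine Eq.mp (congrArg (fun f => HasSum f _) (funext fun x => ?_)) hc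
        symm
        simp only [Function.comp, dvd_mul_right, if_true]
        push_cast
        grind
      · intro x hx
        rw [if_neg]
        rintro ⟨t, ht⟩
        exact hx ⟨(t, x.2), Prod.ext ht.symm rfl⟩
    · have hinj : Function.Injective fun x : Int × Int => ((p:Int) * x.1, (p:Int) * x.2) := by
        rintro ⟨a, b⟩ ⟨c, d⟩ hab
        simp_all
      have h1 := (hx (p * τ) (p * z) (im1 τ hτ)).mul_left (p:Complex)
      rw [← hinj.hasSum_iff]
      · have hc := h1
        refine Eq.mp (congrArg (fun f => HasSum f _) (funext fun x => ?_)) hc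
        symm
        simp only [Function.comp, dvd_mul_right, and_self, if_true]
        rw [Int.mul_ediv_cancel_left _ hp, Int.mul_ediv_cancel_left _ hp, mul_assoc]
        congr 3
        push_cast; ring
      · intro x hx
        rw [if_neg, zero_mul]
        rintro ⟨⟨t, ht⟩, ⟨s, hs⟩⟩
        exact hx ⟨(t, s), Prod.ext ht.symm hs.symm⟩
  · intro τ hτ z lam mu
    simp only
    have a1 : ∀ b : ZMod p, φ ((τ + (b.val : Int)) / p) (z + lam * τ + mu) =
        ee (-((m * p : Nat) : Complex) * (lam ^ 2 * τ + 2 * lam * z)) * φ ((τ + (b.val : Int)) / p) z := by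
      intro b
      have := hE _ (im2 τ b.val hτ) z (p * lam) (mu - lam * b.val)
      rw [show z + ((p * lam : Int) : Complex) * ((τ + (b.val : Int)) / p) + ((mu - lam * b.val : Int) : Complex) = z + lam * τ + mu by
        push_cast; field_simp; ring] at this
      rw [this]
      congr 1
      rw [show -(m:Complex) * (((p * lam : Int) : Complex) ^ 2 * ((τ + (b.val : Int)) / p) + 2 * ((p * lam : Int) : Complex) * z) =
        ((-(m * p * lam ^ 2 * b.val) : Int) : Complex) + -((m * p : Nat) : Complex) * (lam ^ 2 * τ + 2 * lam * z) by
          push_cast; field_simp; ring, ee_add, ee_int, one_mul]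
    have a2 := hE _ (im1 τ hτ) (p * z) lam (p * mu)
    rw [show (p:Complex) * z + lam * (p * τ) + ((p * mu : Int) : Complex) = p * (z + lam * τ + mu) by push_cast; ring] at a2
    rw [a2]
    simp only [a1]
    rw [← Finset.mul_sum, show -(m:Complex) * (lam ^ 2 * (p * τ) + 2 * lam * (p * z)) = -((m * p : Nat) : Complex) * (lam ^ 2 * τ + 2 * lam * z) by push_cast; ring]
    ring
  · obtain ⟨B, hB⟩ := h.bdd
    have hm1 : (1:Int) ≤ m := by exact_mod_cast Nat.pos_of_ne_zero (NeZero.ne m)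
    have hp1 : (1:Int) ≤ p := by exact_mod_cast hpp.pos
    have habs := le_abs_self B
    have habs0 := abs_nonneg B
    have key : ∀ n r : Int, n < -|B| → 4 * (m:Int) * n - r ^ 2 < -B := by
      intro n r hn; nlinarith [sq_nonneg r]
    refine ⟨p * |B|, fun n r hn => ?_⟩
    have hn1 : n < -|B| := by nlinarith
    rw [hB _ _ (key _ _ (by nlinarith)), zero_add]
    split_ifs with hd
    · obtain ⟨⟨t, rfl⟩, -⟩ := hd
      rw [Int.mul_ediv_cancel_left _ hp, hB _ _ (key _ _ (by nlinarith)), mul_zero]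
    · rfl
lemma VpVp {m p : Nat} [NeZero m] [Fact p.Prime] {C : Int → Zt m → Complex} (h : IsVV 2 m C) :
    ∃ C' : Int → ZMod (2 * (m * p ^ 2)) → Complex, IsVV 2 (m * p ^ 2) C' ∧ ∀ n R : Int,
      C' (4 * (m * p ^ 2 : Nat) * n - (p * R) ^ 2) ((p * R : Int)) = C (p ^ 2 * (4 * m * n - R ^ 2)) ((p * R : Int)) +
        p * C (4 * m * n - R ^ 2) R + if (p:Int) ∣ n then p * C (4 * m * n - R ^ 2) R +
          (if (p:Int) ∣ n / p ∧ (p:Int) ∣ R then p ^ 2 * C (4 * m * (n / p / p) - (R / p) ^ 2) ((R / p : Int)) else 0) else 0 := by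
  have hp : (p:Int) ≠ 0 := by exact_mod_cast NeZero.ne p
  obtain ⟨C1, h1, f1⟩ := h.Vp (p := p)
  obtain ⟨C2, h2, f2⟩ := h1.Vp (p := p)
  have e : m * p ^ 2 = m * p * p := by ring
  suffices H : ∀ M : Nat, ∀ [NeZero M], M = m * p * p → ∃ C' : Int → ZMod (2 * M) → Complex, IsVV 2 M C' ∧ ∀ n R : Int,
      C' (4 * (M : Nat) * n - (p * R) ^ 2) ((p * R : Int)) = C (p ^ 2 * (4 * m * n - R ^ 2)) ((p * R : Int)) +
        p * C (4 * m * n - R ^ 2) R + if (p:Int) ∣ n then p * C (4 * m * n - R ^ 2) R +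
          (if (p:Int) ∣ n / p ∧ (p:Int) ∣ R then p ^ 2 * C (4 * m * (n / p / p) - (R / p) ^ 2) ((R / p : Int)) else 0) else 0 from
    H _ e
  rintro M _ rfl
  refine ⟨C2, h2, fun n R => ?_⟩
  rw [f2, f1, Int.mul_ediv_cancel_left _ hp, Int.mul_ediv_cancel_left _ hp]
  simp only [dvd_mul_right, and_self, and_true, if_true]
  have e1 : 4 * (m:Int) * (p * (p * n)) - (p * R) ^ 2 = p ^ 2 * (4 * m * n - R ^ 2) := by ring
  rw [e1]
  congr 1
  split_ifs with hn hb
  · obtain ⟨t, rfl⟩ := hn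
    rw [f1, Int.mul_ediv_cancel_left _ hp, if_pos (by rwa [Int.mul_ediv_cancel_left _ hp] at hb)]
    ring
  · obtain ⟨t, rfl⟩ := hn
    rw [f1, Int.mul_ediv_cancel_left _ hp, if_neg (by rwa [Int.mul_ediv_cancel_left _ hp] at hb)]
    ring
  · rfl
def TpC (m p : Nat) [Fact p.Prime] {M : Type*} [AddCommGroup M] (C : Int → Zt m → M) : Int → Zt m → M := fun Δ ll =>
  C (p ^ 2 * Δ) (p * ll) + legendreSym p (-Δ) • C Δ ll + if (p:Int) ^ 2 ∣ Δ then (p:Int) • C (Δ / p ^ 2) ((p : Zt m)⁻¹ * ll) else 0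
lemma cop4 {m p : Nat} [Fact p.Prime] (hp2 : p ≠ 2) (hpm : ¬ p ∣ m) : IsCoprime ((p:Int)) (4 * m) := by
  have hpp : p.Prime := Fact.out
  rw [Int.isCoprime_iff_gcd_eq_one]
  have : Nat.Coprime p (4 * m) := by
    refine Nat.Coprime.mul_right ?_ ((Nat.Prime.coprime_iff_not_dvd hpp).2 hpm)
    rw [show 4 = 2 ^ 2 by norm_num]
    exact Nat.Coprime.pow_right _ ((Nat.coprime_primes hpp Nat.prime_two).2 hp2)
  exact_mod_cast this
lemma pinv {m p : Nat} [Fact p.Prime] (hp2 : p ≠ 2) (hpm : ¬ p ∣ m) :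
    (p : Zt m) * (p : Zt m)⁻¹ = 1 := by
  apply ZMod.coe_mul_inv_eq_one
  have := cop4 hp2 hpm
  rw [Int.isCoprime_iff_gcd_eq_one] at this
  have : Nat.Coprime p (4 * m) := by exact_mod_cast this
  exact Nat.Coprime.coprime_dvd_right ⟨2, by ring⟩ this
lemma valid_mul {m p : Nat} [Fact p.Prime] (hp2 : p ≠ 2) (hpm : ¬ p ∣ m) (Δ l : Int) :
    (4 * (m:Int)) ∣ p ^ 2 * Δ + (p * l) ^ 2 ↔ (4 * (m:Int)) ∣ Δ + l ^ 2 := by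
  rw [show (p:Int) ^ 2 * Δ + (p * l) ^ 2 = p ^ 2 * (Δ + l ^ 2) by ring]
  exact ⟨(cop4 hp2 hpm).symm.pow_right.dvd_of_dvd_mul_left, fun h => h.mul_left _⟩
lemma bij_range {p m : Nat} [Fact p.Prime] (hp2 : p ≠ 2) (hpm : ¬ p ∣ m) (l : Int) {M : Type*} [AddCommMonoid M] (f : ZMod p → M) :
    ∑ s ∈ Finset.range p, f ((l + 2 * m * s : Int)) = ∑ x, f x := by
  have hpp : p.Prime := Fact.out
  have hu : (2 * m : ZMod p) ≠ 0 := by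
    have : ((2 * m : Nat) : ZMod p) ≠ 0 := by
      rw [Ne, ZMod.natCast_eq_zero_iff, hpp.dvd_mul, Nat.prime_dvd_prime_iff_eq hpp Nat.prime_two]; tauto
    simpa using this
  refine Finset.sum_bij' (fun s _ => ((l + 2 * m * s : Int) : ZMod p)) (fun x _ => ((x - l) / (2 * m)).val) (by simp) ?_ ?_ ?_ (by simp)
  · grind
  · intro s hs
    push_cast
    rw [add_sub_cancel_left, mul_div_cancel_left₀ _ hu, ZMod.val_natCast, Nat.mod_eq_of_lt (by simpa using hs)]
  · intro x _
    push_cast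
    rw [ZMod.natCast_val, ZMod.cast_id', id, mul_div_cancel₀ _ hu]; ring
lemma IsVV.TpC {m p : Nat} [NeZero m] [Fact p.Prime] (hp2 : p ≠ 2) (hpm : ¬ p ∣ m) {C : Int → Zt m → Complex} (h : IsVV 2 m C) :
    IsVV 2 m (TpC m p C) := by
  have hpp : p.Prime := Fact.out
  have hp : (p:Int) ≠ 0 := by exact_mod_cast NeZero.ne p
  have hp' : (p:Complex) ≠ 0 := NeZero.ne _
  obtain ⟨C2, h2, f2⟩ := VpVp (p := p) h
  have hU := h2.Up
  have h3 := (hU.smul (1 / (p:Complex))).add (h.smul (-((p:Complex) + 1)))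
  suffices e : _root_.TpC m p C = fun Δ ll => 1 / (p:Complex) * _root_.Up m p C2 Δ ll + -((p:Complex) + 1) * C Δ ll by rw [e]; exact h3
  funext Δ ll
  obtain ⟨l, rfl, hl⟩ : ∃ l : Int, (l : Zt m) = ll ∧ l = ll.val := ⟨ll.val, by simp, rfl⟩
  have hpi := pinv (m := m) hp2 hpm
  have hlinv : ∃ l' : Int, (l' : Zt m) = (p : Zt m)⁻¹ * l := ⟨((p : Zt m)⁻¹ * l).val, by simp⟩
  by_cases hv : (4 * (m:Int)) ∣ Δ + l ^ 2
  swap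
  · have hz : ∀ {C : Int → Zt m → Complex}, IsVV 2 m C → C Δ l = 0 := fun h => by
      by_contra hne; exact hv (h.supp _ _ hne)
    rw [hz h, hz hU, _root_.TpC, hz h]
    have a1 : C (p ^ 2 * Δ) (p * l) = 0 := by
      by_contra hne
      have := h.supp (p ^ 2 * Δ) (p * l) (by push_cast; exact hne)
      exact hv ((valid_mul hp2 hpm _ _).1 this)
    rw [a1]
    split_ifs with hd
    · obtain ⟨t, rfl⟩ := hd
      obtain ⟨l', hl'⟩ := hlinv
      rw [Int.mul_ediv_cancel_left _ (pow_ne_zero _ hp), ← hl']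
      have : C t l' = 0 := by
        by_contra hne
        have h5 := (valid_mul hp2 hpm _ _).2 (h.supp _ _ hne)
        have h6 := sq_congr m (a := l) (b := p * l') (by push_cast; rw [hl', ← mul_assoc, hpi, one_mul])
        exact hv ((dvd_add h5 h6).trans (by ring_nf; rfl))
      rw [this]; simp
    · simp
  obtain ⟨n, hn⟩ := hv
  -- n_s
  have hR : ∀ s : Nat, ∃ ns : Int, 4 * m * ns - (l + 2 * m * s) ^ 2 = Δ := fun s =>
    ⟨n + l * s + m * s ^ 2, by linear_combination -hn⟩
  choose N hN using hR
  have hdN : ∀ s : Nat, (p:Int) ∣ N s ↔ (((l + 2 * m * s : Int) : ZMod p)) ^ 2 = ((-Δ : Int) : ZMod p) := by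
    intro s
    have e2 : (((l + 2 * m * s : Int) : ZMod p)) ^ 2 = ((-Δ : Int) : ZMod p) ↔ (((l + 2 * m * s) ^ 2 + Δ : Int) : ZMod p) = 0 := by
      push_cast; rw [← sub_eq_zero, sub_neg_eq_add]
    rw [e2, ← hN s, add_sub_cancel, ZMod.intCast_zmod_eq_zero_iff_dvd]
    exact ⟨fun h => h.mul_left _, (cop4 hp2 hpm).dvd_of_dvd_mul_left⟩
  have hterm : ∀ s : Nat, C2 (Δ * (p:Int) ^ 2) ((p * ((l : Zt m).val + 2 * m * s) : Nat) : ZMod (2 * (m * p ^ 2))) =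
      C (p ^ 2 * Δ) (p * l) + p * C Δ l + (if ((l + 2 * m * s : Int) : ZMod p) ^ 2 = ((-Δ : Int) : ZMod p) then p * C Δ l else 0) +
      if ((l + 2 * m * s : Int) : ZMod p) = 0 then (if (p:Int) ^ 2 ∣ Δ then p ^ 2 * C (Δ / p ^ 2) ((p : Zt m)⁻¹ * l) else 0) else 0 := by
    intro s
    have f3 := f2 (N s) (l + 2 * m * s)
    have e1 : 4 * ((m * p ^ 2 : Nat) : Int) * N s - (p * (l + 2 * m * s)) ^ 2 = Δ * p ^ 2 := by
      push_cast; linear_combination (p:Int) ^ 2 * hN s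
    have e2 : ((p * (l + 2 * m * s) : Int) : ZMod (2 * (m * p ^ 2))) = ((p * ((l : Zt m).val + 2 * m * s) : Nat) : ZMod (2 * (m * p ^ 2))) := by
      push_cast; rw [show (l : ZMod (2 * (m * p ^ 2))) = ((l : Zt m).val : Int) from congrArg _ hl]; push_cast; rfl
    have e3 : ((l + 2 * m * s : Int) : Zt m) = l := by
      have : ((2 * m : Nat) : Zt m) = 0 := ZMod.natCast_self _
      push_cast at this ⊢
      rw [this]; ring
    have e4 : ((p * (l + 2 * m * s) : Int) : Zt m) = p * l := by
      rw [Int.cast_mul, e3]; simp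
    rw [e1, e2, e3, e4, hN s] at f3
    rw [f3, add_assoc (C (p ^ 2 * Δ) (p * l) + p * C Δ l)]
    congr 1
    simp only [← hdN s, ZMod.intCast_zmod_eq_zero_iff_dvd]
    by_cases hd : (p:Int) ∣ l + 2 * m * s
    · rw [if_pos hd]
      by_cases hD : (p:Int) ^ 2 ∣ Δ
      · rw [if_pos hD]
        have h9 : (p:Int) ^ 2 ∣ N s := by
          have := dvd_add hD (pow_dvd_pow_of_dvd hd 2)
          rw [← hN s, sub_add_cancel] at this
          exact ((cop4 hp2 hpm).pow_left (m := 2)).dvd_of_dvd_mul_left this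
        obtain ⟨t, ht⟩ := h9
        have h10 : (p:Int) ∣ N s := ht ▸ dvd_mul_of_dvd_left (dvd_pow_self _ two_ne_zero) _
        have h11 : N s / p = p * t := by rw [ht, pow_two, mul_assoc, Int.mul_ediv_cancel_left _ hp]
        rw [if_pos h10, if_pos h10, h11, if_pos ⟨dvd_mul_right _ _, hd⟩, Int.mul_ediv_cancel_left _ hp]
        obtain ⟨R, hR⟩ := hd
        rw [hR, Int.mul_ediv_cancel_left _ hp]
        have h12 : Δ / p ^ 2 = 4 * m * t - R ^ 2 := by
          rw [← hN s, ht, hR]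
          apply Int.ediv_eq_of_eq_mul_right (pow_ne_zero _ hp); ring
        have h13 : (p : Zt m)⁻¹ * l = R := by
          rw [← e3, hR]; push_cast; rw [← mul_assoc, mul_comm _ (p : Zt m), hpi, one_mul]
        rw [h12, h13]
      · rw [if_neg hD, add_zero]
        by_cases h10 : (p:Int) ∣ N s
        · rw [if_pos h10, if_pos h10, if_neg, add_zero]
          rintro ⟨h1, h2⟩
          apply hD
          obtain ⟨t, ht⟩ := h10
          rw [ht, Int.mul_ediv_cancel_left _ hp] at h1
          obtain ⟨t', rfl⟩ := h1
          obtain ⟨R, hR⟩ := h2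
          exact ⟨4 * m * t' - R ^ 2, by rw [← hN s, ht, hR]; ring⟩
        · rw [if_neg h10, if_neg h10]
    · rw [if_neg hd, add_zero]
      refine if_congr Iff.rfl ?_ rfl
      rw [if_neg (fun h => hd h.2), add_zero]
  rw [_root_.Up, Finset.sum_congr rfl fun s _ => hterm s]
  simp only [Finset.sum_add_distrib, Finset.sum_const, Finset.card_range, nsmul_eq_mul]
  rw [bij_range hp2 hpm l (fun x : ZMod p => if x ^ 2 = ((-Δ : Int) : ZMod p) then p * C Δ l else 0),
    bij_range hp2 hpm l (fun x : ZMod p => if x = 0 then (if (p:Int) ^ 2 ∣ Δ then p ^ 2 * C (Δ / p ^ 2) ((p : Zt m)⁻¹ * l) else 0) else 0)]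
  have hc := legendreSym.card_sqrts p hp2 (-Δ)
  rw [Finset.sum_ite_eq', if_pos (Finset.mem_univ _), ← Finset.sum_filter, Finset.sum_const, nsmul_eq_mul]
  have hc' : ((Finset.univ.filter fun x : ZMod p => x ^ 2 = ((-Δ : Int) : ZMod p)).card : Complex) = legendreSym p (-Δ) + 1 := by
    have : ((Finset.univ.filter fun x : ZMod p => x ^ 2 = ((-Δ : Int) : ZMod p)).card : Int) = legendreSym p (-Δ) + 1 := by
      rw [← hc]; congr 2; ext; simp
    exact_mod_cast this
  rw [hc', _root_.TpC, zsmul_eq_mul, zsmul_eq_mul]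
  split_ifs
  · push_cast; field_simp; ring
  · push_cast; field_simp; ring
lemma ct0 (c : Int → Complex) (F : Complex → Complex)
    (hc : ∀ τ : Complex, 0 < τ.im → HasSum (fun n : Int => c n * ee (n * τ)) (F τ))
    (hS : ∀ τ : Complex, 0 < τ.im → F (-1 / τ) = τ ^ 2 * F τ) : c 0 = 0 := by
  have hpi : (2 * Real.pi * I : Complex) ≠ 0 := by simp [Real.pi_ne_zero]
  set d : Int → Complex := fun n => c n / (2 * Real.pi * I * n)
  have hd : ∀ n, d n * (2 * Real.pi * I * n) = if n = 0 then 0 else c n := by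
    intro n
    by_cases hn : n = 0
    · simp [hn]
    · have : (n:Complex) ≠ 0 := by exact_mod_cast hn
      simp only [d, if_neg hn]; field_simp
  have hdn : ∀ n, ‖d n‖ ≤ ‖c n‖ := by
    intro n
    by_cases hn : n = 0
    · simp [d, hn]
    · simp only [d, norm_div]
      apply div_le_self (norm_nonneg _)
      simp only [norm_mul, norm_real, norm_I, mul_one, Complex.norm_ofNat, Complex.norm_intCast]
      have h1 : (1:Real) ≤ |(n:Real)| := by exact_mod_cast Int.one_le_abs hn
      rw [Real.norm_of_nonneg Real.pi_pos.le]
      nlinarith [Real.pi_gt_three]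
  have hds : ∀ τ : Complex, 0 < τ.im → Summable fun n : Int => d n * ee (n * τ) := fun τ hτ =>
    Summable.of_norm_bounded (hc τ hτ).summable.norm fun n => by
      simp only [norm_mul]; gcongr; exact hdn n
  set P : Complex → Complex := fun τ => c 0 * τ + ∑' n : Int, d n * ee (n * τ)
  have hP : ∀ τ : Complex, 0 < τ.im → HasDerivAt P (F τ) τ := by
    intro τ hτ
    set U : Set Complex := {w | τ.im / 2 < w.im ∧ w.im < τ.im + 1}
    have hU : IsOpen U := (isOpen_lt continuous_const continuous_im).inter (isOpen_lt continuous_im continuous_const)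
    have h1 := (hds ((τ.im / 2 : Real) * I) (by simpa using hτ)).norm.add
      (hds ((τ.im + 1 : Real) * I) (by simp only [mul_im, ofReal_re, I_im, mul_one, ofReal_im, I_re, mul_zero, add_zero]; linarith)).norm
    have hfd : ∀ i : Int, DifferentiableOn Complex (fun w : Complex => d i * ee (i * w)) U := fun i => by unfold ee; fun_prop
    have hb : ∀ (i : Int) (w : Complex), w ∈ U → ‖d i * ee (i * w)‖ ≤ ‖d i * ee (i * ((τ.im / 2 : Real) * I))‖ + ‖d i * ee (i * ((τ.im + 1 : Real) * I))‖ := by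
      intro i w hw
      simp only [norm_mul (d i)]
      rw [← mul_add]
      have := norm_ee_le_add (i:Real) hw.1 hw.2
      rw [ofReal_intCast] at this
      exact mul_le_mul_of_nonneg_left this (norm_nonneg _)
    have hmem : τ ∈ U := ⟨by linarith, by linarith⟩
    have h2 := hasSum_deriv_of_summable_norm h1 hfd hU hb hmem
    have h3 := (differentiableOn_tsum_of_summable_norm h1 hfd hU hb).differentiableAt (hU.mem_nhds hmem)
    have h4 : ∀ n : Int, deriv (fun w : Complex => d n * ee (n * w)) τ = (if n = 0 then 0 else c n) * ee (n * τ) := by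
      intro n
      rw [← hd n]
      have : HasDerivAt (fun w : Complex => d n * ee (n * w)) (d n * (cexp (2 * Real.pi * I * (n * τ)) * (2 * Real.pi * I * (n * 1)))) τ :=
        (((hasDerivAt_id τ).const_mul (n:Complex)).const_mul (2 * Real.pi * I)).cexp.const_mul (d n)
      rw [this.deriv, ee]; ring
    simp only [h4] at h2
    have h5 : HasSum (fun n : Int => (if n = 0 then 0 else c n) * ee (n * τ)) (F τ - c 0) := by
      have := (hc τ hτ).sub (hasSum_ite_eq (0:Int) (c 0))
      refine Eq.mp (congrArg (fun f => HasSum f _) (funext fun n => ?_)) this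
      by_cases hn : n = 0
      · simp [hn, ee_zero]
      · simp [hn]
    have h6 := h3.hasDerivAt
    rw [h2.unique h5] at h6
    refine (((hasDerivAt_id τ).const_mul (c 0)).add h6).congr_deriv ?_
    ring
  have hH : IsOpen {w : Complex | 0 < w.im} := isOpen_lt continuous_const continuous_im
  have hconv : IsPreconnected {w : Complex | 0 < w.im} := (convex_halfSpace_im_gt 0).isPreconnected
  have hQ : ∀ τ : Complex, 0 < τ.im → HasDerivAt (fun w => P (-1 / w) - P w) 0 τ := by
    intro τ hτ
    have hτ0 := ne_zero_of_im hτ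
    have h1 : HasDerivAt (fun w : Complex => -1 / w) (1 / τ ^ 2) τ := by
      simp only [div_eq_mul_inv]
      refine ((hasDerivAt_inv hτ0).const_mul (-1)).congr_deriv ?_
      ring
    have := ((hP _ (im_S_pos hτ)).comp τ h1).sub (hP τ hτ)
    rw [hS τ hτ] at this
    refine this.congr_deriv ?_
    field_simp; ring
  have hconst := fun {x y : Complex} => hH.is_const_of_deriv_eq_zero (f := fun w => P (-1 / w) - P w) hconv (fun τ hτ => (hQ τ hτ).differentiableAt.differentiableWithinAt)
    (fun τ hτ => (hQ τ hτ).deriv) (x := x) (y := y)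
  set ρ : Complex := ⟨-1/2, Real.sqrt 3 / 2⟩
  have h3 : (0:Real) < Real.sqrt 3 := by positivity
  have hρ : 0 < ρ.im := by simp only [ρ]; positivity
  have hρS : -1 / ρ = ρ + 1 := by
    rw [div_eq_iff (ne_zero_of_im hρ)]
    have := Real.mul_self_sqrt (show (0:Real) ≤ 3 by norm_num)
    apply Complex.ext <;> simp [ρ] <;> nlinarith
  have e := hconst (show I ∈ _ by simp) (show ρ ∈ _ from hρ)
  simp only [hρS] at e
  rw [show (-1 / I : Complex) = I by simp [div_eq_mul_inv], sub_self] at e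
  simp only [P] at e
  have h7 : ∀ n : Int, ee (n * (ρ + 1)) = ee (n * ρ) := fun n => by rw [mul_add, mul_one, ee_add, ee_int, mul_one]
  simp only [h7] at e
  linear_combination -e
lemma IsVV.ct {m : Nat} [NeZero m] {C : Int → Zt m → Complex} (h : IsVV 2 m C) (hog : ∀ Δ ll, Δ < -1 → C Δ ll = 0) :
    C (-1) 1 + C (-1) (-1) + C 0 0 = 0 := by
  have hm1 : (1:Int) ≤ m := by exact_mod_cast Nat.pos_of_ne_zero (NeZero.ne m)
  have h1 := ct0 (fun n => ∑' r : Int, C (4 * m * n - r ^ 2) r) (fun τ => Phi m C τ 0) ?_ ?_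
  · rw [tsum_eq_sum (s := {-1, 0, 1})] at h1
    · grind
    · intro r hr
      simp only [Finset.mem_insert, Finset.mem_singleton, not_or] at hr
      apply hog
      have : 2 ≤ |r| := by rcases abs_cases r with h | h <;> omega
      nlinarith [sq_abs r]
  · intro τ hτ
    have h2 := Phi_hasSum m h.toPreVV hτ 0
    have h3 := h2.prod_fiberwise (g := fun n : Int => (∑' r : Int, C (4 * m * n - r ^ 2) r) * ee (n * τ)) ?_
    · exact h3
    · intro n
      rw [← tsum_mul_right]
      have := (h2.summable.prod_factor n).hasSum
      simpa using this
  · intro τ hτ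
    have := h.sLaw τ 0 hτ
    simpa [ee_zero] using this
abbrev LA := LaurentPolynomial Int
def Ln (t : Real) (P : LA) : Real := ∑' r : Int, |(P.coeff r : Real)| * t ^ r
lemma Ln_summable (t : Real) (P : LA) : Summable fun r : Int => |(P.coeff r : Real)| * t ^ r := by
  apply summable_of_ne_finset_zero (s := P.coeff.support)
  simp_all
lemma Ln_add {t : Real} (ht : 0 < t) (P Q : LA) : Ln t (P + Q) ≤ Ln t P + Ln t Q := by
  rw [Ln, Ln, Ln, ← (Ln_summable t P).tsum_add (Ln_summable t Q)]
  refine (Ln_summable t _).tsum_le_tsum (fun r => ?_) ((Ln_summable t P).add (Ln_summable t Q))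
  rw [← add_mul]
  gcongr
  simp only [AddMonoidAlgebra.coeff_add, Finsupp.add_apply, Int.cast_add]
  exact abs_add_le _ _
lemma Ln_neg (t : Real) (P : LA) : Ln t (-P) = Ln t P := by
  simp [Ln]
lemma Ln_zero (t : Real) : Ln t 0 = 0 := by simp [Ln]
lemma coeff_T_mul (n r : Int) (Q : LA) : (LaurentPolynomial.T n * Q).coeff r = Q.coeff (r - n) := by
  rw [LaurentPolynomial.T, AddMonoidAlgebra.coeff_single_mul_apply, one_mul]
  congr 1; ring
lemma coeff_C_mul (a r : Int) (Q : LA) : (LaurentPolynomial.C a * Q).coeff r = a * Q.coeff r := by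
  rw [← LaurentPolynomial.smul_eq_C_mul, AddMonoidAlgebra.coeff_smul, Finsupp.smul_apply, smul_eq_mul]
lemma Ln_mono {t : Real} (ht : 0 < t) (a n : Int) (Q : LA) :
    Ln t (LaurentPolynomial.C a * LaurentPolynomial.T n * Q) = |(a:Real)| * t ^ n * Ln t Q := by
  rw [Ln, Ln, ← tsum_mul_left, ← (Equiv.addRight n).tsum_eq]
  refine tsum_congr fun r => ?_
  rw [mul_assoc, coeff_C_mul, coeff_T_mul]
  simp only [Equiv.coe_addRight, add_sub_cancel_right, Int.cast_mul, abs_mul]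
  rw [zpow_add₀ ht.ne']; ring
lemma Ln_T (t : Real) (n : Int) : Ln t (LaurentPolynomial.T n) = t ^ n := by
  rw [Ln, tsum_eq_single n]
  · simp
  · intro b hb; simp [hb.symm]
lemma Ln_sum {ι : Type*} {t : Real} (ht : 0 < t) (s : Finset ι) (f : ι → LA) :
    Ln t (∑ i ∈ s, f i) ≤ ∑ i ∈ s, Ln t (f i) := by
  induction s using Finset.cons_induction with
  | empty => simp [Ln_zero]
  | cons a s ha ih =>
    rw [Finset.sum_cons, Finset.sum_cons]
    exact (Ln_add ht _ _).trans (by gcongr)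
lemma LA_decomp (P : LA) : P = ∑ r ∈ P.coeff.support, LaurentPolynomial.C (P.coeff r) * LaurentPolynomial.T r := by
  apply LaurentPolynomial.ext
  intro a
  rw [AddMonoidAlgebra.coeff_sum, Finsupp.finsetSum_apply]
  simp only [coeff_C_mul, LaurentPolynomial.T_apply]
  simp
lemma Ln_eq (t : Real) (P : LA) : Ln t P = ∑ r ∈ P.coeff.support, |(P.coeff r : Real)| * t ^ r := by
  refine tsum_eq_sum ?_
  simp_all
lemma Ln_mul {t : Real} (ht : 0 < t) (P Q : LA) : Ln t (P * Q) ≤ Ln t P * Ln t Q := by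
  conv_lhs => rw [LA_decomp P]
  rw [Finset.sum_mul, Ln_eq t P, Finset.sum_mul]
  refine (Ln_sum ht _ _).trans (Finset.sum_le_sum fun r _ => ?_)
  rw [Ln_mono ht]
def LnS (t : {t : Real // 0 < t}) : RingSeminorm LA where
  toFun := Ln t
  map_zero' := Ln_zero _
  add_le' := Ln_add t.2
  neg' := Ln_neg _
  mul_le' := Ln_mul t.2
def CvR {R ι : Type*} [CommRing R] (N : ι → RingSeminorm R) : Subring (PowerSeries R) where
  carrier := {f | ∀ i, ∀ ρ : Real, 0 ≤ ρ → ρ < 1 → Summable fun n => N i (PowerSeries.coeff n f) * ρ ^ n}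
  zero_mem' := fun i ρ _ _ => by simp
  one_mem' := fun i ρ _ _ => by
    apply summable_of_ne_finset_zero (s := {0})
    simp_all
  add_mem' := fun {f g} hf hg i ρ h0 h1 => by
    refine Summable.of_nonneg_of_le (fun n => by positivity) (fun n => ?_) ((hf i ρ h0 h1).add (hg i ρ h0 h1))
    rw [← add_mul, map_add]
    gcongr
    exact map_add_le_add _ _ _
  neg_mem' := fun {f} hf i ρ h0 h1 => by
    simpa using hf i ρ h0 h1
  mul_mem' := fun {f g} hf hg i ρ h0 h1 => by
    have h := (summable_norm_sum_mul_antidiagonal_of_summable_norm (hf i ρ h0 h1).norm (hg i ρ h0 h1).norm).of_norm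
    refine Summable.of_nonneg_of_le (fun n => by positivity) (fun n => ?_) h
    rw [PowerSeries.coeff_mul]
    calc _ ≤ (∑ p ∈ Finset.HasAntidiagonal.antidiagonal n, N i (PowerSeries.coeff p.1 f) * N i (PowerSeries.coeff p.2 g)) * ρ ^ n := by
          gcongr
          refine (Finset.le_sum_of_subadditive (N i) (map_zero (N i)).le (map_add_le_add (N i)) _ _).trans
            (Finset.sum_le_sum fun p _ => map_mul_le_mul _ _ _)
      _ ≤ _ := by
          rw [Finset.sum_mul]
          refine Finset.sum_le_sum fun p hp => le_of_eq ?_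
          rw [← Finset.HasAntidiagonal.mem_antidiagonal.1 hp, pow_add]; ring
def CN : Unit → RingSeminorm Complex := fun _ => normRingSeminorm Complex
abbrev CQ := CvR CN
abbrev CJ := CvR LnS
def qq (τ : Complex) : Complex := if 0 < τ.im then ee τ else 0
lemma norm_ee_lt {τ : Complex} (h : 0 < τ.im) : ‖ee τ‖ < 1 := by
  rw [norm_ee, Real.exp_lt_one_iff]
  have := Real.pi_pos
  nlinarith [mul_pos this h]
lemma norm_qq (τ : Complex) : ‖qq τ‖ < 1 := by
  rw [qq]; split_ifs with h
  · exact norm_ee_lt h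
  · simp
lemma CQ_summable_norm (f : CQ) (q : Complex) (hq : ‖q‖ < 1) : Summable fun n => ‖PowerSeries.coeff n f.1 * q ^ n‖ := by
  have := f.2 () ‖q‖ (norm_nonneg _) hq
  simp only [norm_mul, norm_pow]
  exact this
def evq (τ : Complex) : CQ →+* Complex where
  toFun f := ∑' n, PowerSeries.coeff n f.1 * qq τ ^ n
  map_one' := by
    simp
  map_zero' := by simp
  map_add' f g := by
    rw [← ((CQ_summable_norm f _ (norm_qq τ)).of_norm).tsum_add (CQ_summable_norm g _ (norm_qq τ)).of_norm]
    refine tsum_congr fun n => ?_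
    simp [add_mul]
  map_mul' f g := by
    rw [tsum_mul_tsum_eq_tsum_sum_antidiagonal_of_summable_norm (CQ_summable_norm f _ (norm_qq τ))
      (CQ_summable_norm g _ (norm_qq τ))]
    refine tsum_congr fun n => ?_
    rw [Subring.coe_mul, PowerSeries.coeff_mul, Finset.sum_mul]
    refine Finset.sum_congr rfl fun p hp => ?_
    rw [← Finset.HasAntidiagonal.mem_antidiagonal.1 hp, pow_add]; ring
lemma ee_pow (τ : Complex) (n : Nat) : ee τ ^ n = ee (n * τ) := (ee_nat_mul n τ).symm
lemma evq_hasSum (f : CQ) {τ : Complex} (hτ : 0 < τ.im) :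
    HasSum (fun n : Nat => PowerSeries.coeff n f.1 * ee (n * τ)) (evq τ f) := by
  have h := (CQ_summable_norm f _ (norm_qq τ)).of_norm.hasSum
  simp only [qq, if_pos hτ, ee_pow] at h
  simpa [evq, qq, if_pos hτ, ee_pow] using h
def lz (z : Complex) : LA →+* Complex := LaurentPolynomial.eval₂ (Int.castRingHom Complex) (Units.mk0 (ee z) (ee_ne z))
lemma lz_T (z : Complex) (n : Int) : lz z (LaurentPolynomial.T n) = ee (n * z) := by
  rw [lz, LaurentPolynomial.eval₂_T, ee_int_mul]; simp
lemma lz_C (z : Complex) (n : Int) : lz z (LaurentPolynomial.C n) = n := by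
  rw [lz, LaurentPolynomial.eval₂_C]; simp
lemma lz_hasSum (z : Complex) (P : LA) : HasSum (fun r : Int => (P.coeff r : Complex) * ee (r * z)) (lz z P) := by
  have h : lz z P = ∑ r ∈ P.coeff.support, (P.coeff r : Complex) * ee (r * z) := by
    conv_lhs => rw [LA_decomp P]
    simp only [map_sum, map_mul, lz_T, lz_C]
  rw [h]
  apply hasSum_sum_of_ne_finset_zero
  simp_all
lemma norm_mono (z : Complex) (P : LA) (r : Int) : ‖(P.coeff r : Complex) * ee (r * z)‖ = |(P.coeff r : Real)| * ‖ee z‖ ^ r := by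
  rw [norm_mul, ee_int_mul, norm_zpow]; simp
lemma ee_pos (z : Complex) : 0 < ‖ee z‖ := norm_pos_iff.2 (ee_ne z)
lemma norm_lz (z : Complex) (P : LA) : ‖lz z P‖ ≤ Ln ‖ee z‖ P := by
  rw [← (lz_hasSum z P).tsum_eq]
  refine (norm_tsum_le_tsum_norm ?_).trans (le_of_eq ?_)
  · simp only [norm_mono]; exact Ln_summable _ _
  · simp only [norm_mono]; rfl
def lzC (z : Complex) : CJ →+* CQ :=
  ((PowerSeries.map (lz z)).comp (Subring.subtype CJ)).codRestrict CQ (fun f _ ρ h0 h1 => by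
    refine Summable.of_nonneg_of_le (fun n => by positivity) (fun n => ?_) (f.2 ⟨‖ee z‖, ee_pos z⟩ ρ h0 h1)
    gcongr
    exact norm_lz z _)
def EV (τ z : Complex) : CJ →+* Complex := (evq τ).comp (lzC z)
lemma EV_hasSum (f : CJ) {τ : Complex} (hτ : 0 < τ.im) (z : Complex) :
    HasSum (fun n : Nat => lz z (PowerSeries.coeff n f.1) * ee (n * τ)) (EV τ z f) := by
  have h := evq_hasSum (lzC z f) hτ
  have e : ∀ n, PowerSeries.coeff n (lzC z f).1 = lz z (PowerSeries.coeff n f.1) :=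
    fun n => PowerSeries.coeff_map (lz z) n f.1
  simp only [e] at h
  exact h
lemma EV_hasSum2 (f : CJ) {τ : Complex} (hτ : 0 < τ.im) (z : Complex) :
    HasSum (fun p : Nat × Int => ((PowerSeries.coeff p.1 f.1).coeff p.2 : Complex) * ee (p.1 * τ + p.2 * z)) (EV τ z f) := by
  have hterm : ∀ n : Nat, ∀ r : Int, ((PowerSeries.coeff n f.1).coeff r : Complex) * ee (n * τ + r * z) =
      ((PowerSeries.coeff n f.1).coeff r : Complex) * ee (r * z) * ee (n * τ) := by
    intro n r; rw [ee_add]; ring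
  have hs : Summable fun p : Nat × Int => ((PowerSeries.coeff p.1 f.1).coeff p.2 : Complex) * ee (p.1 * τ + p.2 * z) := by
    apply Summable.of_norm
    have hn : ∀ n : Nat, ∀ r : Int, ‖((PowerSeries.coeff n f.1).coeff r : Complex) * ee (n * τ + r * z)‖ =
      |((PowerSeries.coeff n f.1).coeff r : Real)| * ‖ee z‖ ^ r * ‖ee τ‖ ^ n := by
      intro n r; rw [hterm, norm_mul, norm_mono, ← ee_pow, norm_pow]
    rw [summable_prod_of_nonneg (fun p => norm_nonneg _)]
    refine ⟨fun n => ?_, ?_⟩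
    · simp only [hn]; exact (Ln_summable _ _).mul_right _
    · simp only [hn, tsum_mul_right]
      exact f.2 ⟨‖ee z‖, ee_pos z⟩ ‖ee τ‖ (norm_nonneg _) (norm_ee_lt hτ)
  have h2 := hs.hasSum.prod_fiberwise (fun n => by
    have := (lz_hasSum z (PowerSeries.coeff n f.1)).mul_right (ee (n * τ))
    simpa only [hterm] using this)
  rw [(EV_hasSum f hτ z).unique h2]
  exact hs.hasSum
structure TD (ι : Type) where
  r : ι → Int
  g : ι → Nat
  ε : Int
  δ : Int
  inj : Function.Injective r
  hg : ∀ i, 4 * (g i : Int) + ε = r i ^ 2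
namespace TD
variable {ι : Type} (D : TD ι)
lemma fin (N : Nat) : {i | D.g i = N}.Finite := by
  have h : {x : Int | x ^ 2 = 4 * (N:Int) + D.ε}.Finite := by
    refine (Set.finite_Icc (-(4 * (N:Int) + D.ε)) (4 * (N:Int) + D.ε)).subset fun x hx => ?_
    simp only [Set.mem_setOf_eq] at hx
    rw [← hx, Set.mem_Icc]
    constructor <;> nlinarith [Int.le_self_sq x, Int.le_self_sq (-x)]
  refine (h.preimage (f := D.r) D.inj.injOn).subset fun i hi => ?_
  simp only [Set.mem_setOf_eq] at hi
  simp only [Set.mem_preimage, Set.mem_setOf_eq]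
  rw [← hi, D.hg]
lemma term_eq (i : ι) (τ z : Complex) : ee (D.g i * τ + (D.δ * D.r i : Int) * z) =
    ee (-(D.ε / 4) * τ) * ga 1 (D.r i) τ (D.δ * z) := by
  rw [ga, ← ee_add]
  congr 1
  have := D.hg i
  have h2 : (D.r i : Complex) ^ 2 = 4 * (D.g i : Complex) + D.ε := by exact_mod_cast this.symm
  rw [h2]; push_cast; ring
lemma summ {τ : Complex} (hτ : 0 < τ.im) (z : Complex) : Summable fun i => ee (D.g i * τ + (D.δ * D.r i : Int) * z) := by
  simp only [term_eq]
  exact (((summable_ga 1 hτ (D.δ * z)).comp_injective D.inj)).mul_left _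
lemma summ_real {t ρ : Real} (ht : 0 < t) (h0 : 0 ≤ ρ) (h1 : ρ < 1) :
    Summable fun i => t ^ (D.δ * D.r i) * ρ ^ (D.g i) := by
  set ρ' := max ρ (1/2) with hρ'
  have h0' : 0 < ρ' := lt_of_lt_of_le (by norm_num) (le_max_right _ _)
  have h1' : ρ' < 1 := max_lt h1 (by norm_num)
  have hτ : 0 < (I * ((-(Real.log ρ') / (2 * Real.pi) : Real) : Complex)).im := by
    simp only [Complex.mul_im, Complex.I_re, Complex.I_im, Complex.ofReal_re, Complex.ofReal_im]
    have := Real.log_neg h0' h1'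
    have := Real.pi_pos
    simp_all
  have key : ∀ x : Real, 0 < x → ‖ee (I * ((-(Real.log x) / (2 * Real.pi) : Real) : Complex))‖ = x := by
    intro x hx
    rw [norm_ee]
    simp only [Complex.mul_im, Complex.I_re, Complex.I_im, Complex.ofReal_re, Complex.ofReal_im]
    have := Real.pi_pos
    rw [show -(2 * Real.pi * (0 * 0 + 1 * (-Real.log x / (2 * Real.pi)))) = Real.log x by field_simp; ring,
      Real.exp_log hx]
  have hs := (D.summ hτ (I * ((-(Real.log t) / (2 * Real.pi) : Real) : Complex))).norm
  refine Summable.of_nonneg_of_le (fun i => by positivity) (fun i => ?_) hs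
  rw [ee_add, norm_mul, ee_int_mul, ee_nat_mul, norm_zpow, norm_pow, key _ h0', key _ ht, mul_comm]
  gcongr
  exact le_max_left _ _
lemma fib {E : Type*} [NormedAddCommGroup E] [CompleteSpace E] (f : ι → E) (hf : Summable f) :
    HasSum (fun N => ∑ i ∈ (D.fin N).toFinset, f i) (∑' i, f i) := by
  have h := hf.hasSum.tsum_fiberwise D.g
  refine Eq.mp (congrArg (fun f => HasSum f _) (funext fun N => ?_)) h
  have e : D.g ⁻¹' {N} = ↑(D.fin N).toFinset := by ext; simp
  rw [e, Finset.tsum_subtype']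
def ser : CJ := ⟨PowerSeries.mk fun N => ∑ i ∈ (D.fin N).toFinset, LaurentPolynomial.T (D.δ * D.r i), by
  intro t ρ h0 h1
  refine Summable.of_nonneg_of_le (fun n => by positivity) (fun N => ?_) (D.fib _ (D.summ_real t.2 h0 h1)).summable
  rw [PowerSeries.coeff_mk]
  calc _ ≤ (∑ i ∈ (D.fin N).toFinset, Ln t (LaurentPolynomial.T (D.δ * D.r i))) * ρ ^ N := by
        gcongr; exact Ln_sum t.2 _ _
    _ = _ := by
        rw [Finset.sum_mul]
        refine Finset.sum_congr rfl fun i hi => ?_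
        have : D.g i = N := by simpa using hi
        rw [Ln_T, this]⟩
lemma ev {τ : Complex} (hτ : 0 < τ.im) (z : Complex) :
    EV τ z D.ser = ee (-(D.ε / 4) * τ) * ∑' i, ga 1 (D.r i) τ (D.δ * z) := by
  have h1 := EV_hasSum D.ser hτ z
  have h2 := D.fib _ (D.summ hτ z)
  simp only [term_eq] at h2
  rw [tsum_mul_left] at h2
  refine h1.unique (Eq.mp (congrArg (fun f => HasSum f _) (funext fun N => ?_)) h2)
  rw [ser]
  simp only [PowerSeries.coeff_mk, map_sum, lz_T, Finset.sum_mul]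
  refine Finset.sum_congr rfl fun i hi => ?_
  have : D.g i = N := by simpa using hi
  rw [← term_eq, ee_add, this]; ring
end TD
def D0 (δ : Int) : TD Int := ⟨fun n => 2 * n, fun n => (n ^ 2).natAbs, 0, δ, fun a b h => by simpa using h,
  fun i => by rw [Int.natAbs_of_nonneg (sq_nonneg i)]; ring⟩
def D1 : TD Int := ⟨fun n => 2 * n + 1, fun n => (n ^ 2 + n).natAbs, 1, 1, fun a b h => by simpa using h,
  fun i => by
    have : 0 ≤ i ^ 2 + i := by nlinarith [Int.le_self_sq (-i)]
    rw [Int.natAbs_of_nonneg this]; ring⟩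
def DB : TD Nat := ⟨fun k => 2 * k + 1, fun k => k ^ 2 + k, 1, 0, fun a b h => by simpa using h,
  fun i => by push_cast; ring⟩
def t0 : CJ := (D0 1).ser
def t1 : CJ := D1.ser
def al : CJ := (D0 0).ser
def b1 : CJ := DB.ser
def th0 (τ z : Complex) : Complex := ∑' n : Int, ga 1 (2 * n) τ z
def th1 (τ z : Complex) : Complex := ∑' n : Int, ga 1 (2 * n + 1) τ z
lemma ev_t0 {τ : Complex} (hτ : 0 < τ.im) (z : Complex) : th0 τ z = EV τ z t0 := by
  rw [t0, TD.ev _ hτ]; simp [D0, th0, ee_zero]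
lemma ev_al {τ : Complex} (hτ : 0 < τ.im) (z : Complex) : th0 τ 0 = EV τ z al := by
  rw [al, TD.ev _ hτ]; simp [D0, th0, ee_zero]
lemma ev_t1 {τ : Complex} (hτ : 0 < τ.im) (z : Complex) : th1 τ z = ee (τ / 4) * EV τ z t1 := by
  rw [t1, TD.ev _ hτ, ← mul_assoc, ← ee_add]; simp [D1, th1, neg_div]
  rw [show τ / 4 + -(4⁻¹ * τ) = 0 by ring, ee_zero, one_mul]
lemma ev_b1 {τ : Complex} (hτ : 0 < τ.im) (z : Complex) : th1 τ 0 = 2 * ee (τ / 4) * EV τ z b1 := by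
  rw [b1, TD.ev _ hτ, mul_assoc, ← mul_assoc (ee _), ← ee_add]; simp [DB, th1, neg_div]
  rw [show τ / 4 + -(4⁻¹ * τ) = 0 by ring, ee_zero, one_mul]
  have h1 : Summable fun k : Nat => ga 1 (2 * k + 1) τ 0 :=
    (summable_ga 1 hτ 0).comp_injective (i := fun k : Nat => 2 * (k:Int) + 1) (fun a b h => by simpa using h)
  have h := HasSum.of_nat_of_neg_add_one (f := fun n : Int => ga 1 (2 * n + 1) τ 0) h1.hasSum
    (m' := ∑' k : Nat, ga 1 (2 * k + 1) τ 0) (by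
      refine Eq.mp (congrArg (fun f => HasSum f _) (funext fun k => ?_)) h1.hasSum
      simp only [ga]; congr 1; push_cast; ring)
  rw [h.tsum_eq]; ring
lemma th_eq0 (τ z : Complex) : th0 τ z = ∑' r : Int, (if (r : ZMod (2 * 1)) = ((0:Int) : ZMod (2 * 1)) then ga 1 r τ z else 0) := by
  rw [tsum_residue]; simp [th0]
lemma th_eq1 (τ z : Complex) : th1 τ z = ∑' r : Int, (if (r : ZMod (2 * 1)) = ((1:Int) : ZMod (2 * 1)) then ga 1 r τ z else 0) := by
  rw [tsum_residue]; simp [th1, add_comm]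
lemma zmod2_cases (x : ZMod (2 * 1)) : x = ((0:Int) : ZMod (2 * 1)) ∨ x = ((1:Int) : ZMod (2 * 1)) := by
  revert x; decide
lemma zmod2_ne : ¬ ((0:Int) : ZMod (2 * 1)) = ((1:Int) : ZMod (2 * 1)) := by decide
lemma th_split {τ : Complex} (hτ : 0 < τ.im) (z : Complex) (v : ZMod (2 * 1) → Complex) :
    ∑' r : Int, v r * ga 1 r τ z = v ((0:Int) : ZMod (2 * 1)) * th0 τ z + v ((1:Int) : ZMod (2 * 1)) * th1 τ z := by
  have hs : ∀ ll : ZMod (2 * 1), Summable fun r : Int => (if (r : ZMod (2 * 1)) = ll then ga 1 r τ z else 0) := by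
    intro ll
    refine Summable.of_norm_bounded (summable_ga 1 hτ z).norm (fun r => ?_)
    split_ifs <;> simp
  rw [th_eq0, th_eq1, ← tsum_mul_left, ← tsum_mul_left, ← ((hs _).mul_left _).tsum_add ((hs _).mul_left _)]
  refine tsum_congr fun r => ?_
  rcases zmod2_cases (r : ZMod (2 * 1)) with h | h <;> rw [h]
  · simp
  simp
lemma th0_S {τ : Complex} (hτ : 0 < τ.im) (z : Complex) :
    th0 (-1 / τ) (z / τ) = kap 1 τ * ee (z ^ 2 / τ) * (th0 τ z + th1 τ z) := by
  rw [th_eq0, theta_S 1 hτ, th_split hτ z (fun x => ZMod.stdAddChar (-(((0:Int) : ZMod (2 * 1)) * x)))]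
  simp
lemma th1_S {τ : Complex} (hτ : 0 < τ.im) (z : Complex) :
    th1 (-1 / τ) (z / τ) = kap 1 τ * ee (z ^ 2 / τ) * (th0 τ z - th1 τ z) := by
  rw [th_eq1, theta_S 1 hτ, th_split hτ z (fun x => ZMod.stdAddChar (-(((1:Int) : ZMod (2 * 1)) * x)))]
  have h : (ZMod.stdAddChar (-(((1:Int) : ZMod (2 * 1)) * ((1:Int) : ZMod (2 * 1)))) : Complex) = -1 := by
    rw [show (-(((1:Int) : ZMod (2 * 1)) * ((1:Int) : ZMod (2 * 1)))) = ((1:Int) : ZMod (2 * 1)) by decide, chi_ee, ee]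
    rw [show 2 * (Real.pi:Complex) * I * (((1:Int):Complex) / ((2 * 1 : Nat) : Complex)) = Real.pi * I by push_cast; ring, Complex.exp_pi_mul_I]
  rw [h]
  simp [sub_eq_add_neg]
lemma th_ell (l : Int) : EllipticLaw 1 (fun τ z => ∑' r : Int, (if (r : ZMod (2 * 1)) = (l : ZMod (2 * 1)) then ga 1 r τ z else 0)) := by
  have h := Phi_elliptic 1 (fun Δ ll => if Δ = 0 ∧ ll = (l : ZMod (2 * 1)) then 1 else 0)
  have e : Phi 1 (fun Δ ll => if Δ = 0 ∧ ll = (l : ZMod (2 * 1)) then 1 else 0) =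
      (fun τ z => ∑' r : Int, (if (r : ZMod (2 * 1)) = (l : ZMod (2 * 1)) then ga 1 r τ z else 0)) := by
    funext τ z
    rw [Phi]
    refine tsum_congr fun r => ?_
    rw [hh, tsum_eq_single 0 (fun b hb => by simp [hb])]
    by_cases h : (r : ZMod (2 * 1)) = (l : ZMod (2 * 1))
    · rw [if_pos ⟨rfl, h⟩, if_pos h]; simp [ee_zero]
    grind
  rwa [e] at h
lemma th0_ell : EllipticLaw 1 th0 := by
  have : th0 = _ := funext fun τ => funext fun z => th_eq0 τ z
  rw [this]; exact th_ell 0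
lemma th1_ell : EllipticLaw 1 th1 := by
  have : th1 = _ := funext fun τ => funext fun z => th_eq1 τ z
  rw [this]; exact th_ell 1
def ph (s : Int) (f : CJ) (τ z : Complex) : Complex := ee (s * τ) * EV τ z f
structure JF (k : Int) (m : Nat) (s : Int) (f : CJ) : Prop where
  ell : EllipticLaw m (ph s f)
  slaw : SLaw k m (ph s f)
lemma JF.of_eq {k : Int} {m : Nat} {s : Int} {f : CJ} (φ : Complex → Complex → Complex)
    (h : ∀ τ z, 0 < τ.im → φ τ z = ph s f τ z) (hE : EllipticLaw m φ) (hS : SLaw k m φ) : JF k m s f := by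
  constructor
  · intro τ hτ z l n
    rw [← h _ _ hτ, ← h _ _ hτ]; exact hE τ hτ z l n
  · intro τ z hτ
    rw [← h _ _ hτ, ← h _ _ (im_S_pos hτ)]; exact hS τ z hτ
lemma ph_mul (s s' : Int) (f g : CJ) (τ z : Complex) : ph (s + s') (f * g) τ z = ph s f τ z * ph s' g τ z := by
  simp only [ph, map_mul]; push_cast; rw [add_mul, ee_add]; ring
lemma JF.mul {k k' : Int} {m m' : Nat} {s s' : Int} {f g : CJ} (hf : JF k m s f) (hg : JF k' m' s' g) :
    JF (k + k') (m + m') (s + s') (f * g) := by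
  constructor
  · intro τ hτ z l n
    rw [ph_mul, ph_mul, hf.ell τ hτ, hg.ell τ hτ]
    push_cast
    rw [show -((m:Complex) + m') * ((l:Complex) ^ 2 * τ + 2 * l * z) = -(m:Complex) * ((l:Complex) ^ 2 * τ + 2 * l * z) + -(m':Complex) * ((l:Complex) ^ 2 * τ + 2 * l * z) by ring, ee_add]
    ring
  · intro τ z hτ
    rw [ph_mul, ph_mul, hf.slaw τ z hτ, hg.slaw τ z hτ, zpow_add₀ (ne_zero_of_im hτ)]
    push_cast
    rw [show ((m:Complex) + m') * z ^ 2 / τ = m * z ^ 2 / τ + m' * z ^ 2 / τ by ring, ee_add]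
    ring
lemma JF.one : JF 0 0 0 1 := by
  constructor
  · intro τ hτ z l n; simp [ph, ee_zero]
  · intro τ z hτ; simp [ph, ee_zero]
lemma JF.pow {k : Int} {m : Nat} {s : Int} {f : CJ} (hf : JF k m s f) (n : Nat) : JF (n * k) (n * m) (n * s) (f ^ n) := by
  induction n with
  | zero => simpa using JF.one
  | succ n ih =>
    rw [pow_succ]
    have := ih.mul hf
    rw [show ((n+1:Nat):Int) * k = n * k + k by push_cast; ring, show ((n+1:Nat):Int) * s = n * s + s by push_cast; ring,
      show (n+1) * m = n * m + m by ring]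
    exact this
def XC : CJ := ⟨PowerSeries.X, fun t ρ _ _ => by
  apply summable_of_ne_finset_zero (s := {1})
  intro b hb
  simp only [Finset.mem_singleton] at hb
  simp [PowerSeries.coeff_X, hb]⟩
lemma ev_X {τ : Complex} (hτ : 0 < τ.im) (z : Complex) : EV τ z XC = ee τ := by
  have h := EV_hasSum XC hτ z
  refine h.unique ?_
  have := hasSum_single (f := fun n : Nat => lz z (PowerSeries.coeff n XC.1) * ee (n * τ)) 1 (fun b hb => by
    simp [XC, PowerSeries.coeff_X, hb])
  simpa [XC] using this
def fE4 : CJ := al ^ 8 + 224 * XC * al ^ 4 * b1 ^ 4 + 256 * XC ^ 2 * b1 ^ 8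
def fE6 : CJ := al ^ 12 - 528 * XC * al ^ 8 * b1 ^ 4 - 8448 * XC ^ 2 * al ^ 4 * b1 ^ 8 + 4096 * XC ^ 3 * b1 ^ 12
def fk1 : CJ := al * b1 * (al ^ 4 - 16 * XC * b1 ^ 4)
def fu : CJ := fk1 ^ 4
def fE41 : CJ := (al ^ 7 + 112 * XC * al ^ 3 * b1 ^ 4) * t0 + (56 * XC * al ^ 4 * b1 ^ 3 + 128 * XC ^ 2 * b1 ^ 7) * t1
def fphi : CJ := fk1 ^ 3 * (al * t1 - 2 * b1 * t0)
lemma w4 (τ : Complex) : ee τ = ee (τ / 4) ^ 4 := by rw [ee_pow]; congr 1; push_cast; ring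
lemma kap1_sq {τ : Complex} : kap 1 τ ^ 2 = -I * (τ / 2) := by rw [kap_sq]; simp
lemma al_S {τ : Complex} (hτ : 0 < τ.im) : th0 (-1 / τ) 0 = kap 1 τ * (th0 τ 0 + th1 τ 0) := by
  have := th0_S hτ 0; simpa [ee_zero] using this
lemma be_S {τ : Complex} (hτ : 0 < τ.im) : th1 (-1 / τ) 0 = kap 1 τ * (th0 τ 0 - th1 τ 0) := by
  have := th1_S hτ 0; simpa [ee_zero] using this
lemma kap1_4 (τ : Complex) : kap 1 τ ^ 4 = -τ ^ 2 / 4 := by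
  rw [show kap 1 τ ^ 4 = (kap 1 τ ^ 2) ^ 2 by ring, kap1_sq]; linear_combination (τ ^ 2 / 4) * I_sq
lemma kap1_6 (τ : Complex) : kap 1 τ ^ 6 = I * τ ^ 3 / 8 := by
  rw [show kap 1 τ ^ 6 = kap 1 τ ^ 4 * (kap 1 τ ^ 2) by ring, kap1_sq, kap1_4]; ring
lemma ell_const (c : Complex → Complex) : EllipticLaw 0 (fun τ _ => c τ) := by
  intro τ hτ z l n; simp [ee_zero]
lemma jf_E4 : JF 4 0 0 fE4 := by
  refine JF.of_eq (fun τ _ => th0 τ 0 ^ 8 + 14 * th0 τ 0 ^ 4 * th1 τ 0 ^ 4 + th1 τ 0 ^ 8) ?_ (ell_const _) ?_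
  · intro τ z hτ
    rw [ev_al hτ z, ev_b1 hτ z]
    simp only [ph, fE4, map_add, map_mul, map_pow, ev_X hτ, map_ofNat, Int.cast_zero, zero_mul, ee_zero]
    rw [w4 τ]; ring
  · intro τ z hτ
    simp only [al_S hτ, be_S hτ]
    rw [show τ ^ (4:Int) = 16 * (kap 1 τ ^ 4) ^ 2 by rw [kap1_4]; norm_cast; ring]
    simp [ee_zero]; ring
lemma jf_E6 : JF 6 0 0 fE6 := by
  refine JF.of_eq (fun τ _ => th0 τ 0 ^ 12 - 33 * th0 τ 0 ^ 8 * th1 τ 0 ^ 4 - 33 * th0 τ 0 ^ 4 * th1 τ 0 ^ 8 + th1 τ 0 ^ 12) ?_ (ell_const _) ?_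
  · intro τ z hτ
    rw [ev_al hτ z, ev_b1 hτ z]
    simp only [ph, fE6, map_add, map_sub, map_mul, map_pow, ev_X hτ, map_ofNat, Int.cast_zero, zero_mul, ee_zero]
    rw [w4 τ]; ring
  · intro τ z hτ
    simp only [al_S hτ, be_S hτ]
    have e6 : τ ^ (6:Int) = τ ^ 6 := by norm_cast
    rw [e6, show τ ^ 6 = -64 * (kap 1 τ ^ 4) ^ 3 by rw [kap1_4]; ring]
    simp [ee_zero]; ring
def kpf (τ : Complex) : Complex := th0 τ 0 * th1 τ 0 * (th0 τ 0 ^ 4 - th1 τ 0 ^ 4) / 2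
lemma kpf_ev {τ : Complex} (hτ : 0 < τ.im) (z : Complex) : kpf τ = ee (τ / 4) * EV τ z fk1 := by
  rw [kpf, ev_al hτ z, ev_b1 hτ z]
  simp only [fk1, map_sub, map_mul, map_pow, ev_X hτ, map_ofNat]
  rw [w4 τ]; ring
lemma kpf_S {τ : Complex} (hτ : 0 < τ.im) : kpf (-1 / τ) = I * τ ^ 3 * kpf τ := by
  simp only [kpf, al_S hτ, be_S hτ]
  rw [show I * τ ^ 3 = 8 * (kap 1 τ ^ 6) by rw [kap1_6]; ring]; ring
lemma jf_u : JF 12 0 1 fu := by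
  refine JF.of_eq (fun τ _ => kpf τ ^ 4) ?_ (ell_const _) ?_
  · intro τ z hτ
    rw [kpf_ev hτ z]
    simp only [ph, fu, map_pow, Int.cast_one, one_mul]
    rw [w4 τ]; ring
  · intro τ z hτ
    simp only [kpf_S hτ]
    have : τ ^ (12:Int) = τ ^ 12 := by norm_cast
    rw [this]
    simp [ee_zero]; rw [show (I * τ ^ 3 * kpf τ) ^ 4 = (I ^ 2) ^ 2 * τ ^ 12 * kpf τ ^ 4 by ring, I_sq]; ring
lemma ell_mix (c d : Complex → Complex) : EllipticLaw 1 (fun τ z => c τ * th0 τ z + d τ * th1 τ z) := by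
  intro τ hτ z l n
  simp only
  rw [th0_ell τ hτ, th1_ell τ hτ]; ring
lemma jf_E41 : JF 4 1 0 fE41 := by
  refine JF.of_eq (fun τ z => (th0 τ 0 ^ 7 + 7 * th0 τ 0 ^ 3 * th1 τ 0 ^ 4) * th0 τ z +
    (7 * th0 τ 0 ^ 4 * th1 τ 0 ^ 3 + th1 τ 0 ^ 7) * th1 τ z) ?_ (ell_mix _ _) ?_
  · intro τ z hτ
    rw [ev_al hτ z, ev_b1 hτ z, ev_t0 hτ z, ev_t1 hτ z]
    simp only [ph, fE41, map_add, map_mul, map_pow, ev_X hτ, map_ofNat, Int.cast_zero, zero_mul, ee_zero]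
    rw [w4 τ]; ring
  · intro τ z hτ
    simp only [al_S hτ, be_S hτ, th0_S hτ, th1_S hτ]
    rw [show τ ^ (4:Int) = 16 * (kap 1 τ ^ 4) ^ 2 by rw [kap1_4]; norm_cast; ring]
    simp; ring
lemma jf_phi : JF 10 1 1 fphi := by
  refine JF.of_eq (fun τ z => (-(kpf τ ^ 3 * th1 τ 0)) * th0 τ z + (kpf τ ^ 3 * th0 τ 0) * th1 τ z) ?_ (ell_mix _ _) ?_
  · intro τ z hτ
    rw [kpf_ev hτ z, ev_al hτ z, ev_b1 hτ z, ev_t0 hτ z, ev_t1 hτ z]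
    simp only [ph, fphi, map_sub, map_mul, map_pow, map_ofNat, Int.cast_one, one_mul]
    rw [w4 τ]; ring
  · intro τ z hτ
    simp only [kpf_S hτ, al_S hτ, be_S hτ, th0_S hτ, th1_S hτ]
    have : τ ^ (10:Int) = τ ^ 10 := by norm_cast
    rw [this]
    simp
    linear_combination (exp := 1) (-2 * (I * τ ^ 3 * kpf τ) ^ 3 * ee (z ^ 2 / τ) * (th0 τ 0 * th1 τ z - th1 τ 0 * th0 τ z)) * (kap1_sq (τ := τ)) +
      (I ^ 2 - 1) * τ ^ 10 * kpf τ ^ 3 * ee (z ^ 2 / τ) * (th0 τ 0 * th1 τ z - th1 τ 0 * th0 τ z) * I_sq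
lemma rho_small {τ : Complex} (h : 3 ≤ 4 * τ.im ^ 2) (h0 : 0 < τ.im) : ‖ee τ‖ ≤ 1 / 100 := by
  rw [norm_ee]
  have h1 : (5:Real) ≤ 2 * Real.pi * τ.im := by
    have : (0.86:Real) ≤ τ.im := by nlinarith
    nlinarith [Real.pi_gt_three]
  have h2 : (100:Real) ≤ Real.exp 5 := by
    have := Real.exp_one_gt_d9
    rw [show (5:Real) = ((5:Nat):Real) * 1 by norm_num, Real.exp_nat_mul]
    calc (100:Real) ≤ 2.7 ^ 5 := by norm_num
      _ ≤ _ := by gcongr; linarith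
  rw [Real.exp_neg, one_div]
  exact inv_anti₀ (by norm_num) (h2.trans (Real.exp_le_exp.2 h1))
lemma al_near {τ : Complex} (h0 : 0 < τ.im) (h : ‖ee τ‖ ≤ 1 / 100) (z : Complex) : ‖EV τ z al - 1‖ ≤ 2 / 99 := by
  rw [← ev_al h0]
  have e : th0 τ 0 = jacobiTheta (2 * τ) := by
    rw [th0, jacobiTheta]
    refine tsum_congr fun n => ?_
    rw [ga, ee]; congr 1; push_cast; ring
  have h1 := norm_jacobiTheta_sub_one_le (τ := 2 * τ) (by simpa using h0)
  rw [e]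
  have e2 : Real.exp (-Real.pi * (2 * τ).im) = ‖ee τ‖ := by
    rw [norm_ee]; congr 1; simp; ring
  rw [e2] at h1
  refine h1.trans ?_
  have := norm_nonneg (ee τ)
  rw [div_mul_eq_mul_div, div_le_div_iff₀ (by linarith) (by norm_num)]
  linarith
lemma b1_near {τ : Complex} (h0 : 0 < τ.im) (h : ‖ee τ‖ ≤ 1 / 100) (z : Complex) : ‖EV τ z b1 - 1‖ ≤ 1 / 99 := by
  have e : EV τ z b1 = ∑' k : Nat, ee (((k ^ 2 + k : Nat) : Complex) * τ) := by
    rw [b1, TD.ev _ h0, ← tsum_mul_left]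
    refine tsum_congr fun k => ?_
    rw [← TD.term_eq]; simp [DB]
  have hs : Summable fun k : Nat => ee (((k ^ 2 + k : Nat) : Complex) * τ) := by
    have := DB.summ h0 z; simpa [DB] using this
  rw [e, hs.tsum_eq_zero_add]
  have hle : ∀ k : Nat, ‖ee ((((k+1) ^ 2 + (k+1) : Nat) : Complex) * τ)‖ ≤ (1/100:Real) * (1/100:Real) ^ k := by
    intro k
    rw [← ee_pow, norm_pow, ← pow_succ']
    calc _ ≤ (1/100:Real) ^ ((k+1)^2 + (k+1)) := by gcongr
      _ ≤ _ := pow_le_pow_of_le_one (by norm_num) (by norm_num) (by nlinarith)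
  have hg : HasSum (fun k : Nat => (1/100:Real) * (1/100:Real) ^ k) (1/100 * (1 - 1/100)⁻¹) :=
    (hasSum_geometric_of_lt_one (by norm_num) (by norm_num)).mul_left _
  have := tsum_of_norm_bounded hg hle
  simp only [ne_eq, OfNat.ofNat_ne_zero, not_false_eq_true, zero_pow, add_zero, Nat.cast_zero, zero_mul, ee_zero, add_sub_cancel_left]
  refine this.trans (by norm_num)
lemma fk1_ne_fd {τ : Complex} (h : 3 ≤ 4 * τ.im ^ 2) (h0 : 0 < τ.im) (z : Complex) : EV τ z fk1 ≠ 0 := by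
  have hr := rho_small h h0
  have ha := al_near h0 hr z
  have hb := b1_near h0 hr z
  simp only [fk1, map_sub, map_mul, map_pow, ev_X h0, map_ofNat]
  set a := EV τ z al
  set b := EV τ z b1
  have ha2 : 97 / 99 ≤ ‖a‖ := by
    have := norm_sub_norm_le (1:Complex) (1 - a)
    rw [norm_sub_rev 1 a] at this
    simp at this; linarith
  have hb2 : 98 / 99 ≤ ‖b‖ := by
    have := norm_sub_norm_le (1:Complex) (1 - b)
    rw [norm_sub_rev 1 b] at this
    simp at this; linarith
  have hb3 : ‖b‖ ≤ 100 / 99 := by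
    have := norm_add_le (b - 1) 1
    simp at this; linarith
  have ha0 : a ≠ 0 := by rintro e; rw [e] at ha2; norm_num at ha2
  have hb0 : b ≠ 0 := by rintro e; rw [e] at hb2; norm_num at hb2
  refine mul_ne_zero (mul_ne_zero ha0 hb0) ?_
  intro e
  have e1 : ‖a ^ 4‖ = ‖16 * ee τ * b ^ 4‖ := by rw [sub_eq_zero.1 e]
  rw [norm_mul, norm_mul, norm_pow, norm_pow] at e1
  have h1 : (97/99:Real) ^ 4 ≤ ‖a‖ ^ 4 := by gcongr
  have h2 : ‖b‖ ^ 4 ≤ (100/99:Real) ^ 4 := by gcongr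
  have h3 : ‖(16:Complex)‖ * ‖ee τ‖ * ‖b‖ ^ 4 ≤ 16 * (1/100) * (100/99:Real) ^ 4 := by
    have : ‖(16:Complex)‖ = 16 := by simp
    rw [this]; gcongr
  linarith
lemma qq_add_one (τ : Complex) : qq (τ + 1) = qq τ := by
  have : ee (τ + 1) = ee τ := by rw [ee_add, show (1:Complex) = ((1:Int):Complex) by simp, ee_int, mul_one]
  simp [qq, this]
lemma EV_add_one (τ z : Complex) (f : CJ) : EV (τ + 1) z f = EV τ z f := by
  change ∑' n, _ = ∑' n, _
  rw [qq_add_one]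
lemma fu_ne {τ : Complex} (h0 : 0 < τ.im) (z : Complex) : EV τ z fu ≠ 0 := by
  have hM := modularLaw_of jf_u.slaw (by
    intro τ z hτ
    rw [ph, ph, EV_add_one, mul_add, ee_add]
    simp [ee_int_mul]
    have := ee_int 1; simp at this; simp [this])
  obtain ⟨g, hg⟩ := ModularGroup.exists_smul_mem_fd (⟨τ, h0⟩ : UpperHalfPlane)
  have h3 := ModularGroup.three_le_four_mul_im_sq_of_mem_fd hg
  have hdet : g 0 0 * g 1 1 - g 0 1 * g 1 0 = 1 := by
    have := g.2; rw [Matrix.det_fin_two] at this; exact this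
  have h4 := hM τ h0 (z * (g 1 0 * τ + g 1 1)) (g 0 0) (g 0 1) (g 1 0) (g 1 1) hdet
  have hcoe : ((g 0 0 : Complex) * τ + g 0 1) / (g 1 0 * τ + g 1 1) = ((g • (⟨τ, h0⟩ : UpperHalfPlane) : UpperHalfPlane) : Complex) := by
    rw [UpperHalfPlane.coe_specialLinearGroup_apply]; simp
  rw [hcoe] at h4
  set w := g • (⟨τ, h0⟩ : UpperHalfPlane) with hw
  intro hz
  have hz' : ∀ z', EV τ z' fu = 0 := by
    intro z'
    have e1 : EV τ z' fu = EV τ z fu := by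
      simp only [fu, fk1, map_pow, map_mul, map_sub, map_ofNat, ev_X h0, ← ev_al h0]
      have hb : EV τ z' b1 = EV τ z b1 := by
        have h1 := ev_b1 h0 z'; rw [ev_b1 h0 z] at h1
        exact (mul_left_cancel₀ (mul_ne_zero two_ne_zero (ee_ne _)) h1).symm
      rw [hb]
    rw [e1, hz]
  have : ph 1 fu (w:Complex) (z * (g 1 0 * τ + g 1 1) / (g 1 0 * τ + g 1 1)) ≠ 0 := by
    refine mul_ne_zero (ee_ne _) ?_
    simp only [fu, map_pow]
    exact pow_ne_zero _ (fk1_ne_fd h3 w.2 _)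
  apply this
  rw [h4, ph, hz']; simp
lemma pow_unique (D : Nat → Complex) {s : Real} (hs0 : 0 < s) (hs : Summable fun n => ‖D n‖ * s ^ n)
    (h : ∀ x : Real, ∑' n, D n * ((s:Complex) * ee x) ^ n = 0) (n : Nat) : D n = 0 := by
  let c : Int → Complex := Function.extend (fun n : Nat => (n:Int)) (fun n => D n * (s:Complex) ^ n) 0
  have hinj : Function.Injective fun n : Nat => (n:Int) := Nat.cast_injective
  have hc : ∀ n : Nat, c n = D n * (s:Complex) ^ n := fun n => hinj.extend_apply _ _ n
  have hc0 : ∀ r : Int, r ∉ Set.range (fun n : Nat => (n:Int)) → c r = 0 := fun r hr =>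
    Function.extend_apply' _ _ _ (fun ⟨a, ha⟩ => hr ⟨a, ha⟩)
  have hsum : Summable c := by
    rw [← hinj.summable_iff hc0]
    refine Summable.of_norm ?_
    refine hs.congr fun n => ?_
    simp [hc, abs_of_pos hs0]
  have := fourier_unique c hsum (fun x => by
    rw [← h x, ← hinj.tsum_eq (f := fun r : Int => c r * ee (r * x))]
    · refine tsum_congr fun n => ?_
      rw [hc, mul_pow, ee_pow, mul_assoc]; simp
    · intro r hr
      by_contra hh
      exact hr (by simp [hc0 r hh])) n
  rw [hc] at this
  have h2 : (s:Complex) ^ n ≠ 0 := pow_ne_zero _ (by exact_mod_cast hs0.ne')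
  grind
lemma inv_conv (g gi : PowerSeries Complex) (hg : g ∈ CQ) (hgi : g * gi = 1)
    (hne : ∀ q : Complex, ‖q‖ < 1 → ∑' n, PowerSeries.coeff n g * q ^ n ≠ 0) : gi ∈ CQ := by
  intro _ ρ h0 h1
  let c : Nat → Complex := fun n => PowerSeries.coeff n g
  let p := FormalMultilinearSeries.ofScalars (𝕜 := Complex) Complex c
  have hsumn : ∀ q : Complex, ‖q‖ < 1 → Summable fun n => ‖c n * q ^ n‖ := fun q hq => CQ_summable_norm ⟨g, hg⟩ q hq
  have hrad : 1 ≤ p.radius := by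
    refine ENNReal.le_of_forall_nnreal_lt fun r hr => ?_
    apply p.le_radius_of_summable
    have := hsumn (r:Complex) (by simpa using hr)
    refine this.congr fun n => ?_
    rw [FormalMultilinearSeries.ofScalars_norm, norm_mul, norm_pow]; simp
  have hF : ∀ q : Complex, p.sum q = ∑' n, c n * q ^ n := by
    intro q
    rw [FormalMultilinearSeries.sum]
    refine tsum_congr fun n => ?_
    rw [FormalMultilinearSeries.ofScalars_apply_eq, smul_eq_mul]
  have hp := p.hasFPowerSeriesOnBall (lt_of_lt_of_le (by norm_num) hrad)
  have hd : DifferentiableOn Complex p.sum (Metric.ball 0 1) := by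
    refine hp.differentiableOn.mono fun x hx => ?_
    rw [Metric.mem_eball]
    refine lt_of_lt_of_le ?_ hrad
    rw [edist_zero_right, ← ENNReal.coe_one, enorm_lt_coe]
    have : ‖x‖ < 1 := by simpa using hx
    exact_mod_cast this
  set R : NNReal := ⟨(1 + ρ) / 2, by linarith⟩ with hR
  have hRv : (R:Real) = (1 + ρ) / 2 := rfl
  have hR1 : (R:Real) < 1 := by rw [hRv]; linarith
  have hR0 : 0 < R := by rw [← NNReal.coe_pos, hRv]; linarith
  have hρR : ρ < R := by rw [hRv]; linarith
  have hsub : Metric.closedBall (0:Complex) R ⊆ Metric.ball 0 1 := Metric.closedBall_subset_ball hR1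
  have hd2 : DifferentiableOn Complex (fun q => (p.sum q)⁻¹) (Metric.closedBall 0 R) :=
    (hd.mono hsub).inv (fun q hq => by rw [hF]; exact hne q (by simpa using hsub hq))
  have hps := hd2.hasFPowerSeriesOnBall hR0
  set P := cauchyPowerSeries (fun q => (p.sum q)⁻¹) 0 R
  let b : Nat → Complex := fun n => P.coeff n
  have hbs : ∀ r : NNReal, r < R → Summable fun n => ‖b n‖ * (r:Real) ^ n := by
    intro r hr
    have := P.summable_norm_mul_pow (r := r) (lt_of_lt_of_le (by exact_mod_cast hr) hps.r_le)
    refine this.congr fun n => ?_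
    rw [FormalMultilinearSeries.norm_apply_eq_norm_coef]
  have hbq : ∀ q : Complex, ‖q‖ < R → ∑' n, b n * q ^ n = (p.sum q)⁻¹ := by
    intro q hq
    have := hps.hasSum (y := q) (by rw [Metric.mem_eball, edist_zero_right, enorm_lt_coe]; exact_mod_cast hq)
    rw [zero_add] at this
    rw [← this.tsum_eq]
    refine tsum_congr fun n => ?_
    rw [FormalMultilinearSeries.apply_eq_pow_smul_coeff, smul_eq_mul, mul_comm]
  have hbqs : ∀ q : Complex, ‖q‖ < R → Summable fun n => ‖b n * q ^ n‖ := by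
    intro q hq
    refine (hbs ‖q‖₊ (by exact_mod_cast hq)).congr fun n => ?_
    simp
  have hprod : g * PowerSeries.mk b = 1 := by
    rw [← sub_eq_zero]
    have hterm : ∀ q : Complex, ‖q‖ < R → (Summable fun n => ‖PowerSeries.coeff n (g * PowerSeries.mk b - 1) * q ^ n‖) ∧
        ∑' n, PowerSeries.coeff n (g * PowerSeries.mk b - 1) * q ^ n = 0 := by
      intro q hq
      have hq1 : ‖q‖ < 1 := hq.trans hR1
      have s1 := summable_norm_sum_mul_antidiagonal_of_summable_norm (hsumn q hq1) (hbqs q hq)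
      have t1 := tsum_mul_tsum_eq_tsum_sum_antidiagonal_of_summable_norm (hsumn q hq1) (hbqs q hq)
      have e1 : ∀ n, ∑ kl ∈ Finset.HasAntidiagonal.antidiagonal n, c kl.1 * q ^ kl.1 * (b kl.2 * q ^ kl.2) =
          PowerSeries.coeff n (g * PowerSeries.mk b) * q ^ n := by
        intro n
        rw [PowerSeries.coeff_mul, Finset.sum_mul]
        refine Finset.sum_congr rfl fun p hp => ?_
        rw [← Finset.HasAntidiagonal.mem_antidiagonal.1 hp, pow_add, PowerSeries.coeff_mk]; ring
      simp only [e1] at s1 t1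
      rw [hbq q hq, ← hF, mul_inv_cancel₀ (by rw [hF]; exact hne q hq1)] at t1
      have o : HasSum (fun n => PowerSeries.coeff n (1 : PowerSeries Complex) * q ^ n) 1 := by
        have := hasSum_single (f := fun n => PowerSeries.coeff n (1 : PowerSeries Complex) * q ^ n) 0 (fun b hb => by
          simp [PowerSeries.coeff_one, hb])
        simpa using this
      have s2 := s1.of_norm.hasSum.sub o
      rw [← t1, sub_self] at s2
      simp only [← sub_mul, ← map_sub] at s2
      exact ⟨s2.summable.norm, s2.tsum_eq⟩
    ext n
    rw [map_zero]
    have hs0 : (0:Real) < (R:Real) / 2 := by have : (0:Real) < R := hR0; linarith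
    have hlt : ∀ x : Real, ‖(((R:Real) / 2 : Real) : Complex) * ee x‖ < R := by
      intro x
      rw [norm_mul, norm_ee_real, mul_one, Complex.norm_real, Real.norm_of_nonneg hs0.le]; linarith
    refine pow_unique (fun n => PowerSeries.coeff n (g * PowerSeries.mk b - 1)) hs0 ?_ (fun x => (hterm _ (hlt x)).2) n
    have := (hterm _ (hlt 0)).1
    refine this.congr fun n => ?_
    rw [norm_mul, norm_pow, norm_mul, norm_ee_real, mul_one, Complex.norm_real, Real.norm_of_nonneg hs0.le]
  have hgib : gi = PowerSeries.mk b := by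
    grind
  rw [hgib]
  have := hbs ⟨ρ, h0⟩ (by exact_mod_cast hρR)
  simp only [PowerSeries.coeff_mk]
  exact this
def ZS : Subring CJ := ((PowerSeries.map (LaurentPolynomial.C (R := Int))).range).comap CJ.subtype
lemma ser_ZS {ι : Type} (D : TD ι) (h : D.δ = 0) : D.ser ∈ ZS := by
  refine ⟨PowerSeries.mk fun N => ((D.fin N).toFinset.card : Int), ?_⟩
  ext1 N
  rw [PowerSeries.coeff_map, PowerSeries.coeff_mk]
  rw [Subring.subtype_apply, TD.ser, PowerSeries.coeff_mk]
  simp [h]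
lemma al_ZS : al ∈ ZS := ser_ZS _ rfl
lemma b1_ZS : b1 ∈ ZS := ser_ZS _ rfl
lemma XC_ZS : XC ∈ ZS := ⟨PowerSeries.X, by simp [XC]⟩
lemma fk1_ZS : fk1 ∈ ZS := by
  unfold fk1
  exact mul_mem (mul_mem al_ZS b1_ZS) (sub_mem (pow_mem al_ZS _) (mul_mem (mul_mem (ofNat_mem ZS 16) XC_ZS) (pow_mem b1_ZS _)))
lemma fu_ZS : fu ∈ ZS := pow_mem fk1_ZS _
lemma fE4_ZS : fE4 ∈ ZS := by
  unfold fE4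
  exact add_mem (add_mem (pow_mem al_ZS _) (mul_mem (mul_mem (mul_mem (ofNat_mem ZS 224) XC_ZS) (pow_mem al_ZS _)) (pow_mem b1_ZS _)))
    (mul_mem (mul_mem (ofNat_mem ZS 256) (pow_mem XC_ZS _)) (pow_mem b1_ZS _))
lemma fE6_ZS : fE6 ∈ ZS := by
  unfold fE6
  exact add_mem (sub_mem (sub_mem (pow_mem al_ZS _) (mul_mem (mul_mem (mul_mem (ofNat_mem ZS 528) XC_ZS) (pow_mem al_ZS _)) (pow_mem b1_ZS _)))
    (mul_mem (mul_mem (mul_mem (ofNat_mem ZS 8448) (pow_mem XC_ZS _)) (pow_mem al_ZS _)) (pow_mem b1_ZS _)))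
    (mul_mem (mul_mem (ofNat_mem ZS 4096) (pow_mem XC_ZS _)) (pow_mem b1_ZS _))
def ld : CJ →+* LA := (PowerSeries.constantCoeff (R := LA)).comp CJ.subtype
lemma ld_ser {ι : Type} (D : TD ι) (s : Finset ι) (h : ∀ i, D.g i = 0 ↔ i ∈ s) :
    ld D.ser = ∑ i ∈ s, LaurentPolynomial.T (D.δ * D.r i) := by
  have : (D.fin 0).toFinset = s := by ext i; simp [h]
  rw [← this, ld, RingHom.comp_apply, ← PowerSeries.coeff_zero_eq_constantCoeff_apply]
  rw [Subring.subtype_apply, TD.ser, PowerSeries.coeff_mk]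
lemma ld_al : ld al = 1 := by
  rw [al, ld_ser _ {0} (by intro i; simp [D0])]; simp [D0]
lemma ld_t0 : ld t0 = 1 := by
  rw [t0, ld_ser _ {0} (by intro i; simp [D0])]; simp [D0]
lemma ld_b1 : ld b1 = 1 := by
  rw [b1, ld_ser _ {0} (by intro i; simp [DB])]; simp [DB]
lemma ld_t1 : ld t1 = LaurentPolynomial.T 1 + LaurentPolynomial.T (-1) := by
  rw [t1, ld_ser _ {0, -1} (by
    intro i
    simp only [D1, Int.natAbs_eq_zero, Finset.mem_insert, Finset.mem_singleton]
    constructor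
    · intro h
      have : i * (i + 1) = 0 := by linarith [h, sq i]
      rcases mul_eq_zero.1 this with h | h
      · exact Or.inl h
      · right; omega
    · rintro (rfl | rfl) <;> norm_num)]
  rw [Finset.sum_pair (by norm_num)]; simp [D1]
lemma ld_X : ld XC = 0 := by simp [ld, XC]
lemma ld_fk1 : ld fk1 = 1 := by simp [fk1, ld_al, ld_b1, ld_X]
lemma ld_fu : ld fu = 1 := by simp [fu, ld_fk1]
lemma ld_E4 : ld fE4 = 1 := by simp [fE4, ld_al, ld_X]
lemma ld_E6 : ld fE6 = 1 := by simp [fE6, ld_al, ld_X]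
lemma ld_E41 : ld fE41 = 1 := by simp [fE41, ld_al, ld_X, ld_t0]
lemma ld_phi : ld fphi = LaurentPolynomial.T 1 + LaurentPolynomial.T (-1) - 2 := by
  have : ld 2 = 2 := map_ofNat ld 2
  simp [fphi, ld_fk1, ld_al, ld_b1, ld_t0, ld_t1, this]
lemma Ln_C {t : Real} (ht : 0 < t) (a : Int) : Ln t (LaurentPolynomial.C a) = |(a:Real)| := by
  have h := Ln_mono ht a 0 1
  rw [← LaurentPolynomial.T_zero, mul_assoc, ← LaurentPolynomial.T_add, Ln_T, add_zero, LaurentPolynomial.T_zero] at h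
  simpa using h
lemma log_ee (q : Complex) (h0 : q ≠ 0) (h1 : ‖q‖ < 1) : ∃ τ : Complex, 0 < τ.im ∧ ee τ = q := by
  have hpi : (2 * Real.pi * I : Complex) ≠ 0 := by simp [Real.pi_ne_zero]
  refine ⟨Complex.log q / (2 * Real.pi * I), ?_, ?_⟩
  · have h2 : ee (Complex.log q / (2 * Real.pi * I)) = q := by
      rw [ee, mul_div_cancel₀ _ hpi, Complex.exp_log h0]
    rw [← h2, norm_ee, Real.exp_lt_one_iff] at h1
    have := Real.pi_pos
    nlinarith
  · rw [ee, mul_div_cancel₀ _ hpi, Complex.exp_log h0]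
lemma fu_inv : ∃ f : CJ, f ∈ ZS ∧ fu * f = 1 := by
  obtain ⟨g, hg⟩ := fu_ZS
  have hg' : PowerSeries.map LaurentPolynomial.C g = fu.1 := hg
  have hc : PowerSeries.constantCoeff g = 1 := by
    have h := ld_fu
    rw [ld, RingHom.comp_apply, Subring.subtype_apply, ← hg', ← PowerSeries.coeff_zero_eq_constantCoeff_apply,
      PowerSeries.coeff_map, PowerSeries.coeff_zero_eq_constantCoeff_apply] at h
    have h2 := congrArg (lz 0) h
    rw [lz_C, map_one] at h2
    exact_mod_cast h2
  have hgi : g * PowerSeries.invOfUnit g 1 = 1 := PowerSeries.mul_invOfUnit g 1 hc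
  set gi := PowerSeries.invOfUnit g 1
  have hG : PowerSeries.map (Int.castRingHom Complex) g = (lzC 0 fu).1 := by
    ext n
    change _ = PowerSeries.coeff n (PowerSeries.map (lz 0) fu.1)
    rw [← hg', PowerSeries.coeff_map, PowerSeries.coeff_map, PowerSeries.coeff_map, lz_C]; rfl
  have hcv := inv_conv (PowerSeries.map (Int.castRingHom Complex) g) (PowerSeries.map (Int.castRingHom Complex) gi)
    (by rw [hG]; exact (lzC 0 fu).2) (by rw [← map_mul, hgi, map_one]) (fun q hq => by
      by_cases h0 : q = 0
      · rw [tsum_eq_single 0]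
        · simp [hc]
        · intro b hb; simp [h0, hb]
      · obtain ⟨τ, hτ, rfl⟩ := log_ee q h0 hq
        have := fu_ne hτ 0
        rw [EV, RingHom.comp_apply, ← (evq_hasSum _ hτ).tsum_eq, ← hG] at this
        simpa only [ee_pow] using this)
  refine ⟨⟨PowerSeries.map LaurentPolynomial.C gi, ?_⟩, ⟨gi, rfl⟩, ?_⟩
  · intro t ρ h0 h1
    refine (hcv () ρ h0 h1).congr fun n => ?_
    congr 1
    rw [PowerSeries.coeff_map, PowerSeries.coeff_map]
    change ‖((PowerSeries.coeff n gi : Int) : Complex)‖ = Ln t _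
    rw [Ln_C t.2]; simp
  · apply Subtype.ext
    change fu.1 * PowerSeries.map LaurentPolynomial.C gi = 1
    rw [← hg', ← map_mul, hgi, map_one]
def fui : CJ := fu_inv.choose
lemma fui_ZS : fui ∈ ZS := fu_inv.choose_spec.1
lemma fu_fui : fu * fui = 1 := fu_inv.choose_spec.2
lemma ld_fui : ld fui = 1 := by
  have := congrArg ld fu_fui
  simpa [ld_fu] using this
lemma jf_ui : JF (-12) 0 (-1) fui := by
  have hz : ∀ τ z, 0 < τ.im → ph (-1) fui τ z = (ph 1 fu τ 0)⁻¹ ∧ ph 1 fu τ z = ph 1 fu τ 0 := by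
    intro τ z hτ
    have e : ph 1 fu τ z = ph 1 fu τ 0 := by
      have : ∀ z, ph 1 fu τ z = kpf τ ^ 4 := by
        intro z
        rw [kpf_ev hτ z]; simp only [ph, fu, map_pow, Int.cast_one, one_mul]; rw [w4 τ]; ring
      rw [this, this]
    refine ⟨?_, e⟩
    have h := ph_mul 1 (-1) fu fui τ z
    rw [fu_fui] at h
    simp only [ph, add_neg_cancel, Int.cast_zero, zero_mul, ee_zero, map_one, mul_one] at h
    rw [← e]
    refine eq_inv_of_mul_eq_one_right h.symm
  refine JF.of_eq (fun τ _ => (ph 1 fu τ 0)⁻¹) (fun τ z hτ => ((hz τ z hτ).1).symm) (ell_const _) ?_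
  intro τ z hτ
  have := jf_u.slaw τ z hτ
  rw [(hz _ _ hτ).2, (hz _ _ (im_S_pos hτ)).2] at this
  simp only [Nat.cast_zero, zero_mul, zero_div, ee_zero, mul_one] at this ⊢
  rw [this, mul_inv, zpow_neg]
def co (f : CJ) (n r : Int) : Int := if 0 ≤ n then (PowerSeries.coeff n.toNat f.1).coeff r else 0
lemma co_nat (f : CJ) (n : Nat) (r : Int) : co f n r = (PowerSeries.coeff n f.1).coeff r := by simp [co]
lemma co_neg (f : CJ) {n : Int} (hn : n < 0) (r : Int) : co f n r = 0 := by simp [co, hn]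
lemma ph_hasSum (f : CJ) (s : Int) {τ : Complex} (hτ : 0 < τ.im) (z : Complex) :
    HasSum (fun p : Int × Int => (co f (p.1 - s) p.2 : Complex) * ee (p.1 * τ + p.2 * z)) (ph s f τ z) := by
  have h := (EV_hasSum2 f hτ z).mul_left (ee (s * τ))
  have hinj : Function.Injective fun p : Nat × Int => ((p.1 + s : Int), p.2) := by
    rintro ⟨a, b⟩ ⟨c, d⟩ hh
    simpa using hh
  refine (hinj.hasSum_iff (fun p hp => ?_)).1 (Eq.mp (congrArg (fun f => HasSum f _) (funext fun p => ?_)) h)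
  · rw [co_neg]
    · simp
    · by_contra hn
      exact hp ⟨((p.1 - s).toNat, p.2), by
        ext
        · simp; omega
        · rfl⟩
  · simp only [Function.comp_apply, add_sub_cancel_right, co_nat]
    rw [mul_left_comm, ← ee_add]
    congr 2
    push_cast; ring
def IntVV (m : Nat) [NeZero m] (k : Int) (c : Int → Zt m → Int) : Prop := IsVV k m (fun Δ ll => (c Δ ll : Complex))
lemma JF.toVV {k : Int} {m : Nat} [NeZero m] {s : Int} {f : CJ} (h : JF k m s f) :
    ∃ c : Int → Zt m → Int, IntVV m k c ∧ ∀ n r : Int, c (4 * m * n - r ^ 2) r = co f (n - s) r := by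
  obtain ⟨C, hC, hc, -⟩ := mkVV (k := k) (m := m) (fun n r => (co f (n - s) r : Complex)) (ph s f)
    (fun τ z hτ => ph_hasSum f s hτ z) h.ell h.slaw ⟨-s, fun n r hn => by
      rw [co_neg]; · simp
      omega⟩
  have hint : ∀ Δ ll, ∃ a : Int, (a:Complex) = C Δ ll := by
    intro Δ ll
    obtain ⟨l, rfl⟩ := ZMod.intCast_surjective ll
    by_cases h0 : C Δ l = 0
    · exact ⟨0, by simp [h0]⟩
    · obtain ⟨n, hn⟩ := hC.supp Δ l h0
      exact ⟨co f (n - s) l, by rw [← hc n l]; congr 1; linarith⟩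
  choose c hcc using hint
  have e : (fun Δ ll => (c Δ ll : Complex)) = C := by funext Δ ll; exact hcc Δ ll
  refine ⟨c, by rw [IntVV, e]; exact hC, fun n r => ?_⟩
  have := hcc (4 * m * n - r ^ 2) r
  rw [hc] at this
  exact_mod_cast this
lemma JF.cast {k k' : Int} {m m' : Nat} {s s' : Int} {f : CJ} (h : JF k m s f) (hk : k = k') (hm : m = m') (hs : s = s') :
    JF k' m' s' f := by subst hk hm hs; exact h
def Bf : CJ := fE6 * (fphi * fui)
def ej (m j : Nat) : CJ := fE4 ^ (2 * m) * fE41 ^ (m - j) * Bf ^ j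
def Fi (m i : Nat) : CJ := fE4 ^ (2 + 3 * i) * fE6 * fui ^ (m + 1 + i)
lemma jf_B : JF 4 1 0 Bf := (jf_E6.mul (jf_phi.mul jf_ui)).cast (by norm_num) (by norm_num) (by norm_num)
lemma jf_ej {m j : Nat} (hj : j ≤ m) : JF (12 * m) m 0 (ej m j) :=
  (((jf_E4.pow (2 * m)).mul (jf_E41.pow (m - j))).mul (jf_B.pow j)).cast
    (by push_cast [hj]; ring) (by simp; omega) (by simp)
lemma jf_Fi (m i : Nat) : JF (2 - 12 * m) 0 (-(m + 1 + i)) (Fi m i) :=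
  (((jf_E4.pow (2 + 3 * i)).mul jf_E6).mul (jf_ui.pow (m + 1 + i))).cast
    (by push_cast; ring) (by simp) (by push_cast; ring)
lemma jf_X {m j : Nat} (hj : j ≤ m) (i : Nat) : JF 2 m (-(m + 1 + i)) (ej m j * Fi m i) :=
  ((jf_ej hj).mul (jf_Fi m i)).cast (by ring) (by simp) (by ring)
lemma ld_ej (m j : Nat) : ld (ej m j) = (LaurentPolynomial.T 1 + LaurentPolynomial.T (-1) - 2) ^ j := by
  simp [ej, Bf, ld_E4, ld_E6, ld_E41, ld_phi, ld_fui]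
lemma ld_Fi (m i : Nat) : ld (Fi m i) = 1 := by
  simp [Fi, ld_E4, ld_E6, ld_fui]
lemma pol_coeff (j : Nat) : (∀ r : Int, (j:Int) < |r| → ((LaurentPolynomial.T 1 + LaurentPolynomial.T (-1) - 2 : LA) ^ j).coeff r = 0) ∧
    ((LaurentPolynomial.T 1 + LaurentPolynomial.T (-1) - 2 : LA) ^ j).coeff j = 1 := by
  induction j with
  | zero =>
    constructor
    · intro r hr
      have : r ≠ 0 := by rintro rfl; simp at hr
      rw [pow_zero, ← LaurentPolynomial.T_zero, LaurentPolynomial.T_apply, if_neg this.symm]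
    · rw [pow_zero, ← LaurentPolynomial.T_zero, LaurentPolynomial.T_apply]; simp
  | succ j ih =>
    have step : ∀ r : Int, ((LaurentPolynomial.T 1 + LaurentPolynomial.T (-1) - 2 : LA) ^ (j+1)).coeff r =
        ((LaurentPolynomial.T 1 + LaurentPolynomial.T (-1) - 2 : LA) ^ j).coeff (r - 1) +
        ((LaurentPolynomial.T 1 + LaurentPolynomial.T (-1) - 2 : LA) ^ j).coeff (r + 1) -
        2 * ((LaurentPolynomial.T 1 + LaurentPolynomial.T (-1) - 2 : LA) ^ j).coeff r := by
      intro r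
      rw [pow_succ', sub_mul, add_mul, AddMonoidAlgebra.coeff_sub, AddMonoidAlgebra.coeff_add, Finsupp.sub_apply,
        Finsupp.add_apply, coeff_T_mul, coeff_T_mul, sub_neg_eq_add,
        show (2 : LA) = LaurentPolynomial.C 2 by rw [map_ofNat], coeff_C_mul]
    constructor
    · intro r hr
      push_cast at hr
      rw [step, ih.1 (r - 1), ih.1 (r + 1), ih.1 r]
      · simp
      all_goals grind
    · rw [step]
      push_cast
      rw [add_sub_cancel_right, ih.2, ih.1, ih.1] <;> grind
lemma co_zero (f : CJ) (r : Int) : co f 0 r = (ld f).coeff r := by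
  rw [show (0:Int) = ((0:Nat):Int) by simp, co_nat, PowerSeries.coeff_zero_eq_constantCoeff_apply]; rfl
section Ob
variable {m : Nat} [NeZero m] {M : Type*} [AddCommGroup M] {M' : Type*} [AddCommGroup M']
def pr (c : Int → Zt m → Int) (a : Int → Zt m → M) : M :=
  ∑ᶠ x : Zt m × Int, c (-x.2) x.1 • a x.2 x.1
structure Ob (m : Nat) [NeZero m] (M : Type*) [AddCommGroup M] (a : Int → Zt m → M) : Prop where
  pos : ∀ D ll, a D ll ≠ 0 → 0 < D
  val : ∀ D l : Int, a D (l : Zt m) ≠ 0 → (4 * (m:Int)) ∣ D - l ^ 2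
  even : ∀ D ll, a D (-ll) = a D ll
  kill : ∀ c, IntVV m 2 c → pr c a = 0
lemma pr_fin {c : Int → Zt m → Int} (hc : ∃ B : Int, ∀ Δ ll, Δ < -B → c Δ ll = 0) {a : Int → Zt m → M}
    (ha : ∀ D ll, a D ll ≠ 0 → 0 < D) : (Function.support fun x : Zt m × Int => c (-x.2) x.1 • a x.2 x.1).Finite := by
  obtain ⟨B, hB⟩ := hc
  refine (Set.finite_univ.prod (Set.finite_Icc 0 B)).subset fun x hx => ?_
  rw [Function.mem_support] at hx
  refine ⟨trivial, ?_, ?_⟩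
  · exact (ha x.2 x.1 (fun h => hx (by rw [h, smul_zero]))).le
  · by_contra hn
    simp_all
lemma IntVV.bdd {k : Int} {c : Int → Zt m → Int} (h : IntVV m k c) : ∃ B : Int, ∀ Δ ll, Δ < -B → c Δ ll = 0 := by
  obtain ⟨B, hB⟩ := PreVV.bdd (IsVV.toPreVV h)
  exact ⟨B, fun Δ ll hh => by simpa using hB Δ ll hh⟩
lemma IntVV.even {c : Int → Zt m → Int} (h : IntVV m 2 c) (Δ : Int) (ll : Zt m) : c Δ (-ll) = c Δ ll := by
  have := IsVV.even h (by decide) Δ ll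
  exact_mod_cast this
lemma Ob.map {a : Int → Zt m → M} (h : Ob m M a) (f : M →+ M') : Ob m M' (fun D ll => f (a D ll)) where
  pos D ll hh := h.pos D ll fun h0 => hh (by rw [h0, map_zero])
  val D l hh := h.val D l fun h0 => hh (by rw [h0, map_zero])
  even D ll := by rw [h.even]
  kill c hc := by
    have := congrArg f (h.kill c hc)
    rw [map_zero, pr, map_finsum _ (pr_fin hc.bdd h.pos)] at this
    rw [pr]; simpa only [map_zsmul] using this
lemma Ob.of_inj {a : Int → Zt m → M} (f : M →+ M') (hf : Function.Injective f)
    (h : Ob m M' (fun D ll => f (a D ll))) : Ob m M a where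
  pos D ll hh := h.pos D ll fun h0 => hh (hf (by rw [h0, map_zero]))
  val D l hh := h.val D l fun h0 => hh (hf (by rw [h0, map_zero]))
  even D ll := hf (h.even D ll)
  kill c hc := by
    apply hf
    rw [map_zero, pr, f.map_finsum_of_injective hf]
    have := h.kill c hc
    rw [pr] at this
    simpa only [map_zsmul] using this
lemma Ob.add {a b : Int → Zt m → M} (ha : Ob m M a) (hb : Ob m M b) : Ob m M (fun D ll => a D ll + b D ll) where
  pos D ll hh := by
    by_cases h : a D ll = 0
    · exact hb.pos D ll (by simpa [h] using hh)
    · exact ha.pos D ll h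
  val D l hh := by
    by_cases h : a D l = 0
    · exact hb.val D l (by simpa [h] using hh)
    · exact ha.val D l h
  even D ll := by rw [ha.even, hb.even]
  kill c hc := by
    have := finsum_add_distrib (pr_fin hc.bdd ha.pos) (pr_fin hc.bdd hb.pos)
    rw [pr]
    simp only [smul_add]
    rw [this]
    exact (congrArg₂ (· + ·) (ha.kill c hc) (hb.kill c hc)).trans (add_zero _)
lemma Ob.zsmul {a : Int → Zt m → M} (h : Ob m M a) (n : Int) : Ob m M (fun D ll => n • a D ll) :=
  h.map (zsmulAddGroupHom n)
lemma Ob.sub {a b : Int → Zt m → M} (ha : Ob m M a) (hb : Ob m M b) : Ob m M (fun D ll => a D ll - b D ll) := by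
  have := ha.add (hb.zsmul (-1))
  grind
lemma finsum_inj {α β : Type*} (i : α → β) (hi : Function.Injective i) (F : β → M) (hF : ∀ x, x ∉ Set.range i → F x = 0) :
    ∑ᶠ x, F x = ∑ᶠ y, F (i y) := by
  rw [← finsum_mem_range hi, ← finsum_mem_univ]
  apply finsum_mem_inter_support_eq'
  intro x hx
  simp only [Set.mem_univ, true_iff]
  by_contra hn
  exact hx (hF x hn)
def mu (m r : Nat) : Int := if r = 0 ∨ r = m then 1 else 2
lemma sum_even (m : Nat) [NeZero m] (G : Zt m → M) (hG : ∀ x, G (-x) = G x) :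
    ∑ x, G x = ∑ r ∈ Finset.range (m + 1), mu m r • G (r : Nat) := by
  have hm : m ≠ 0 := NeZero.ne m
  have e1 : ∑ x, G x = ∑ r ∈ Finset.range (m + m), G (r : Nat) := by
    refine Finset.sum_bij' (fun x _ => x.val) (fun r _ => (r : Zt m)) ?_ (by simp) (by simp) ?_ (by simp)
    · grind
    · intro r hr; simp only [Finset.mem_range] at hr; exact ZMod.val_natCast_of_lt (by omega)
  have e2 : ∑ k ∈ Finset.range m, G ((m + k : Nat)) = ∑ k ∈ Finset.range m, G ((k + 1 : Nat)) := by
    rw [← Finset.sum_range_reflect]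
    refine Finset.sum_congr rfl fun k hk => ?_
    rw [Finset.mem_range] at hk
    rw [← hG]
    congr 1
    have : ((m + (m - 1 - k) : Nat) : Zt m) + ((k + 1 : Nat) : Zt m) = 0 := by
      rw [← Nat.cast_add, show m + (m - 1 - k) + (k + 1) = 2 * m by omega]; simp
    grind
  have e3 : ∑ r ∈ Finset.range (m + 1), mu m r • G (r : Nat) =
      ∑ r ∈ Finset.range (m + 1), (G (r : Nat) + G (r : Nat)) - G (0 : Nat) - G (m : Nat) := by
    rw [sub_sub, eq_sub_iff_add_eq]
    have : G (0 : Nat) + G (m : Nat) = ∑ r ∈ Finset.range (m + 1), if r = 0 ∨ r = m then G (r : Nat) else 0 := by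
      rw [Finset.sum_ite, Finset.sum_const_zero, add_zero,
        show (Finset.range (m + 1)).filter (fun r => r = 0 ∨ r = m) = {0, m} by
          ext r; simp; omega, Finset.sum_pair hm.symm]
    rw [this, ← Finset.sum_add_distrib]
    refine Finset.sum_congr rfl fun r _ => ?_
    rw [mu]; split_ifs
    · rw [one_smul]
    · rw [two_smul, add_zero]
  rw [e1, Finset.sum_range_add, e2, e3, Finset.sum_add_distrib]
  nth_rewrite 1 [Finset.sum_range_succ]
  rw [Finset.sum_range_succ']
  abel
lemma pr_coord {c : Int → Zt m → Int} (hc : IntVV m 2 c) {a : Int → Zt m → M}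
    (hpos : ∀ D ll, a D ll ≠ 0 → 0 < D) (hval : ∀ D l : Int, a D (l : Zt m) ≠ 0 → (4 * (m:Int)) ∣ D - l ^ 2)
    (hev : ∀ D ll, a D (-ll) = a D ll) :
    pr c a = ∑ r ∈ Finset.range (m + 1), mu m r • ∑ᶠ N : Int, c (4 * m * (-N) - (r:Int) ^ 2) (r : Int) • a (4 * m * N + (r:Int) ^ 2) (r : Int) := by
  have hm : (m:Int) ≠ 0 := by exact_mod_cast NeZero.ne m
  rw [pr, finsum_curry _ (pr_fin hc.bdd hpos), finsum_eq_sum_of_fintype, sum_even]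
  · refine Finset.sum_congr rfl fun r _ => ?_
    congr 1
    rw [finsum_inj (fun N : Int => 4 * m * N + (r:Int) ^ 2)]
    · refine finsum_congr fun N => ?_
      simp only [Int.cast_natCast]
      congr 2; ring
    · intro x y hxy
      simp_all
    · intro D hD
      by_contra hne
      have h1 : a D ((r:Int) : Zt m) ≠ 0 := by
        intro h; apply hne; simp only [Int.cast_natCast] at h; simp [h]
      obtain ⟨n, hn⟩ := hval D r h1
      exact hD ⟨n, by simp only; linarith⟩
  · intro x
    simp only [hc.even, hev]
lemma zrep (ll : Zt m) : ∃ r : Nat, r ≤ m ∧ (ll = ((r : Int) : Zt m) ∨ ll = -((r : Int) : Zt m)) := by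
  refine ⟨ll.valMinAbs.natAbs, ?_, ?_⟩
  · have := ZMod.natAbs_valMinAbs_le ll
    omega
  · have h := ZMod.coe_valMinAbs ll
    rcases Int.natAbs_eq ll.valMinAbs with h1 | h1
    · left; rw [← h1, h]
    · right; rw [← Int.cast_neg, ← h1, h]
lemma Ob.det (h2 : ∀ x : M, (2:Int) • x = 0 → x = 0) {a : Int → Zt m → M} (h : Ob m M a)
    (hw : ∀ (D : Int) ll, D ≤ 5 * (m:Int) ^ 2 → a D ll = 0) : ∀ D ll, a D ll = 0 := by
  have hm : (1:Int) ≤ m := by exact_mod_cast Nat.one_le_iff_ne_zero.2 (NeZero.ne m)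
  have key : ∀ k : Nat, ∀ N r : Nat, r ≤ m → (m + 1) * N + r = k → a (4 * m * N + (r:Int) ^ 2) (r : Int) = 0 := by
    intro k
    induction k using Nat.strong_induction_on with
    | _ k ih =>
    intro N r hr hk
    have hr' : (r:Int) ≤ m := by exact_mod_cast hr
    by_cases hN : N ≤ m
    · apply hw
      nlinarith
    obtain ⟨i, rfl⟩ : ∃ i, N = m + 1 + i := ⟨N - (m + 1), by omega⟩
    obtain ⟨c, hc, hcc⟩ := (jf_X hr i).toVV
    have hp := h.kill c hc
    rw [pr_coord hc h.pos h.val h.even] at hp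
    simp only [hcc] at hp
    have term : ∀ r' : Nat, r' ≤ m → ∀ N' : Int, (r' ≠ r ∨ N' ≠ ((m + 1 + i : Nat) : Int)) →
        co (ej m r * Fi m i) (-N' - -(m + 1 + i)) r' • a (4 * m * N' + (r':Int) ^ 2) (r' : Int) = 0 := by
      intro r' hr' N' hne
      have hr'' : (r':Int) ≤ m := by exact_mod_cast hr'
      rcases lt_trichotomy N' ((m + 1 + i : Nat) : Int) with hlt | heq | hgt
      · have : a (4 * m * N' + (r':Int) ^ 2) (r' : Int) = 0 := by
          by_cases hn : 0 ≤ N'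
          · obtain ⟨n, rfl⟩ := Int.eq_ofNat_of_zero_le hn
            have hlt' : n < m + 1 + i := by exact_mod_cast hlt
            refine ih ((m + 1) * n + r') ?_ n r' hr' rfl
            nlinarith
          · apply hw; nlinarith
        rw [this, smul_zero]
      · subst heq
        rw [show (-((m + 1 + i : Nat) : Int) - -((m:Int) + 1 + i)) = 0 by push_cast; ring, co_zero, map_mul, ld_ej, ld_Fi, mul_one]
        rcases lt_trichotomy r' r with h1 | h1 | h1
        · rw [ih ((m + 1) * (m + 1 + i) + r') (by omega) _ r' hr' rfl, smul_zero]
        · exact absurd h1 (by simpa using hne)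
        · rw [(pol_coeff r).1, zero_smul]
          grind
      · rw [co_neg, zero_smul]
        push_cast at hgt
        linarith
    rw [Finset.sum_eq_single r] at hp
    · rw [finsum_eq_single _ ((m + 1 + i : Nat) : Int) (fun N' hN' => term r hr N' (Or.inr hN'))] at hp
      rw [show (-((m + 1 + i : Nat) : Int) - -((m:Int) + 1 + i)) = 0 by push_cast; ring, co_zero, map_mul, ld_ej, ld_Fi, mul_one,
        (pol_coeff r).2, one_smul, mu] at hp
      split_ifs at hp
      · simpa using hp
      · exact h2 _ hp
    · intro r' hr' hne
      rw [Finset.mem_range] at hr'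
      rw [finsum_eq_zero_of_forall_eq_zero (fun N' => term r' (by omega) N' (Or.inl hne)), smul_zero]
    grind
  intro D ll
  obtain ⟨r, hr, hl⟩ := zrep ll
  have e : a D ll = a D (r : Int) := by
    rcases hl with rfl | rfl
    · rfl
    · rw [h.even]
  rw [e]
  by_contra hne
  obtain ⟨N, hN⟩ := h.val D r hne
  have hr' : (r:Int) ≤ m := by exact_mod_cast hr
  by_cases hn : 0 ≤ N
  · obtain ⟨n, rfl⟩ := Int.eq_ofNat_of_zero_le hn
    apply hne
    rw [show D = 4 * m * (n:Nat) + (r:Int) ^ 2 by linarith]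
    exact key _ n r hr rfl
  · apply hne; apply hw; nlinarith
def Ts (m p : Nat) [Fact p.Prime] (a : Int → Zt m → M) : Int → Zt m → M := fun D ll =>
  (if (p:Int) ^ 2 ∣ D then a (D / p ^ 2) ((p : Zt m)⁻¹ * ll) else 0) + legendreSym p D • a D ll +
    (p:Int) • a (p ^ 2 * D) (p * ll)
variable {p : Nat} [Fact p.Prime]
lemma IntVV.TpC (hp2 : p ≠ 2) (hpm : ¬ p ∣ m) {c : Int → Zt m → Int} (h : IntVV m 2 c) : IntVV m 2 (TpC m p c) := by
  have := IsVV.TpC hp2 hpm h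
  rw [IntVV]
  convert this using 3
  simp only [_root_.TpC]
  simp
lemma Ob.Ts (hp2 : p ≠ 2) (hpm : ¬ p ∣ m) {a : Int → Zt m → M} (h : Ob m M a) : Ob m M (Ts m p a) := by
  have hpp : p.Prime := Fact.out
  have hp0 : (p:Int) ^ 2 ≠ 0 := pow_ne_zero _ (by exact_mod_cast hpp.ne_zero)
  have hpos : (0:Int) < (p:Int) ^ 2 := by positivity
  have hpi := pinv (m := m) hp2 hpm
  have hcop := (cop4 (m := m) hp2 hpm)
  have A1 : ∀ D ll, (if (p:Int) ^ 2 ∣ D then a (D / p ^ 2) ((p : Zt m)⁻¹ * ll) else 0) ≠ 0 → 0 < D := by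
    intro D ll hh
    split_ifs at hh with hd
    · obtain ⟨k, rfl⟩ := hd
      rw [Int.mul_ediv_cancel_left _ hp0] at hh
      exact mul_pos hpos (h.pos _ _ hh)
    · exact absurd rfl hh
  have A2 : ∀ D ll, (legendreSym p D • a D ll) ≠ 0 → 0 < D := fun D ll hh => h.pos D ll fun h0 => hh (by rw [h0, smul_zero])
  have A3 : ∀ D ll, ((p:Int) • a (p ^ 2 * D) (p * ll)) ≠ 0 → 0 < D := fun D ll hh => by
    have := h.pos (p ^ 2 * D) (p * ll) fun h0 => hh (by rw [h0, smul_zero])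
    nlinarith
  constructor
  · intro D ll hh
    by_contra hn
    apply hh
    rw [_root_.Ts, not_not.1 (mt (A1 D ll) hn), not_not.1 (mt (A2 D ll) hn), not_not.1 (mt (A3 D ll) hn)]; simp
  · intro D l hh
    by_contra hn
    apply hh
    have b1 : (if (p:Int) ^ 2 ∣ D then a (D / p ^ 2) ((p : Zt m)⁻¹ * (l : Zt m)) else 0) = 0 := by
      split_ifs with hd
      · obtain ⟨k, rfl⟩ := hd
        rw [Int.mul_ediv_cancel_left _ hp0]
        by_contra h1
        obtain ⟨l', hl'⟩ := ZMod.intCast_surjective ((p : Zt m)⁻¹ * (l : Zt m))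
        rw [← hl'] at h1
        have h3 := h.val _ _ h1
        have h4 : (l : Zt m) = ((p * l' : Int) : Zt m) := by
          push_cast; rw [hl', ← mul_assoc, hpi, one_mul]
        have h5 := sq_congr m h4
        apply hn
        have h6 : (4 * (m:Int)) ∣ p ^ 2 * (k - l' ^ 2) := h3.mul_left _
        have := dvd_sub h6 h5
        grind
      · rfl
    have b2 : a D l = 0 := by
      by_contra h1; exact hn (h.val _ _ h1)
    have b3 : a (p ^ 2 * D) (p * (l : Zt m)) = 0 := by
      by_contra h1
      have h1' : a (p ^ 2 * D) ((p * l : Int) : Zt m) ≠ 0 := by push_cast; exact h1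
      have h3 := h.val _ _ h1'
      rw [show (p:Int) ^ 2 * D - (p * l) ^ 2 = p ^ 2 * (D - l ^ 2) by ring] at h3
      exact hn (hcop.symm.pow_right.dvd_of_dvd_mul_left h3)
    rw [_root_.Ts, b1, b2, b3]; simp
  · intro D ll
    simp only [_root_.Ts, mul_neg, h.even]
  · intro c hc
    have hk := h.kill _ (hc.TpC hp2 hpm)
    rw [← hk]
    let ι : Zt m × Int → Zt m × Int := fun x => (p * x.1, p ^ 2 * x.2)
    have hι : Function.Injective ι := by
      rintro ⟨x, D⟩ ⟨y, E⟩ hxy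
      simp only [ι, Prod.mk.injEq] at hxy
      obtain ⟨h1, h2⟩ := hxy
      have h1' := congrArg (fun t => (p : Zt m)⁻¹ * t) h1
      simp only [← mul_assoc, mul_comm _ (p : Zt m), hpi, one_mul] at h1'
      rw [h1', mul_left_cancel₀ hp0 h2]
    have hrange : ∀ x : Zt m × Int, x ∉ Set.range ι → ¬ (p:Int) ^ 2 ∣ x.2 := by
      rintro ⟨x, D⟩ hx ⟨k, hk⟩
      exact hx ⟨((p : Zt m)⁻¹ * x, k), by simp only [ι]; rw [← mul_assoc, hpi, one_mul, ← hk]⟩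
    have hpi' : ∀ x : Zt m, (p : Zt m)⁻¹ * (p * x) = x := by
      grind
    have bb := hc.bdd
    have f1 := pr_fin hc.bdd A1
    have f2 := pr_fin hc.bdd A2
    have f3 := pr_fin hc.bdd A3
    have L : pr c (_root_.Ts m p a) = ∑ᶠ x : Zt m × Int, c (-(p ^ 2 * x.2)) (p * x.1) • a x.2 x.1 +
        ∑ᶠ x : Zt m × Int, c (-x.2) x.1 • (legendreSym p x.2 • a x.2 x.1) +
        ∑ᶠ x : Zt m × Int, c (-x.2) x.1 • ((p:Int) • a (p ^ 2 * x.2) (p * x.1)) := by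
      rw [pr]
      simp only [_root_.Ts, smul_add]
      rw [finsum_add_distrib (f1.union f2 |>.subset (Function.support_add _ _)) f3, finsum_add_distrib f1 f2]
      congr 2
      rw [finsum_inj ι hι]
      · refine finsum_congr fun x => ?_
        simp only [ι]
        rw [if_pos (dvd_mul_right _ _), Int.mul_ediv_cancel_left _ hp0, hpi']
      · intro x hx
        rw [if_neg (hrange x hx), smul_zero]
    have g1 : (Function.support fun x : Zt m × Int => c (-(p ^ 2 * x.2)) (p * x.1) • a x.2 x.1).Finite := by
      refine (f1.preimage (f := ι) hι.injOn).subset fun x hx => ?_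
      simp only [Set.mem_preimage, Function.mem_support, ι] at hx ⊢
      rwa [if_pos (dvd_mul_right _ _), Int.mul_ediv_cancel_left _ hp0, hpi']
    have g3 : (Function.support fun x : Zt m × Int => (if (p:Int) ^ 2 ∣ -x.2 then (p:Int) • c (-x.2 / p ^ 2) ((p : Zt m)⁻¹ * x.1) else 0) • a x.2 x.1).Finite := by
      refine (f3.image ι).subset fun x hx => ?_
      rw [Function.mem_support] at hx
      split_ifs at hx with hd
      · obtain ⟨y, rfl⟩ := not_not.1 (mt (hrange x) (not_not.2 ((dvd_neg).1 hd)))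
        refine ⟨y, ?_, rfl⟩
        simp only [ι] at hx
        rw [← mul_neg, Int.mul_ediv_cancel_left _ hp0, hpi', smul_assoc] at hx
        rw [Function.mem_support, smul_comm]; exact hx
      · simp at hx
    have R : pr (_root_.TpC m p c) a = ∑ᶠ x : Zt m × Int, c (-(p ^ 2 * x.2)) (p * x.1) • a x.2 x.1 +
        ∑ᶠ x : Zt m × Int, c (-x.2) x.1 • (legendreSym p x.2 • a x.2 x.1) +
        ∑ᶠ x : Zt m × Int, c (-x.2) x.1 • ((p:Int) • a (p ^ 2 * x.2) (p * x.1)) := by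
      rw [pr]
      simp only [_root_.TpC, add_smul, neg_neg, mul_neg]
      have e2 : ∀ x : Zt m × Int, (legendreSym p x.2 • c (-x.2) x.1) • a x.2 x.1 =
          c (-x.2) x.1 • (legendreSym p x.2 • a x.2 x.1) := by
        intro x; rw [smul_assoc, smul_comm]
      simp only [e2]
      rw [finsum_add_distrib (g1.union f2 |>.subset (Function.support_add _ _)) g3, finsum_add_distrib g1 f2]
      congr 1
      rw [finsum_inj ι hι]
      · refine finsum_congr fun x => ?_
        simp only [ι]
        rw [if_pos ((dvd_mul_right _ _).neg_right), ← mul_neg, Int.mul_ediv_cancel_left _ hp0, hpi', smul_assoc, smul_comm]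
      · intro x hx
        rw [if_neg (fun hd => hrange x hx ((dvd_neg).1 hd)), zero_smul]
    rw [L, R]
end Ob
section Hecke
variable {m : Nat} [NeZero m] {p : Nat} [Fact p.Prime]
lemma zp_two (hp2 : p ≠ 2) : ∀ x : ZMod p, (2:Int) • x = 0 → x = 0 := by
  intro x hx
  rw [zsmul_eq_mul] at hx
  refine (mul_eq_zero.1 hx).resolve_left fun h => hp2 ?_
  have h1 : ((2:Nat) : ZMod p) = 0 := by exact_mod_cast h
  rw [ZMod.natCast_eq_zero_iff] at h1
  exact (Nat.prime_dvd_prime_iff_eq Fact.out Nat.prime_two).1 h1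
lemma Ts_map {M M' : Type*} [AddCommGroup M] [AddCommGroup M'] (f : M →+ M') (a : Int → Zt m → M) :
    (fun D ll => f (Ts m p a D ll)) = Ts m p (fun D ll => f (a D ll)) := by
  funext D ll
  simp only [Ts, map_add, map_zsmul, apply_ite f, map_zero]
def redp (p : Nat) [Fact p.Prime] : ℤ_[p] →+ ZMod p := (PadicInt.toZMod (p := p)).toAddMonoidHom
lemma redp_dvd {x : ℤ_[p]} (h : redp p x = 0) : ∃ y, x = (p : Int) • y := by
  have : x ∈ RingHom.ker (PadicInt.toZMod (p := p)) := h
  rw [PadicInt.ker_toZMod, PadicInt.maximalIdeal_eq_span_p, Ideal.mem_span_singleton] at this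
  obtain ⟨y, rfl⟩ := this
  simp
lemma Ob.redp_div {a : Int → Zt m → ℤ_[p]} (h : Ob m ℤ_[p] a) (h0 : ∀ D ll, redp p (a D ll) = 0) :
    ∃ c, Ob m ℤ_[p] c ∧ ∀ D ll, a D ll = (p:Int) • c D ll := by
  choose c hc using fun D ll => redp_dvd (h0 D ll)
  refine ⟨c, Ob.of_inj (zsmulAddGroupHom (p:Int)) ?_ ?_, hc⟩
  · intro x y hxy
    simp only [zsmulAddGroupHom_apply, zsmul_eq_mul] at hxy
    refine mul_left_cancel₀ ?_ hxy
    exact_mod_cast (Fact.out : p.Prime).ne_zero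
  · have : a = fun D ll => (zsmulAddGroupHom (p:Int)) (c D ll) := by funext D ll; exact hc D ll
    rwa [← this]
lemma leg_sq (D : Int) : legendreSym p (p ^ 2 * D) = 0 := by
  rw [legendreSym.eq_zero_iff]; push_cast; simp [(Fact.out : p.Prime).ne_zero]
lemma Ts_p2 {M : Type*} [AddCommGroup M] (hp2 : p ≠ 2) (hpm : ¬ p ∣ m) (a : Int → Zt m → M) (D : Int) (ll : Zt m) :
    Ts m p a (p ^ 2 * D) (p * ll) = a D ll + (p:Int) • a (p ^ 2 * (p ^ 2 * D)) (p * (p * ll)) := by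
  have hpi := pinv (m := m) hp2 hpm
  have hp0 : (p:Int) ^ 2 ≠ 0 := pow_ne_zero _ (by exact_mod_cast (Fact.out : p.Prime).ne_zero)
  rw [Ts, if_pos (dvd_mul_right _ _), Int.mul_ediv_cancel_left _ hp0, leg_sq, zero_smul, add_zero,
    ← mul_assoc (p : Zt m)⁻¹, mul_comm (p : Zt m)⁻¹, hpi, one_mul]
lemma Ob.decomp (hp2 : p ≠ 2) (hpm : ¬ p ∣ m) {a : Int → Zt m → ℤ_[p]} (h : Ob m ℤ_[p] a) :
    ∃ b c, Ob m ℤ_[p] b ∧ Ob m ℤ_[p] c ∧ ∀ D ll, a D ll = _root_.Ts m p b D ll + (p:Int) • c D ll := by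
  let V : Set (Int → Zt m → ZMod p) := {f | ∃ a, Ob m ℤ_[p] a ∧ f = fun D ll => redp p (a D ll)}
  have hV : ∀ f ∈ V, Ob m (ZMod p) f := by
    rintro f ⟨a, ha, rfl⟩; exact ha.map _
  have hfin : Finite V := by
    refine Finite.of_injective (β := (Finset.Icc (1:Int) (5 * (m:Int) ^ 2)) → Zt m → ZMod p) (fun f D ll => f.1 D ll) ?_
    rintro ⟨f, hf⟩ ⟨g, hg⟩ hfg
    have hs := (hV f hf).sub (hV g hg)
    have := hs.det (zp_two hp2) (fun D ll hD => by
      by_cases h1 : 1 ≤ D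
      · have := congrFun (congrFun hfg ⟨D, Finset.mem_Icc.2 ⟨h1, hD⟩⟩) ll
        exact sub_eq_zero.2 this
      · by_contra hne
        have := hs.pos D ll hne
        omega)
    apply Subtype.ext
    grind
  let T : V → V := fun f => ⟨_root_.Ts m p f.1, by
    obtain ⟨a, ha, e⟩ := f.2
    exact ⟨_, ha.Ts hp2 hpm, by rw [e, Ts_map]⟩⟩
  have hT : Function.Injective T := by
    intro f g hfg
    apply Subtype.ext
    funext D ll
    have h1 := congrFun (congrFun (congrArg Subtype.val hfg) (p ^ 2 * D)) (p * ll)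
    simp only [T] at h1
    rw [Ts_p2 hp2 hpm, Ts_p2 hp2 hpm] at h1
    simpa using h1
  obtain ⟨⟨f, b, hb, rfl⟩, hf⟩ := Finite.surjective_of_injective hT ⟨_, a, h, rfl⟩
  have hf' := congrArg Subtype.val hf
  simp only [T] at hf'
  obtain ⟨c, hc, hcc⟩ := (h.sub (hb.Ts hp2 hpm)).redp_div (fun D ll => by
    have := congrFun (congrFun hf' D) ll
    rw [← Ts_map] at this
    beta_reduce at this
    rw [map_sub, ← this, sub_self])
  grind
lemma Ob.hecke_zp (hp2 : p ≠ 2) (hpm : ¬ p ∣ m) {D : Int} (hD : ¬ (p:Int) ∣ D) (ll : Zt m) (j : Nat)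
    {a : Int → Zt m → ℤ_[p]} (h : Ob m ℤ_[p] a) :
    a (p ^ (2 * (j + 1)) * D) (p ^ (j + 1) * ll) = legendreSym p D • a (p ^ (2 * j) * D) (p ^ j * ll) := by
  let P : Nat → Int := fun j => (p:Int) ^ (2 * j) * D
  let L : Nat → (Zt m) := fun j => (p : Zt m) ^ j * ll
  have hP : ∀ j, P (j + 1) = p ^ 2 * P j := fun j => by simp only [P]; ring
  have hL : ∀ j, L (j + 1) = p * L j := fun j => by simp only [L]; ring
  have hP0 : P 0 = D := by simp [P]
  have hL0 : L 0 = ll := by simp [L]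
  set χ := legendreSym p D with hχ
  have hχ2 : χ * χ = 1 := by
    have := legendreSym.sq_one p (a := D) (by rwa [Ne, ZMod.intCast_zmod_eq_zero_iff_dvd] )
    rw [← sq]; exact this
  have t0 : ∀ b : Int → Zt m → ℤ_[p], _root_.Ts m p b (P 0) (L 0) = χ • b (P 0) (L 0) + (p:Int) • b (P 1) (L 1) := by
    intro b
    rw [hP 0, hL 0, hP0, hL0, _root_.Ts, if_neg (fun h => hD (dvd_trans (dvd_pow_self _ two_ne_zero) h)), zero_add]
  have t1 : ∀ (b : Int → Zt m → ℤ_[p]) j, _root_.Ts m p b (P (j + 1)) (L (j + 1)) = b (P j) (L j) + (p:Int) • b (P (j + 2)) (L (j + 2)) := by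
    intro b j
    rw [hP, hL, Ts_p2 hp2 hpm, hP (j + 1), hL (j + 1), hP j, hL j]
  have key : ∀ s : Nat, ∀ j, ∀ a : Int → Zt m → ℤ_[p], Ob m ℤ_[p] a →
      (p : ℤ_[p]) ^ s ∣ a (P (j + 1)) (L (j + 1)) - χ • a (P j) (L j) := by
    intro s
    induction s with
    | zero => intro j a _; simp
    | succ s ih =>
    intro j
    induction j with
    | zero =>
      intro a ha
      obtain ⟨b, c, hb, hc, e⟩ := ha.decomp hp2 hpm
      obtain ⟨x, hx⟩ := ih 1 b hb
      obtain ⟨y, hy⟩ := ih 0 c hc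
      refine ⟨x + y, ?_⟩
      rw [e, e, t0, t1]
      simp only [zsmul_eq_mul, Int.cast_natCast, zero_add, Nat.reduceAdd] at hx hy ⊢
      have h2 : (χ : ℤ_[p]) * χ = 1 := by exact_mod_cast hχ2
      rw [pow_succ]
      linear_combination (p : ℤ_[p]) * hx + p * hy - b (P 0) (L 0) * h2
    | succ j ihj =>
      intro a ha
      obtain ⟨b, c, hb, hc, e⟩ := ha.decomp hp2 hpm
      obtain ⟨x, hx⟩ := ih (j + 2) b hb
      obtain ⟨y, hy⟩ := ih (j + 1) c hc
      obtain ⟨w, hw⟩ := ihj b hb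
      refine ⟨w + x + y, ?_⟩
      rw [e, e, t1, t1]
      simp only [zsmul_eq_mul, Int.cast_natCast] at hx hy hw ⊢
      rw [pow_succ] at hw ⊢
      linear_combination (p : ℤ_[p]) * hx + p * hy + hw
  have hz : a (P (j + 1)) (L (j + 1)) - χ • a (P j) (L j) = 0 := by
    by_contra hne
    have hu : ¬ IsUnit (p : ℤ_[p]) := PadicInt.prime_p.not_isUnit
    obtain ⟨n, hn⟩ := FiniteMultiplicity.of_not_isUnit hu hne
    grind
  exact sub_eq_zero.1 hz
lemma exists_den (a : Int → Zt m → ℚ) (s : Finset Int) :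
    ∃ n : Int, n ≠ 0 ∧ ∀ D ∈ s, ∀ ll, ∃ k : Int, n • a D ll = k := by
  obtain ⟨⟨n, hn⟩, hb⟩ := IsLocalization.exist_integer_multiples_of_finset (nonZeroDivisors Int)
    ((s ×ˢ Finset.univ).image fun x : Int × Zt m => a x.1 x.2)
  refine ⟨n, nonZeroDivisors.ne_zero hn, fun D hD ll => ?_⟩
  obtain ⟨k, hk⟩ := hb (a D ll) (Finset.mem_image.2 ⟨(D, ll), by simp [hD], rfl⟩)
  exact ⟨k, hk.symm⟩
lemma Ob.hecke (hp2 : p ≠ 2) (hpm : ¬ p ∣ m) {D : Int} (hD : ¬ (p:Int) ∣ D) (ll : Zt m) (j : Nat)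
    {a : Int → Zt m → ℚ} (h : Ob m ℚ a) :
    a (p ^ (2 * (j + 1)) * D) (p ^ (j + 1) * ll) = legendreSym p D • a (p ^ (2 * j) * D) (p ^ j * ll) := by
  obtain ⟨n, hn, hint⟩ := exists_den a (Finset.Icc 1 (5 * (m:Int) ^ 2))
  have h1 : Ob m ℚ_[p] (fun D ll => (algebraMap ℚ ℚ_[p]).toAddMonoidHom (n • a D ll)) := (h.zsmul n).map _
  let S : AddSubgroup ℚ_[p] := (PadicInt.subring p).toAddSubgroup
  have hS : ∀ x : ℚ_[p], x ∈ S ↔ ‖x‖ ≤ 1 := fun x => Iff.rfl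
  have hall : ∀ D ll, (algebraMap ℚ ℚ_[p]) (n • a D ll) ∈ S := by
    have h2 := h1.map (QuotientAddGroup.mk' S)
    have := h2.det ?_ ?_
    · intro D ll; exact (QuotientAddGroup.eq_zero_iff _).1 (this D ll)
    · intro x
      induction x using QuotientAddGroup.induction_on with
      | H x =>
      intro hx
      have hx' : (2:Int) • x ∈ S := (QuotientAddGroup.eq_zero_iff _).1 hx
      apply (QuotientAddGroup.eq_zero_iff _).2
      rw [hS] at hx' ⊢
      rw [zsmul_eq_mul, norm_mul] at hx'
      have e2 : ‖((2:Int) : ℚ_[p])‖ = 1 := by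
        have := (Padic.norm_natCast_eq_one_iff (p := p) (n := 2)).2 ((Nat.coprime_primes Fact.out Nat.prime_two).2 hp2)
        exact_mod_cast this
      rwa [e2, one_mul] at hx'
    · intro D ll hD
      by_cases h1' : 1 ≤ D
      · obtain ⟨k, hk⟩ := hint D (Finset.mem_Icc.2 ⟨h1', hD⟩) ll
        apply (QuotientAddGroup.eq_zero_iff _).2
        rw [hS, hk]
        change ‖(algebraMap ℚ ℚ_[p]) (k:ℚ)‖ ≤ 1
        rw [map_intCast]
        exact Padic.norm_int_le_one k
      · by_contra hne
        have := h2.pos D ll hne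
        omega
  let b : Int → Zt m → ℤ_[p] := fun D ll => ⟨_, (hS _).1 (hall D ll)⟩
  have hb : Ob m ℤ_[p] b := Ob.of_inj (PadicInt.Coe.ringHom (p := p)).toAddMonoidHom Subtype.val_injective h1
  have := congrArg (PadicInt.Coe.ringHom (p := p)) (hb.hecke_zp hp2 hpm hD ll j)
  rw [map_zsmul] at this
  change (algebraMap ℚ ℚ_[p]) _ = _ • (algebraMap ℚ ℚ_[p]) _ at this
  rw [← map_zsmul] at this
  have h3 := (algebraMap ℚ ℚ_[p]).injective this
  rw [smul_comm] at h3
  exact smul_right_injective ℚ hn h3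
end Hecke
lemma exists_nonres (D N : Nat) (hN : N ≠ 0) (hD : ¬ IsSquare D) :
    ∃ p : Nat, ∃ _ : Fact p.Prime, p ≠ 2 ∧ ¬ p ∣ N ∧ legendreSym p D = -1 := by
  have hD0 : D ≠ 0 := fun h => hD (h ▸ ⟨0, rfl⟩)
  obtain ⟨l, hl, hodd⟩ : ∃ l : Nat, l.Prime ∧ Odd (D.factorization l) := by
    by_contra hn
    push Not at hn
    apply hD
    rw [← Nat.prod_factorization_pow_eq_self hD0, Finsupp.prod]
    refine Finset.isSquare_prod _ fun l hl => ?_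
    have := hn l (Nat.prime_of_mem_primeFactors (Nat.support_factorization D ▸ hl))
    rw [Nat.not_odd_iff_even] at this
    exact this.isSquare_pow l
  have hl0 := hl.pos
  let D' := ordCompl[l] D
  let N' := ordCompl[l] N
  have hD' : l.Coprime D' := Nat.coprime_ordCompl hl hD0
  have hN' : l.Coprime N' := Nat.coprime_ordCompl hl hN
  have eD : l ^ (D.factorization l) * D' = D := Nat.ordProj_mul_ordCompl_eq_self D l
  have eN : l ^ (N.factorization l) * N' = N := Nat.ordProj_mul_ordCompl_eq_self N l
  have hD'0 : D' ≠ 0 := fun h => hD0 (by rw [← eD, h, mul_zero])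
  obtain ⟨n, hn1, hn2, hn3, hJ⟩ : ∃ n : Nat, n % (4 * D') = 1 ∧ n.Coprime N' ∧ n.Coprime l ∧ jacobiSym l n = -1 := by
    by_cases h2 : l = 2
    · have hc : Nat.Coprime 8 (D' * N') := by
        rw [show 8 = 2 ^ 3 by norm_num]
        exact Nat.Coprime.pow_left 3 (h2 ▸ hD'.mul_right hN')
      obtain ⟨n, hna, hnb⟩ := Nat.chineseRemainder hc 5 1
      have h8 : n % 8 = 5 := hna
      refine ⟨n, ?_, ?_, ?_, ?_⟩
      · have hc4 : Nat.Coprime 4 D' := by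
          rw [show 4 = 2 ^ 2 by norm_num]; exact Nat.Coprime.pow_left 2 (h2 ▸ hD')
        have e : n ≡ 1 [MOD 4 * D'] := (Nat.modEq_and_modEq_iff_modEq_mul hc4).1
          ⟨show n % 4 = 1 % 4 by omega, hnb.of_mul_right N'⟩
        rw [show n % (4 * D') = 1 % (4 * D') from e, Nat.mod_eq_of_lt (by omega)]
      · have := (hnb.of_mul_left D').gcd_eq
        rw [Nat.Coprime, this]; simp
      · rw [h2, Nat.coprime_two_right]; exact Nat.odd_iff.2 (by omega)
      · rw [h2]
        have := jacobiSym.at_two (b := n) (Nat.odd_iff.2 (by omega))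
        rw [show ((2:Nat):Int) = 2 by rfl, this, ZMod.χ₈_nat_eq_if_mod_eight, if_neg (by omega), if_neg (by omega)]
    · have : Fact l.Prime := ⟨hl⟩
      obtain ⟨x, hx⟩ := FiniteField.exists_nonsquare (F := ZMod l) (by rwa [ZMod.ringChar_zmod_n])
      have hlo : Odd l := hl.odd_of_ne_two h2
      have hc : Nat.Coprime l (4 * D' * N') := by
        refine (Nat.Coprime.mul_right ?_ hD').mul_right hN'
        rw [show 4 = 2 ^ 2 by norm_num]; exact Nat.Coprime.pow_right 2 ((Nat.coprime_primes hl Nat.prime_two).2 h2)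
      obtain ⟨n, hna, hnb⟩ := Nat.chineseRemainder hc x.val 1
      have e : n ≡ 1 [MOD 4 * D'] := hnb.of_mul_right N'
      have e4 : n % 4 = 1 := e.of_mul_right D'
      have hJn : jacobiSym n l = -1 := by
        rw [← jacobiSym.legendreSym.to_jacobiSym, legendreSym.eq_neg_one_iff]
        have : ((n:Int) : ZMod l) = x := by
          have := (ZMod.natCast_eq_natCast_iff n x.val l).2 hna
          simp_all
        rwa [this]
      refine ⟨n, ?_, ?_, ?_, ?_⟩
      · rw [show n % (4 * D') = 1 % (4 * D') from e, Nat.mod_eq_of_lt (by omega)]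
      · have := (hnb.of_mul_left (4 * D')).gcd_eq
        rw [Nat.Coprime, this]; simp
      · by_contra hcon
        have := jacobiSym.eq_zero_iff_not_coprime (a := n) (b := l) |>.2 (by rwa [Int.gcd_natCast_natCast])
        rw [this] at hJn; norm_num at hJn
      · rw [jacobiSym.quadratic_reciprocity_one_mod_four' hlo e4, hJn]
  have hno : Odd n := by
    have : n % 4 = 1 := by rw [← Nat.mod_mul_right_mod n 4 D', hn1]
    exact Nat.odd_iff.2 (by omega)
  have hJD : jacobiSym D n = -1 := by
    rw [← eD]
    push_cast
    rw [jacobiSym.mul_left, jacobiSym.pow_left, hJ, hodd.neg_one_pow, jacobiSym.mod_right' D' hno, hn1]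
    simp
  obtain ⟨p, hp, hpn, hJp⟩ := jacobiSym.eq_neg_one_at_prime_divisor_of_eq_neg_one hJD
  refine ⟨p, ⟨hp⟩, ?_, ?_, ?_⟩
  · rintro rfl
    grind
  · intro hpN
    have hc : n.Coprime N := by rw [← eN]; exact (hn3.pow_right _).mul_right hn2
    exact hp.one_lt.ne' (Nat.dvd_one.1 (hc ▸ Nat.dvd_gcd hpn hpN))
  · have : Fact p.Prime := ⟨hp⟩
    rw [jacobiSym.legendreSym.to_jacobiSym]; exact hJp
section Pur
variable {m : Nat} [NeZero m]
lemma Ob.Ts_val {p : Nat} [Fact p.Prime] (hp2 : p ≠ 2) (hpm : ¬ p ∣ m) {a : Int → Zt m → ℚ} (h : Ob m ℚ a)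
    {D : Int} (hD : ¬ (p:Int) ∣ D) (ll : Zt m) :
    _root_.Ts m p a D ll = legendreSym p D * (1 + p) * a D ll := by
  have h1 := h.hecke hp2 hpm hD ll 0
  simp only [zero_add, mul_one, pow_one, mul_zero, pow_zero, one_mul] at h1
  rw [_root_.Ts, if_neg (fun h => hD (dvd_trans (dvd_pow_self _ two_ne_zero) h)), zero_add, h1]
  simp only [zsmul_eq_mul, Int.cast_natCast]
  ring
lemma win_ndvd {p m : Nat} (hp : p.Prime) (h : ¬ p ∣ 2 * m * (5 * m ^ 2).factorial) :
    ¬ p ∣ m ∧ ∀ D : Int, 0 < D → D ≤ 5 * (m:Int) ^ 2 → ¬ (p:Int) ∣ D := by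
  refine ⟨fun h1 => h (Dvd.dvd.mul_right (h1.mul_left 2) _), fun D h0 h1 h2 => h (Dvd.dvd.mul_left ?_ _)⟩
  lift D to Nat using h0.le
  have h1' : D ≤ 5 * m ^ 2 := by exact_mod_cast h1
  exact (Int.natCast_dvd_natCast.1 h2).trans (Nat.dvd_factorial (by exact_mod_cast h0) h1')
lemma leg_one (p : Nat) [Fact p.Prime] {D : Int} (hs : IsSquare D) (hD : ¬ (p:Int) ∣ D) : legendreSym p D = 1 := by
  obtain ⟨k, rfl⟩ := hs
  rw [← sq]
  refine legendreSym.sq_one' p ?_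
  rw [Ne, ZMod.intCast_zmod_eq_zero_iff_dvd]
  exact fun hh => hD (hh.mul_right k)
lemma sq_cast {D : Nat} (h : ¬ IsSquare (D:Int)) : ¬ IsSquare D := fun ⟨k, hk⟩ => h ⟨k, by exact_mod_cast hk⟩
lemma fac_ne (m : Nat) [NeZero m] : 2 * m * (5 * m ^ 2).factorial ≠ 0 :=
  mul_ne_zero (mul_ne_zero two_ne_zero (NeZero.ne m)) (Nat.factorial_ne_zero _)
lemma Ob.purify {a : Int → Zt m → ℚ} (h : Ob m ℚ a) :
    ∃ a', Ob m ℚ a' ∧ (∀ D ll, ¬ IsSquare D → a' D ll = 0) ∧ ∃ c : ℚ, c ≠ 0 ∧ ∀ ll, a' 1 ll = c * a 1 ll := by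
  have hm1 : (1:Int) ≤ 5 * (m:Int) ^ 2 := by
    have : (1:Int) ≤ m := by exact_mod_cast Nat.one_le_iff_ne_zero.2 (NeZero.ne m)
    nlinarith
  have step : ∀ S : Finset Int, (∀ D ∈ S, D ≤ 5 * (m:Int) ^ 2 ∧ ¬ IsSquare D ∧ 0 < D) →
      ∃ a', Ob m ℚ a' ∧ (∀ D ∈ S, ∀ ll, a' D ll = 0) ∧ ∃ c : ℚ, c ≠ 0 ∧ ∀ ll, a' 1 ll = c * a 1 ll := by
    intro S
    induction S using Finset.induction_on with
    | empty => exact fun _ => ⟨a, h, by simp, 1, one_ne_zero, fun ll => (one_mul _).symm⟩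
    | insert D0 S hD0 ih =>
      intro hS
      obtain ⟨a', ha', hz, c, hc, he⟩ := ih fun D hD => hS D (Finset.mem_insert_of_mem hD)
      obtain ⟨hb, hs, h0⟩ := hS D0 (Finset.mem_insert_self _ _)
      obtain ⟨d, rfl⟩ := Int.eq_ofNat_of_zero_le h0.le
      obtain ⟨p, hp, hp2, hpN, hleg⟩ := exists_nonres d _ (fac_ne m) (sq_cast hs)
      obtain ⟨hpm, hw⟩ := win_ndvd hp.out hpN
      have hv : ∀ D ll, 0 < D → D ≤ 5 * (m:Int) ^ 2 → _root_.Ts m p a' D ll + ((p:Int) + 1) • a' D ll = (legendreSym p D + 1) * (1 + p) * a' D ll := by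
        intro D ll h1 h2
        rw [ha'.Ts_val hp2 hpm (hw D h1 h2), zsmul_eq_mul]
        push_cast; ring
      refine ⟨_, (ha'.Ts hp2 hpm).add (ha'.zsmul (p + 1)), ?_, 2 * (1 + p) * c, ?_, ?_⟩
      · intro D hD ll
        obtain ⟨h1, h2, h3⟩ := hS D hD
        beta_reduce
        rw [hv D ll h3 h1]
        rcases Finset.mem_insert.1 hD with rfl | hD
        · rw [hleg]; norm_num
        · rw [hz D hD, mul_zero]
      · have : (0:ℚ) < 1 + p := by positivity
        positivity
      · intro ll
        beta_reduce
        rw [hv 1 ll one_pos hm1, he, leg_one p (D := 1) ⟨1, rfl⟩ (hw 1 one_pos hm1)]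
        push_cast; ring
  obtain ⟨a', ha', hz, c, hc, he⟩ := step ((Finset.Icc 1 (5 * (m:Int) ^ 2)).filter fun D => ¬ IsSquare D)
    (fun D hD => by
      rw [Finset.mem_filter, Finset.mem_Icc] at hD
      exact ⟨hD.1.2, hD.2, by omega⟩)
  refine ⟨a', ha', ?_, c, hc, he⟩
  intro D ll hD
  by_contra hne
  have h0 := ha'.pos D ll hne
  obtain ⟨d, rfl⟩ := Int.eq_ofNat_of_zero_le h0.le
  obtain ⟨p, hp, hp2, hpN, hleg⟩ := exists_nonres d _ (fac_ne m) (sq_cast hD)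
  obtain ⟨hpm, hw⟩ := win_ndvd hp.out hpN
  have hob := (ha'.Ts hp2 hpm).sub (ha'.zsmul (p + 1))
  have hall := hob.det (fun x hx => by simpa using hx) (fun D ll hle => by
    by_contra hne
    have h0 := hob.pos D ll hne
    apply hne
    rw [ha'.Ts_val hp2 hpm (hw D h0 hle)]
    by_cases hs : IsSquare D
    · rw [leg_one p hs (hw D h0 hle), zsmul_eq_mul]; push_cast; ring
    · rw [hz D (by rw [Finset.mem_filter, Finset.mem_Icc]; exact ⟨⟨by omega, hle⟩, hs⟩)]; simp)
  have h1 := hall d ll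
  have hnd : ¬ (p:Int) ∣ d := by
    intro hd
    have := (legendreSym.eq_zero_iff p d).2 ((ZMod.intCast_zmod_eq_zero_iff_dvd _ _).2 hd)
    rw [hleg] at this; norm_num at this
  rw [ha'.Ts_val hp2 hpm hnd, hleg, zsmul_eq_mul] at h1
  push_cast at h1
  have h2 : (-2 * (1 + (p:ℚ))) * a' d ll = 0 := by linear_combination h1
  rcases mul_eq_zero.1 h2 with h3 | h3
  · linarith
  · exact hne h3
lemma Ob.sq_val {a : Int → Zt m → ℚ} (h : Ob m ℚ a) (n : Nat) (hn : n.Coprime (2 * m)) (ll : Zt m) :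
    a ((n:Int) ^ 2) (n * ll) = a 1 ll := by
  induction n using induction_on_primes with
  | zero => simp at hn
  | one => simp
  | prime_mul p k hp ih =>
    have : Fact p.Prime := ⟨hp⟩
    have hp2 : p ≠ 2 := by
      rintro rfl
      exact absurd (Nat.Coprime.coprime_dvd_left (dvd_mul_right _ _) hn) (by simp)
    have hpm : ¬ p ∣ m := fun hd => hp.one_lt.ne' (Nat.dvd_one.1 (hn ▸ Nat.dvd_gcd (dvd_mul_right _ _) (hd.mul_left 2)))
    have hk := Nat.Coprime.coprime_dvd_left (dvd_mul_left _ _) hn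
    rw [← ih hk]
    have hk0 : k ≠ 0 := by rintro rfl; simp at hk
    obtain ⟨j, k', hk', e⟩ := Nat.exists_eq_pow_mul_and_not_dvd hk0 p hp.one_lt.ne'
    have hnd : ¬ (p:Int) ∣ (k':Int) ^ 2 := fun hd => hk' (by exact_mod_cast Int.Prime.dvd_pow' hp hd)
    have h1 := h.hecke hp2 hpm hnd (k' * ll) j
    rw [leg_one p ⟨k', by ring⟩ hnd, one_smul] at h1
    have e1 : (p:Int) ^ (2 * (j + 1)) * (k':Int) ^ 2 = ((p * k : Nat) : Int) ^ 2 := by rw [e]; push_cast; ring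
    have e2 : (p:Int) ^ (2 * j) * (k':Int) ^ 2 = (k : Int) ^ 2 := by rw [e]; push_cast; ring
    have e3 : (p : Zt m) ^ (j + 1) * (k' * ll) = ((p * k : Nat) : Zt m) * ll := by rw [e]; push_cast; ring
    have e4 : (p : Zt m) ^ j * (k' * ll) = (k : Zt m) * ll := by rw [e]; push_cast; ring
    rwa [e1, e2, e3, e4] at h1
end Pur
def rcQ (r : Int) (f : CJ) : CQ := ⟨PowerSeries.mk fun n => ((PowerSeries.coeff n f.1).coeff r : Complex), fun _ ρ h0 h1 => by
  refine Summable.of_nonneg_of_le (fun n => by positivity) (fun n => ?_) (f.2 ⟨1, one_pos⟩ ρ h0 h1)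
  gcongr
  rw [PowerSeries.coeff_mk]
  change ‖(_ : Complex)‖ ≤ Ln 1 _
  have := (Ln_summable 1 (PowerSeries.coeff n f.1)).le_tsum r (fun _ _ => by positivity)
  rw [one_zpow, mul_one] at this
  rw [Ln]; simpa using this⟩
lemma rcQ_mul (r : Int) {f : CJ} (hf : f ∈ ZS) (g : CJ) : rcQ r (f * g) = lzC 0 f * rcQ r g := by
  obtain ⟨F, hF⟩ := hf
  have hF' : PowerSeries.map LaurentPolynomial.C F = f.1 := hF
  have e : ∀ n, PowerSeries.coeff n (lzC 0 f).1 = (PowerSeries.coeff n F : Int) := fun n => by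
    rw [show PowerSeries.coeff n (lzC 0 f).1 = lz 0 (PowerSeries.coeff n f.1) from PowerSeries.coeff_map (lz 0) n f.1,
      ← hF', PowerSeries.coeff_map, lz_C]
  apply Subtype.ext
  ext n
  rw [Subring.coe_mul, PowerSeries.coeff_mul, rcQ, PowerSeries.coeff_mk, Subring.coe_mul, PowerSeries.coeff_mul,
    AddMonoidAlgebra.coeff_sum, Finsupp.finsetSum_apply, Int.cast_sum]
  refine Finset.sum_congr rfl fun p _ => ?_
  rw [e, ← hF', PowerSeries.coeff_map, coeff_C_mul, rcQ, PowerSeries.coeff_mk, Int.cast_mul]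
def cQ (c : Complex) : CQ := ⟨PowerSeries.C c, fun _ ρ _ _ => by
  apply summable_of_ne_finset_zero (s := {0})
  intro b hb
  simp only [Finset.mem_singleton] at hb
  simp [PowerSeries.coeff_C, hb]⟩
lemma evq_cQ (c : Complex) {τ : Complex} (hτ : 0 < τ.im) : evq τ (cQ c) = c := by
  refine (evq_hasSum _ hτ).unique ?_
  have := hasSum_single (f := fun n : Nat => PowerSeries.coeff n (cQ c).1 * ee (n * τ)) 0 (fun b hb => by
    simp [cQ, PowerSeries.coeff_C, hb])
  simpa [cQ, ee_zero] using this
lemma evq_small (f : CQ) (K : Nat) (hK : ∀ n < K, PowerSeries.coeff n f.1 = 0) :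
    ∃ B : Real, ∀ τ : Complex, 1 ≤ τ.im → ‖evq τ f‖ ≤ B * ‖ee τ‖ ^ K := by
  set ρ : Real := Real.exp (-(2 * Real.pi)) with hρ
  have h1 : ρ < 1 := by rw [hρ, Real.exp_lt_one_iff]; linarith [Real.pi_pos]
  have h0 : 0 < ρ := Real.exp_pos _
  have hs : Summable fun n => ‖PowerSeries.coeff n f.1‖ * ρ ^ n := f.2 () ρ h0.le h1
  refine ⟨(∑' n, ‖PowerSeries.coeff n f.1‖ * ρ ^ n) * (ρ ^ K)⁻¹, fun τ hτ => ?_⟩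
  have hle : ‖ee τ‖ ≤ ρ := by
    rw [norm_ee, hρ, Real.exp_le_exp]; nlinarith [Real.pi_pos]
  rw [← (evq_hasSum f (by linarith : 0 < τ.im)).tsum_eq]
  have hb : ∀ n : Nat, ‖PowerSeries.coeff n f.1 * ee (n * τ)‖ ≤ (‖PowerSeries.coeff n f.1‖ * ρ ^ n) * ((ρ ^ K)⁻¹ * ‖ee τ‖ ^ K) := by
    intro n
    by_cases hn : n < K
    · rw [hK n hn]; simp
    · obtain ⟨d, rfl⟩ := Nat.exists_eq_add_of_le (not_lt.1 hn)
      rw [← ee_pow, norm_mul, norm_pow, mul_assoc]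
      gcongr
      rw [show ρ ^ (K + d) * ((ρ ^ K)⁻¹ * ‖ee τ‖ ^ K) = ‖ee τ‖ ^ K * ρ ^ d by
        rw [pow_add]; field_simp, pow_add]
      gcongr
  have hs2 := hs.mul_right ((ρ ^ K)⁻¹ * ‖ee τ‖ ^ K)
  refine (norm_tsum_le_tsum_norm (Summable.of_nonneg_of_le (fun _ => norm_nonneg _) hb hs2)).trans ?_
  refine ((Summable.of_nonneg_of_le (fun _ => norm_nonneg _) hb hs2).tsum_le_tsum hb hs2).trans (le_of_eq ?_)
  rw [tsum_mul_right, mul_assoc]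
lemma ee_iY_tendsto {s : Real} (hs : 0 < s) : Tendsto (fun Y : Real => ‖ee (s * (I * Y))‖) atTop (𝓝 0) := by
  have : ∀ Y : Real, ‖ee (s * (I * Y))‖ = Real.exp (-(2 * Real.pi * s * Y)) := fun Y => by
    rw [norm_ee]; congr 1; simp; ring
  simp only [this]
  refine Real.tendsto_exp_neg_atTop_nhds_zero.comp (tendsto_id.const_mul_atTop (by have := Real.pi_pos; positivity))
lemma evq_lim (f : CQ) : Tendsto (fun Y : Real => evq (I * Y) f) atTop (𝓝 (PowerSeries.coeff 0 f.1)) := by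
  obtain ⟨B, hB⟩ := evq_small (f - cQ (PowerSeries.coeff 0 f.1)) 1 (fun n hn => by
    obtain rfl : n = 0 := by omega
    simp [cQ])
  rw [tendsto_iff_norm_sub_tendsto_zero]
  have h1 := (ee_iY_tendsto one_pos).const_mul B
  rw [mul_zero] at h1
  refine squeeze_zero' (Eventually.of_forall fun _ => norm_nonneg _) ?_ h1
  filter_upwards [eventually_ge_atTop 1] with Y hY
  have := hB (I * Y) (by simpa using hY)
  rw [map_sub, evq_cQ _ (by simp; linarith), pow_one] at this
  simpa using this
def MF (k s : Int) (f : CQ) : Prop := ∀ τ : Complex, 0 < τ.im →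
  ee (s * (-1 / τ)) * evq (-1 / τ) f = τ ^ k * (ee (s * τ) * evq τ f)
lemma MF.add {k s : Int} {f g : CQ} (hf : MF k s f) (hg : MF k s g) : MF k s (f + g) := fun τ hτ => by
  rw [map_add, map_add, mul_add, hf τ hτ, hg τ hτ]; ring
lemma MF.zero (k s : Int) : MF k s 0 := fun τ hτ => by simp
lemma MF.smul {k s : Int} {f : CQ} (hf : MF k s f) (c : Complex) : MF k s (cQ c * f) := fun τ hτ => by
  rw [map_mul, map_mul, evq_cQ _ hτ, evq_cQ _ (im_S_pos hτ), mul_left_comm, hf τ hτ]; ring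
lemma MF.mul {k s k' s' : Int} {f g : CQ} (hf : MF k s f) (hg : MF k' s' g) : MF (k + k') (s + s') (f * g) := fun τ hτ => by
  have e : ∀ x : Complex, ee (((s + s' : Int) : Complex) * x) = ee (s * x) * ee (s' * x) := fun x => by
    rw [← ee_add]; congr 1; push_cast; ring
  rw [map_mul, map_mul, e, e, zpow_add₀ (ne_zero_of_im hτ)]
  linear_combination (ee (s' * (-1 / τ)) * evq (-1 / τ) g) * hf τ hτ + τ ^ k * (ee (s * τ) * evq τ f) * hg τ hτ
lemma JF.mf {k s : Int} {f : CJ} (h : JF k 0 s f) : MF k s (lzC 0 f) := fun τ hτ => by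
  have := h.slaw τ 0 hτ
  simpa [ph, EV, ee_zero] using this
lemma MF.shift {k s : Int} {f : CQ} (h : MF k s f) (K : Nat) : MF k (s - K) (lzC 0 XC ^ K * f) := fun τ hτ => by
  have e : ∀ x : Complex, 0 < x.im → ee (((s - K : Int) : Complex) * x) * evq x (lzC 0 XC ^ K * f) = ee (s * x) * evq x f := fun x hx => by
    have h1 : evq x (lzC 0 XC) = ee x := ev_X hx 0
    rw [map_mul, map_pow, h1, ee_pow, ← mul_assoc, ← ee_add]
    congr 2; push_cast; ring
  rw [e _ hτ, e _ (im_S_pos hτ)]; exact h τ hτ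
lemma MF.ct {K : Nat} {f : CQ} (h : MF 2 (-K) f) : PowerSeries.coeff K f.1 = 0 := by
  have h0 := ct0 (fun n => if 0 ≤ n + K then PowerSeries.coeff (n + K).toNat f.1 else 0)
    (fun τ => ee (((-K : Int) : Complex) * τ) * evq τ f) (fun τ hτ => by
      have h1 := (evq_hasSum f hτ).mul_left (ee (((-K : Int) : Complex) * τ))
      have hinj : Function.Injective fun n : Nat => (n : Int) - K := fun a b hab => by
        linarith
      refine (hinj.hasSum_iff (fun p hp => ?_)).1 (Eq.mp (congrArg (fun f => HasSum f _) (funext fun p => ?_)) h1)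
      · grind
      · simp only [Function.comp_apply, sub_add_cancel, Int.natCast_nonneg, if_true, Int.toNat_natCast]
        rw [mul_left_comm, ← ee_add]
        congr 2; push_cast; ring) (fun τ hτ => by
      have := h τ hτ
      have e : τ ^ (2:Int) = τ ^ 2 := by norm_cast
      rw [← e]; exact this)
  simpa using h0
lemma coeff_lead {R : Type*} [CommRing R] (F d : PowerSeries R) (N : Nat) (h : ∀ n < N, PowerSeries.coeff n d = 0) :
    PowerSeries.coeff N (F * d) = PowerSeries.coeff 0 F * PowerSeries.coeff N d := by
  obtain ⟨e, rfl⟩ := PowerSeries.X_pow_dvd_iff.2 h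
  rw [mul_left_comm, PowerSeries.coeff_X_pow_mul', PowerSeries.coeff_X_pow_mul', if_pos le_rfl, Nat.sub_self]
  simp
lemma coeff_lz0 (f : CJ) : PowerSeries.coeff 0 (lzC 0 f).1 = lz 0 (ld f) := by
  rw [show PowerSeries.coeff 0 (lzC 0 f).1 = lz 0 (PowerSeries.coeff 0 f.1) from PowerSeries.coeff_map (lz 0) 0 f.1,
    PowerSeries.coeff_zero_eq_constantCoeff_apply]; rfl
lemma exists_mf (m : Nat) (f : PowerSeries Complex) (K : Nat) (hK : K ≤ 2 * m + 1) :
    ∃ h : CQ, MF (12 * m) (-m) h ∧ ∀ n < K, PowerSeries.coeff n h.1 = PowerSeries.coeff n f := by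
  induction K with
  | zero => exact ⟨0, MF.zero _ _, by simp⟩
  | succ K ih =>
    obtain ⟨h, h1, h2⟩ := ih (by omega)
    set b : CJ := fE4 ^ (3 * (2 * m - K)) * fu ^ K * fui ^ m
    have hb : JF (12 * m) 0 (K - m) b :=
      (((jf_E4.pow (3 * (2 * m - K))).mul (jf_u.pow K)).mul (jf_ui.pow m)).cast
        (by push_cast [show K ≤ 2 * m by omega]; ring) (by simp) (by push_cast; ring)
    have hb2 : MF (12 * m) (-m) (lzC 0 XC ^ K * lzC 0 b) := by
      have := hb.mf.shift K
      simp_all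
    have hX : (lzC 0 XC).1 = PowerSeries.X := by
      change PowerSeries.map (lz 0) PowerSeries.X = _
      simp
    have hb0 : PowerSeries.coeff 0 (lzC 0 b).1 = 1 := by
      rw [coeff_lz0]; simp [b, ld_E4, ld_fu, ld_fui]
    refine ⟨h + cQ (PowerSeries.coeff K f - PowerSeries.coeff K h.1) * (lzC 0 XC ^ K * lzC 0 b), h1.add (hb2.smul _), fun n hn => ?_⟩
    rw [Subring.coe_add, map_add, Subring.coe_mul, cQ, PowerSeries.coeff_C_mul, Subring.coe_mul, Subring.coe_pow, hX,
      PowerSeries.coeff_X_pow_mul']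
    rcases Nat.lt_succ_iff_lt_or_eq.1 hn with hn | rfl
    · rw [if_neg (by omega), h2 n hn]; ring
    · rw [if_pos le_rfl, Nat.sub_self, hb0]; ring
lemma mf_unique (m : Nat) (f : PowerSeries Complex) (hf : ∀ i : Nat, PowerSeries.coeff (2 * m + 1 + i) ((lzC 0 (Fi m i)).1 * f) = 0) :
    ∃ h : CQ, MF (12 * m) (-m) h ∧ h.1 = f := by
  obtain ⟨h, h1, h2⟩ := exists_mf m f (2 * m + 1) le_rfl
  refine ⟨h, h1, ?_⟩
  have hh : ∀ i : Nat, PowerSeries.coeff (2 * m + 1 + i) ((lzC 0 (Fi m i)).1 * h.1) = 0 := fun i => by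
    have := (jf_Fi m i).mf.mul h1
    rw [← Subring.coe_mul]
    apply MF.ct
    grind
  rw [← sub_eq_zero]
  ext n
  induction n using Nat.strong_induction_on with
  | _ n ih =>
    by_cases hn : n < 2 * m + 1
    · rw [map_sub, h2 n hn]; simp
    · obtain ⟨i, rfl⟩ := Nat.exists_eq_add_of_le (not_lt.1 hn)
      have h3 := coeff_lead (lzC 0 (Fi m i)).1 (h.1 - f) (2 * m + 1 + i) (fun n hn => by simpa using ih n hn)
      rw [mul_sub, map_sub, hh, hf, coeff_lz0, ld_Fi, map_one, one_mul, sub_zero] at h3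
      rw [← h3]; simp
section Gh
variable {m : Nat} [NeZero m]
def gh (m : Nat) (a : Int → Zt m → Complex) (r : Nat) : PowerSeries Complex :=
  PowerSeries.mk fun n => a (4 * m * ((n:Int) - m) + (r:Int) ^ 2) (r : Int)
def AM (m : Nat) : Matrix (Fin (m + 1)) (Fin (m + 1)) CQ := fun j r => (mu m r : CQ) * rcQ ((r : Nat) : Int) (ej m j)
lemma Fi_ZS (m i : Nat) : Fi m i ∈ ZS :=
  mul_mem (mul_mem (pow_mem fE4_ZS _) fE6_ZS) (pow_mem fui_ZS _)
lemma neg_ind {r : Nat} (hr : r ≤ m) {N : Int} (hN : N < -m) : 4 * (m:Int) * N + (r:Int) ^ 2 < 0 := by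
  have h1 : (r:Int) ≤ m := by exact_mod_cast hr
  have h2 : (0:Int) < m := by exact_mod_cast Nat.pos_of_ne_zero (NeZero.ne m)
  nlinarith
lemma Ob.fhat {a : Int → Zt m → Complex} (h : Ob m Complex a) (j : Fin (m + 1)) :
    ∃ f : CQ, MF (12 * m) (-m) f ∧ f.1 = ∑ r : Fin (m + 1), (AM m j r).1 * gh m a r := by
  apply mf_unique
  intro i
  obtain ⟨c, hc, hcc⟩ := (jf_X (m := m) (j := j) (by omega) i).toVV
  have h0 := h.kill c hc
  rw [pr_coord hc h.pos h.val h.even, Finset.sum_range] at h0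
  rw [Finset.mul_sum, map_sum]
  refine Eq.trans ?_ h0
  refine Finset.sum_congr rfl fun r _ => ?_
  have e1 : (lzC 0 (Fi m i)).1 * ((AM m j r).1 * gh m a r) =
      mu m r • (gh m a r * (rcQ ((r:Nat):Int) (ej m j * Fi m i)).1) := by
    rw [mul_comm (ej m j), rcQ_mul _ (Fi_ZS m i), AM, Subring.coe_mul, Subring.coe_mul, zsmul_eq_mul, Subring.coe_intCast]
    ring
  rw [e1, map_zsmul]
  congr 1
  rw [PowerSeries.coeff_mul, Finset.Nat.sum_antidiagonal_eq_sum_range_succ_mk, finsum_inj (fun n : Nat => (n:Int) - m),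
    finsum_eq_sum_of_support_subset (s := Finset.range (2 * m + 1 + i).succ)]
  · refine Finset.sum_congr rfl fun n hn => ?_
    rw [Finset.mem_range] at hn
    rw [hcc, gh, PowerSeries.coeff_mk, rcQ, PowerSeries.coeff_mk, zsmul_eq_mul,
      show -((n:Int) - m) - -(m + 1 + i) = ((2 * m + 1 + i - n : Nat) : Int) by push_cast [show n ≤ 2 * m + 1 + i by omega]; ring, co_nat]
    rw [mul_comm]
  · intro n hn
    rw [Function.mem_support] at hn
    by_contra hh
    simp only [Finset.coe_range, Set.mem_Iio, not_lt] at hh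
    rw [hcc, co_neg _ (by omega), zero_smul] at hn
    exact hn rfl
  · intro x y hxy
    linarith
  · intro N hN
    have hN' : N < -m := by
      by_contra hh
      exact hN ⟨(N + m).toNat, by simp; omega⟩
    have := neg_ind (show (r:Nat) ≤ m by omega) hN'
    by_contra h1
    have h2 := h.pos _ _ (fun h3 => h1 (by rw [h3, smul_zero]))
    omega
lemma exists_H (m : Nat) [NeZero m] (j : Fin (m + 1)) : ∃ C : Int → Zt m → Complex, IsVV (12 * m) m C ∧
    ∀ r ≤ m, ∀ τ : Complex, 0 < τ.im → hh m C (r : Nat) τ = ee (-((r:Complex) ^ 2 / (4 * m)) * τ) * evq τ (rcQ ((r:Nat):Int) (ej m j)) := by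
  obtain ⟨c, hc, hcc⟩ := (jf_ej (m := m) (j := j) (by omega)).toVV
  have hm : (m:Complex) ≠ 0 := by exact_mod_cast NeZero.ne m
  have hm' : (m:Int) ≠ 0 := by exact_mod_cast NeZero.ne m
  refine ⟨_, hc, fun r hr τ hτ => ?_⟩
  have h1 := (evq_hasSum (rcQ ((r:Nat):Int) (ej m j)) hτ).mul_left (ee (-((r:Complex) ^ 2 / (4 * m)) * τ))
  refine HasSum.tsum_eq ?_
  have hinj : Function.Injective fun n : Nat => 4 * (m:Int) * n - (r:Int) ^ 2 := fun x y hxy => by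
    simpa [hm', NeZero.ne m] using hxy
  refine (hinj.hasSum_iff (fun p hp => ?_)).1 (Eq.mp (congrArg (fun f => HasSum f _) (funext fun p => ?_)) h1)
  · by_contra h0
    have h2 : (c p ((r:Int) : Zt m) : Complex) ≠ 0 := fun h3 => h0 (by rw [Int.cast_natCast] at h3; beta_reduce; rw [h3, zero_mul])
    obtain ⟨n, hn⟩ := PreVV.supp (IsVV.toPreVV hc) _ _ h2
    obtain rfl : p = 4 * m * n - (r:Int) ^ 2 := by linarith
    rw [hcc] at h2
    by_cases h3 : n < 0
    · exact h2 (by rw [co_neg _ (by omega)]; simp)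
    · exact hp ⟨n.toNat, by simp; left; omega⟩
  · have := hcc p r
    rw [Int.cast_natCast] at this
    simp only [Function.comp_apply]
    rw [this, sub_zero, co_nat, rcQ, PowerSeries.coeff_mk, mul_left_comm, ← ee_add]
    congr 2
    push_cast; field_simp; ring
lemma det_AM (m : Nat) [NeZero m] : PowerSeries.coeff 0 (AM m).det.1 ≠ 0 := by
  set φ : CQ →+* Complex := (PowerSeries.constantCoeff (R := Complex)).comp CQ.subtype
  have e : ∀ f : CQ, φ f = PowerSeries.coeff 0 f.1 := fun f => by
    rw [PowerSeries.coeff_zero_eq_constantCoeff_apply]; rfl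
  rw [← e, RingHom.map_det]
  have e2 : ∀ j r, φ (AM m j r) = mu m r * (((LaurentPolynomial.T 1 + LaurentPolynomial.T (-1) - 2 : LA) ^ (j:Nat)).coeff (r:Nat) : Int) := by
    intro j r
    rw [show AM m j r = (mu m r : CQ) * rcQ ((r : Nat) : Int) (ej m j) from rfl, map_mul, map_intCast, e, rcQ, PowerSeries.coeff_mk, ← ld_ej m, ← co_zero, ← co_nat]; rfl
  rw [Matrix.det_of_lowerTriangular]
  · rw [Finset.prod_ne_zero_iff]
    intro r _
    rw [RingHom.mapMatrix_apply, Matrix.map_apply, e2, (pol_coeff r).2, mu]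
    split_ifs <;> simp
  · intro i j hij
    rw [RingHom.mapMatrix_apply, Matrix.map_apply, e2, (pol_coeff i).1]
    · simp
    simp_all
lemma det_lim (m : Nat) [NeZero m] : ∃ ε > 0, ∀ᶠ Y : Real in atTop, ε ≤ ‖evq (I * Y) (AM m).det‖ := by
  have h0 : 0 < ‖PowerSeries.coeff 0 (AM m).det.1‖ := norm_pos_iff.2 (det_AM m)
  refine ⟨_, half_pos h0, ?_⟩
  have := (evq_lim (AM m).det).norm
  exact this.eventually_const_le (by linarith)
end Gh
section An
variable {m : Nat} [NeZero m]
def Lo (m : Nat) [NeZero m] (C : Int → Zt m → Complex) (τ : Complex) (x : Zt m → Complex) : Complex := ∑ ll, hh m C ll τ * x ll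
def FT (m : Nat) [NeZero m] (τ : Complex) (x : Zt m → Complex) (ll : Zt m) : Complex :=
  kap m τ * ∑ ll', ZMod.stdAddChar (-(ll * ll')) * x ll'
lemma Lo_FT {k : Int} {C : Int → Zt m → Complex} (hC : IsVV k m C) {τ : Complex} (hτ : 0 < τ.im) (x : Zt m → Complex) :
    Lo m C (-1 / τ) (FT m τ x) = τ ^ k * Lo m C τ x := by
  simp only [Lo, FT, Finset.mul_sum]
  rw [Finset.sum_comm]
  refine Finset.sum_congr rfl fun ll' _ => ?_
  rw [← mul_assoc, ← hC.slaw τ hτ ll', Finset.mul_sum, Finset.sum_mul]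
  grind
lemma FT_even {τ : Complex} {x : Zt m → Complex} (hx : ∀ ll, x (-ll) = x ll) (ll : Zt m) : FT m τ x (-ll) = FT m τ x ll := by
  rw [FT, FT, ← Equiv.sum_comp (Equiv.neg ((Zt m)))]
  simp_all
lemma FT_inj {τ : Complex} (hτ : 0 < τ.im) {x : Zt m → Complex} (h : ∀ ll, FT m τ x ll = 0) : x = 0 := by
  apply (ZMod.dft (N := 2 * m) (E := Complex)).injective
  rw [map_zero]
  funext ll
  have := h ll
  rw [FT, mul_eq_zero, or_iff_right (kap_ne m hτ)] at this
  rw [ZMod.dft_apply, Pi.zero_apply, ← this]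
  exact Finset.sum_congr rfl fun l _ => by rw [smul_eq_mul, mul_comm l]
abbrev Aev (m : Nat) (τ : Complex) : Matrix (Fin (m + 1)) (Fin (m + 1)) Complex := (evq τ).mapMatrix (AM m)
def yv (τ : Complex) (x : Zt m → Complex) (r : Fin (m + 1)) : Complex := ee (-(((r:Nat):Complex) ^ 2 / (4 * m)) * τ) * x ((r:Nat) : Zt m)
lemma Lo_eq {C : Int → Zt m → Complex} {j : Fin (m + 1)} (hC : IsVV (12 * m) m C)
    (hH : ∀ r ≤ m, ∀ τ : Complex, 0 < τ.im → hh m C (r : Nat) τ = ee (-((r:Complex) ^ 2 / (4 * m)) * τ) * evq τ (rcQ ((r:Nat):Int) (ej m j)))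
    {τ : Complex} (hτ : 0 < τ.im) {x : Zt m → Complex} (hx : ∀ ll, x (-ll) = x ll) :
    Lo m C τ x = (Aev m τ).mulVec (yv τ x) j := by
  have hev : ∀ ll, hh m C (-ll) τ = hh m C ll τ := fun ll =>
    tsum_congr fun Δ => by rw [hC.even (by simp [Int.even_mul, show Even (12:Int) by decide])]
  rw [Lo, sum_even m _ (fun ll => by rw [hx, hev]), Finset.sum_range, Matrix.mulVec, dotProduct]
  refine Finset.sum_congr rfl fun r _ => ?_
  rw [hH r (by omega) τ hτ, show (Aev m τ) j r = evq τ ((mu m r : CQ) * rcQ ((r : Nat) : Int) (ej m j)) from rfl, map_mul, map_intCast, zsmul_eq_mul, yv]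
  ring
lemma even_zero {x : Zt m → Complex} (hx : ∀ ll, x (-ll) = x ll) (h : ∀ r ≤ m, x (r : Nat) = 0) : x = 0 := by
  funext ll
  obtain ⟨r, hr, rfl | rfl⟩ := zrep ll
  · simpa using h r hr
  · rw [hx]; simpa using h r hr
lemma det_S {τ : Complex} (hτ : 0 < τ.im) (hd : evq τ (AM m).det ≠ 0) : evq (-1 / τ) (AM m).det ≠ 0 := by
  have hτ' := im_S_pos hτ
  have hinv : -1 / (-1 / τ) = τ := by have := ne_zero_of_im hτ; field_simp
  intro h0
  rw [RingHom.map_det] at h0 hd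
  obtain ⟨y, hy, hy0⟩ := Matrix.exists_mulVec_eq_zero_iff.2 h0
  have hz : ∀ ll : Zt m, (ZMod.valMinAbs ll).natAbs < m + 1 := fun ll => by
    have := ZMod.natAbs_valMinAbs_le ll; omega
  set x : Zt m → Complex := fun ll => ee ((((ZMod.valMinAbs ll).natAbs : Nat) : Complex) ^ 2 / (4 * m) * (-1 / τ)) * y ⟨_, hz ll⟩ with hx
  have hxe : ∀ ll, x (-ll) = x ll := fun ll => by simp only [hx, ZMod.natAbs_valMinAbs_neg]
  have hyv : yv (-1 / τ) x = y := by
    funext r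
    have e : (ZMod.valMinAbs (((r:Nat) : Zt m))).natAbs = r := by
      rw [ZMod.valMinAbs_natCast_of_le_half (by omega)]; simp
    simp only [yv, hx, e]
    rw [← mul_assoc, ← ee_add, neg_mul, neg_add_cancel, ee_zero, one_mul]
  have hF : FT m (-1 / τ) x = 0 := by
    have hfe := FT_even (τ := -1 / τ) hxe
    have hyy : yv τ (FT m (-1 / τ) x) = 0 := by
      refine Matrix.eq_zero_of_mulVec_eq_zero hd ?_
      funext j
      obtain ⟨C, hC, hH⟩ := exists_H m j
      rw [← Lo_eq hC hH hτ hfe]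
      have := Lo_FT hC hτ' x
      rw [hinv] at this
      rw [this, Lo_eq hC hH hτ' hxe, hyv, hy0]; simp
    refine even_zero hfe fun r hr => ?_
    have := congrFun hyy ⟨r, by omega⟩
    rw [yv, Pi.zero_apply, mul_eq_zero, or_iff_right (ee_ne _)] at this
    exact this
  have hx0 := FT_inj hτ' (congrFun hF)
  apply hy
  rw [← hyv, hx0]
  funext r; simp [yv]
lemma kap_bound {Y : Real} (hY : 1 ≤ Y) : ‖kap m (I * Y)‖ ≤ Y := by
  have h1 : ‖kap m (I * Y)‖ ^ 2 = Y / (2 * m) := by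
    rw [← norm_pow, kap_sq]; simp [abs_of_pos (by linarith : 0 < Y)]
  have hm : (1:Real) ≤ m := by exact_mod_cast Nat.one_le_iff_ne_zero.2 (NeZero.ne m)
  have h2 : Y / (2 * m) ≤ Y ^ 2 := by
    rw [div_le_iff₀ (by positivity)]; nlinarith [mul_le_mul hm hY (by positivity) (by positivity)]
  nlinarith
lemma small_tendsto {s : Real} (hs : 0 < s) : Tendsto (fun Y : Real => Y * ‖ee (s * (I * Y))‖) atTop (𝓝 0) := by
  have hc : 0 < 2 * Real.pi * s := by have := Real.pi_pos; positivity
  have h := ((Real.tendsto_pow_mul_exp_neg_atTop_nhds_zero 1).comp (tendsto_id.const_mul_atTop hc)).const_mul (2 * Real.pi * s)⁻¹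
  rw [mul_zero] at h
  refine h.congr fun Y => ?_
  rw [norm_ee]
  simp only [Function.comp_apply, id, pow_one]
  rw [← mul_assoc, inv_mul_cancel_left₀ hc.ne']
  congr 2
  simp; ring
lemma u_small {a : Int → Zt m → Complex} (h : Ob m Complex a) (r : Nat) (w : CQ) (hw : w.1 = (AM m).det.1 * gh m a r) :
    Tendsto (fun Y : Real => Y * ‖ee (((r:Complex) ^ 2 / (4 * m) - m) * (I * Y)) * evq (I * Y) w / evq (I * Y) (AM m).det‖) atTop (𝓝 0) := by
  have hm : (m:Real) ≠ 0 := by exact_mod_cast NeZero.ne m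
  have hm1 : 0 < (m:Int) := by exact_mod_cast Nat.pos_of_ne_zero (NeZero.ne m)
  have hex : ∃ n : Nat, 0 < 4 * (m:Int) * ((n:Int) - m) + (r:Int) ^ 2 := ⟨m + 1, by push_cast; ring_nf; positivity⟩
  set K := Nat.find hex
  have hK := Nat.find_spec hex
  obtain ⟨B, hB⟩ := evq_small w K (fun n hn => by
    rw [hw, PowerSeries.coeff_mul]
    refine Finset.sum_eq_zero fun p hp => ?_
    have hp' := Finset.HasAntidiagonal.mem_antidiagonal.1 hp
    have := Nat.find_min hex (show p.2 < K by omega)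
    rw [gh, PowerSeries.coeff_mk, mul_eq_zero]
    right
    by_contra h0
    exact this (h.pos _ _ h0))
  obtain ⟨ε, hε, hd⟩ := det_lim m
  set s : Real := (4 * (m:Real) * ((K:Real) - m) + (r:Real) ^ 2) / (4 * m) with hs
  have hspos : 0 < s := by
    have : (0:Real) < 4 * (m:Real) * ((K:Real) - m) + (r:Real) ^ 2 := by
      have h5 : 0 < 4 * (m:Int) * ((K:Int) - m) + (r:Int) ^ 2 := hK
      clear_value K; exact_mod_cast h5
    positivity
  have hlim := (small_tendsto hspos).const_mul (B / ε)
  rw [mul_zero] at hlim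
  refine squeeze_zero' ?_ ?_ hlim
  · filter_upwards [eventually_ge_atTop 0] with Y hY
    positivity
  · filter_upwards [eventually_ge_atTop 1, hd] with Y hY hdY
    have h1 := hB (I * Y) (by simpa using hY)
    have e : ‖ee (((r:Complex) ^ 2 / (4 * m) - m) * (I * Y))‖ * ‖ee (I * Y)‖ ^ K = ‖ee (s * (I * Y))‖ := by
      rw [← norm_pow, ← norm_mul, ee_pow, ← ee_add]
      congr 2
      have : (m:Complex) ≠ 0 := by exact_mod_cast NeZero.ne m
      rw [hs]; push_cast; field_simp; ring
    rw [norm_div, norm_mul]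
    calc _ ≤ Y * (‖ee (((r:Complex) ^ 2 / (4 * m) - m) * (I * Y))‖ * (B * ‖ee (I * Y)‖ ^ K) / ε) := by
          gcongr
          exact mul_nonneg (norm_nonneg _) ((norm_nonneg _).trans h1)
      _ = _ := by rw [← e]; ring
end An
section An
variable {m : Nat} [NeZero m]
lemma adj_solve {n : Type*} [Fintype n] [DecidableEq n] {R S : Type*} [CommRing R] [CommRing S] (A : Matrix n n R) (F : n → R) (φ : R →+* S)
    (y : n → S) (c : S) (h : (φ.mapMatrix A).mulVec y = fun j => c * φ (F j)) (r : n) :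
    φ A.det * y r = c * φ (A.adjugate.mulVec F r) := by
  have h1 := congrArg (fun v => (φ.mapMatrix A).adjugate.mulVec v r) h
  simp only [Matrix.mulVec_mulVec, Matrix.adjugate_mul, Matrix.smul_mulVec, Matrix.one_mulVec] at h1
  rw [RingHom.map_det, RingHom.map_mulVec]
  rw [Pi.smul_apply, smul_eq_mul] at h1
  rw [h1, ← RingHom.mapMatrix_apply, ← RingHom.map_adjugate]
  simp only [Matrix.mulVec, dotProduct, Finset.mul_sum, Function.comp_apply]
  grind
lemma Ob.V {a : Int → Zt m → Complex} (h : Ob m Complex a) : ∃ v : Real → Zt m → Complex,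
    (∀ ll, Tendsto (fun Y => v Y ll) atTop (𝓝 0)) ∧ ∀ᶠ Y : Real in atTop, (∀ ll, v Y (-ll) = v Y ll) ∧
      ∀ r ≤ m, ∀ G : CQ, G.1 = gh m a r →
        v Y (r : Nat) = ee (((r:Complex) ^ 2 / (4 * m) - m) * (-1 / (I * Y))) * evq (-1 / (I * Y)) G := by
  choose F hF1 hF2 using h.fhat
  set w := (AM m).adjugate.mulVec F with hw
  have hwg : ∀ r : Fin (m + 1), (w r).1 = (AM m).det.1 * gh m a r := fun r => by
    have := adj_solve (AM m) F CQ.subtype (fun r => gh m a r) 1 (by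
      funext j
      rw [one_mul]
      simp only [Matrix.mulVec, dotProduct, RingHom.mapMatrix_apply, Matrix.map_apply, Subring.subtype_apply]
      exact (hF2 j).symm) r
    simp_all
  have hAw : (AM m).mulVec w = fun j => (AM m).det * F j := by
    rw [hw, Matrix.mulVec_mulVec, Matrix.mul_adjugate, Matrix.smul_mulVec, Matrix.one_mulVec]; rfl
  have hz : ∀ ll : Zt m, (ZMod.valMinAbs ll).natAbs < m + 1 := fun ll => by
    have := ZMod.natAbs_valMinAbs_le ll; omega
  set U : Real → Fin (m + 1) → Complex := fun Y r =>
    ee ((((r:Nat):Complex) ^ 2 / (4 * m) - m) * (I * Y)) * evq (I * Y) (w r) / evq (I * Y) (AM m).det with hU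
  set u : Real → Zt m → Complex := fun Y ll => U Y ⟨_, hz ll⟩ with hu
  have hue : ∀ Y ll, u Y (-ll) = u Y ll := fun Y ll => by simp only [hu, ZMod.natAbs_valMinAbs_neg]
  have hur : ∀ Y (r : Fin (m + 1)), u Y ((r:Nat) : Zt m) = U Y r := fun Y r => by
    have e : (ZMod.valMinAbs (((r:Nat) : Zt m))).natAbs = r := by
      rw [ZMod.valMinAbs_natCast_of_le_half (by omega)]; simp
    simp only [hu, e]
  refine ⟨fun Y => FT m (I * Y) (u Y), fun ll => ?_, ?_⟩
  · have hlim := tendsto_finsetSum (Finset.univ : Finset ((Zt m))) (fun ll' _ => u_small h _ (w ⟨_, hz ll'⟩) (hwg _))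
    rw [Finset.sum_const_zero] at hlim
    refine squeeze_zero_norm' ?_ hlim
    filter_upwards [eventually_ge_atTop 1] with Y hY
    rw [FT, norm_mul]
    refine (mul_le_mul (kap_bound hY) (norm_sum_le _ _) (norm_nonneg _) (by linarith)).trans ?_
    rw [Finset.mul_sum]
    refine Finset.sum_le_sum fun ll' _ => ?_
    rw [norm_mul, AddChar.norm_apply, one_mul]
  · obtain ⟨ε, hε, hd⟩ := det_lim m
    filter_upwards [eventually_ge_atTop 1, hd] with Y hY hdY
    have hτ : 0 < (I * Y : Complex).im := by simp; linarith
    set τ : Complex := I * Y with hτd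
    have hδ : evq τ (AM m).det ≠ 0 := fun h0 => by rw [h0, norm_zero] at hdY; linarith
    have hδ' := det_S hτ hδ
    have hτ' := im_S_pos hτ
    have hve := FT_even (τ := τ) (hue Y)
    refine ⟨hve, fun r hr G hG => ?_⟩
    have hL : (Aev m (-1 / τ)).mulVec (yv (-1 / τ) (FT m τ (u Y))) = fun j => ee (((-m : Int) : Complex) * (-1 / τ)) * evq (-1 / τ) (F j) := by
      funext j
      obtain ⟨C, hC, hH⟩ := exists_H m j
      rw [← Lo_eq hC hH hτ' hve, Lo_FT hC hτ, hF1 j τ hτ, Lo_eq hC hH hτ (hue Y)]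
      congr 1
      have e2 : yv τ (u Y) = fun r => (ee (((-m : Int) : Complex) * τ) / evq τ (AM m).det) * evq τ (w r) := by
        funext r
        rw [yv, hur]
        simp only [hU]
        rw [← hτd, show ee (((-m : Int) : Complex) * τ) = ee (-(((r:Nat):Complex) ^ 2 / (4 * m)) * τ) * ee ((((r:Nat):Complex) ^ 2 / (4 * m) - m) * τ) by
          rw [← ee_add]; congr 1; push_cast; ring]
        ring
      have e3 : (Aev m τ).mulVec (fun r => evq τ (w r)) j = evq τ (AM m).det * evq τ (F j) := by
        have := congrArg (evq τ) (congrFun hAw j)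
        rw [RingHom.map_mulVec, map_mul] at this
        exact this
      rw [e2, show (fun r => (ee (((-m : Int) : Complex) * τ) / evq τ (AM m).det) * evq τ (w r)) =
        (ee (((-m : Int) : Complex) * τ) / evq τ (AM m).det) • (fun r => evq τ (w r)) from rfl, Matrix.mulVec_smul, Pi.smul_apply, e3, smul_eq_mul]
      field_simp
    have h5 := adj_solve (AM m) F (evq (-1 / τ)) _ _ hL ⟨r, by omega⟩
    rw [show (AM m).adjugate.mulVec F ⟨r, by omega⟩ = (AM m).det * G from Subtype.ext (by
      rw [Subring.coe_mul, hG]; exact hwg ⟨r, by omega⟩), map_mul, mul_left_comm] at h5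
    have h6 := mul_left_cancel₀ hδ' h5
    rw [yv] at h6
    have h7 : ee (-((r:Complex) ^ 2 / (4 * m)) * (-1 / τ)) * ee ((r:Complex) ^ 2 / (4 * m) * (-1 / τ)) = 1 := by
      rw [← ee_add, neg_mul, neg_add_cancel, ee_zero]
    have h8 : ee (((r:Complex) ^ 2 / (4 * m) - m) * (-1 / τ)) = ee ((r:Complex) ^ 2 / (4 * m) * (-1 / τ)) * ee (((-m : Int) : Complex) * (-1 / τ)) := by
      rw [← ee_add]; congr 1; push_cast; ring
    grind
lemma Ob.tot {a : Int → Zt m → Complex} (h : Ob m Complex a) (hsq : ∀ D ll, ¬ IsSquare D → a D ll = 0)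
    (hv : ∀ n : Nat, n.Coprime (2 * m) → ∀ ll, a ((n:Int) ^ 2) (n * ll) = a 1 ll) : ∑ ll, a 1 ll = 0 := by
  by_contra ht
  set t := ∑ ll, a 1 ll with htd
  have hm : (m:Complex) ≠ 0 := by exact_mod_cast NeZero.ne m
  have hm' : (m:Int) ≠ 0 := by exact_mod_cast NeZero.ne m
  have hmr : (0:Real) < m := by exact_mod_cast Nat.pos_of_ne_zero (NeZero.ne m)
  set vl : Zt m → Prop := fun ll => ∃ l : Int, (l : Zt m) = ll ∧ 4 * (m:Int) ∣ l ^ 2 - 1 with hvl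
  set gd : Int → Prop := fun D => IsSquare D ∧ 4 * (m:Int) ∣ D - 1 with hgd
  have hcop : ∀ k : Nat, 4 * (m:Int) ∣ (k:Int) ^ 2 - 1 → k.Coprime (2 * m) := fun k hk => by
    rw [← Nat.isCoprime_iff_coprime]
    obtain ⟨c, hc⟩ := hk
    exact ⟨k, -2 * c, by push_cast; linear_combination hc⟩
  have habs : ∀ D : Int, IsSquare D → ∃ k : Nat, D = (k:Int) ^ 2 := fun D ⟨k, hk⟩ => ⟨k.natAbs, by rw [hk, Int.natAbs_sq, sq]⟩
  -- the value at a unit square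
  have hval : ∀ k : Nat, k.Coprime (2 * m) → ∀ ll, a ((k:Int) ^ 2) ll = a 1 ((k : Zt m)⁻¹ * ll) := fun k hk ll => by
    rw [← hv k hk, ← mul_assoc, ZMod.coe_mul_inv_eq_one _ hk, one_mul]
  have hs : ∀ D, ∑ ll with vl ll, a D ll = t * (if gd D then 1 else 0) := by
    intro D
    split_ifs with hD
    · obtain ⟨k, rfl⟩ := habs D hD.1
      have hk := hcop k hD.2
      rw [mul_one, Finset.sum_filter_of_ne]
      · simp only [hval k hk]
        rw [htd]
        exact Equiv.sum_comp (ZMod.unitOfCoprime k hk)⁻¹.mulLeft (fun ll => a 1 ll)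
      · intro ll _ h0
        obtain ⟨l, rfl⟩ := ZMod.intCast_surjective ll
        exact ⟨l, rfl, by
          have := h.val _ _ h0
          have h2 := dvd_sub hD.2 this
          rwa [sub_sub_sub_cancel_left] at h2⟩
    · rw [mul_zero]
      refine Finset.sum_eq_zero fun ll hll => ?_
      obtain ⟨l, rfl, hl⟩ := (Finset.mem_filter.1 hll).2
      by_contra h0
      refine hD ⟨by by_contra h1; exact h0 (hsq _ _ h1), ?_⟩
      have h2 := dvd_add (h.val _ _ h0) hl
      grind
  obtain ⟨v, hv0, hvY⟩ := h.V
  -- expansions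
  have hexp : ∀ᶠ Y : Real in atTop, ∀ ll, vl ll → HasSum (fun D : Int => a D ll * ee (D / (4 * m) * (-1 / (I * Y)))) (v Y ll) := by
    filter_upwards [hvY, eventually_gt_atTop 0] with Y ⟨h1, h2⟩ hY
    have hτ : 0 < (-1 / (I * Y) : Complex).im := im_S_pos (by simpa using hY)
    set τ : Complex := -1 / (I * Y)
    have key : ∀ r : Nat, r ≤ m → vl (r : Nat) → HasSum (fun D : Int => a D (r:Nat) * ee (D / (4 * m) * τ)) (v Y (r:Nat)) := by
      intro r hr ⟨l, hl, hl2⟩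
      have hr2 : 4 * (m:Int) ∣ (r:Int) ^ 2 - 1 := by
        have := sq_congr m (a := r) (b := l) (by rw [hl]; simp)
        have h2 := dvd_add this hl2
        grind
      have hG : gh m a r ∈ CQ := by
        intro _ ρ hρ0 hρ1
        have hb : ∀ D, ‖a D (r:Int)‖ ≤ ∑ ll, ‖a 1 ll‖ := fun D => by
          by_cases h0 : a D (r:Int) = 0
          · rw [h0, norm_zero]; exact Finset.sum_nonneg fun _ _ => norm_nonneg _
          · obtain ⟨k, rfl⟩ := habs D (by by_contra h1; exact h0 (hsq _ _ h1))
            have h4 := dvd_add (h.val _ _ h0) hr2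
            rw [hval k (hcop k (by rwa [sub_add_sub_cancel] at h4))]
            exact Finset.single_le_sum (f := fun ll => ‖a 1 ll‖) (fun _ _ => norm_nonneg _) (Finset.mem_univ _)
        refine Summable.of_nonneg_of_le (fun n => by positivity) (fun n => ?_) ((summable_geometric_of_lt_one hρ0 hρ1).mul_left (∑ ll, ‖a 1 ll‖))
        gcongr
        rw [gh, PowerSeries.coeff_mk]
        exact hb _
      rw [h2 r hr ⟨_, hG⟩ rfl]
      have hS := (evq_hasSum ⟨_, hG⟩ hτ).mul_left (ee (((r:Complex) ^ 2 / (4 * m) - m) * τ))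
      have hinj : Function.Injective fun n : Nat => 4 * (m:Int) * ((n:Int) - m) + (r:Int) ^ 2 := fun x y hxy => by
        simpa [hm', NeZero.ne m] using hxy
      refine (hinj.hasSum_iff (fun p hp => ?_)).1 (Eq.mp (congrArg (fun f => HasSum f _) (funext fun p => ?_)) hS)
      · by_contra h0
        have h3 : a p ((r:Int) : Zt m) ≠ 0 := fun h3 => h0 (by rw [Int.cast_natCast] at h3; rw [h3, zero_mul])
        obtain ⟨n, hn⟩ := h.val _ _ h3
        have h4 := h.pos _ _ h3
        have h5 : ¬ n < -m := fun h5 => by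
          have := neg_ind hr h5
          linarith
        exact hp ⟨(n + m).toNat, by
          simp only [Int.toNat_of_nonneg (show 0 ≤ n + m by omega)]
          linarith⟩
      · simp only [Function.comp_apply, gh, PowerSeries.coeff_mk, Int.cast_natCast]
        rw [mul_left_comm, ← ee_add]
        congr 2
        push_cast; field_simp; ring
    intro ll hll
    obtain ⟨r, hr, rfl | rfl⟩ := zrep ll
    · rw [Int.cast_natCast] at hll ⊢
      exact key r hr hll
    · rw [Int.cast_natCast] at hll ⊢
      rw [h1]
      simp only [h.even]
      refine key r hr ?_
      obtain ⟨l, hl, hl2⟩ := hll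
      exact ⟨-l, by rw [Int.cast_neg, hl, neg_neg], by rwa [neg_sq]⟩
  have hlim : Tendsto (fun Y : Real => ‖(∑ ll with vl ll, v Y ll) / t‖) atTop (𝓝 0) := by
    have := ((tendsto_finsetSum (Finset.univ.filter vl) (fun ll _ => hv0 ll)).div_const t).norm
    simpa using this
  have hlow : ∀ᶠ Y : Real in atTop, Real.exp (-(2 * Real.pi * (1 / (4 * m)))) ≤ ‖(∑ ll with vl ll, v Y ll) / t‖ := by
    filter_upwards [hexp, eventually_ge_atTop 1] with Y hY hY1
    have h1 := (hasSum_sum (s := Finset.univ.filter vl) fun ll hll => hY ll (Finset.mem_filter.1 hll).2).div_const t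
    simp only [← Finset.sum_mul, hs] at h1
    have h2 : HasSum (fun D : Int => (if gd D then (1:Real) else 0) * Real.exp (-(2 * Real.pi * (D / (4 * m) * (1 / Y)))))
        ((∑ ll with vl ll, v Y ll) / t).re := by
      have h3 := Complex.hasSum_re h1
      refine Eq.mp (congrArg (fun f => HasSum f _) (funext fun D => ?_)) h3
      have e : ee (D / (4 * m) * (-1 / (I * Y))) = (Real.exp (-(2 * Real.pi * (D / (4 * m) * (1 / Y)))) : Real) := by
        have hY0 : (Y:Complex) ≠ 0 := by exact_mod_cast (by linarith : Y ≠ 0)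
        rw [ee, Complex.ofReal_exp]
        congr 1
        push_cast
        field_simp
      rw [e]
      split_ifs
      · rw [mul_one, mul_div_cancel_left₀ _ ht, ofReal_re, one_mul]
      · simp
    have h4 := le_hasSum h2 1 (fun _ _ => by positivity)
    rw [if_pos ⟨⟨1, by norm_num⟩, by simp⟩, one_mul] at h4
    refine le_trans ?_ (h4.trans (Complex.re_le_norm _))
    rw [Real.exp_le_exp]
    have := Real.pi_pos
    push_cast
    rw [neg_le_neg_iff]
    gcongr
    have : 1 / Y ≤ 1 := by rw [div_le_one (by linarith)]; exact hY1
    calc _ ≤ 1 / (4 * (m:Real)) * 1 := by gcongr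
      _ = _ := mul_one _
  have := ge_of_tendsto hlim hlow
  linarith [Real.exp_pos (-(2 * Real.pi * (1 / (4 * (m:Real)))))]
end An
section Du
variable {m : Nat} [NeZero m]
lemma Ob.totQ {a : Int → Zt m → ℚ} (h : Ob m ℚ a) : ∑ ll, a 1 ll = 0 := by
  obtain ⟨a', h', hs, c, hc, e⟩ := h.purify
  have := Ob.tot (h'.map (Rat.castHom Complex).toAddMonoidHom) (fun D ll hD => by simp [hs D ll hD])
    (fun n hn ll => by rw [h'.sq_val n hn ll])
  have h2 : ((∑ ll, a' 1 ll : ℚ) : Complex) = 0 := by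
    rw [← this]; push_cast; rfl
  rw [Rat.cast_eq_zero] at h2
  simp only [e, ← Finset.mul_sum] at h2
  grind
def Vd (m : Nat) (D : Int) (ll : Zt m) : Prop := ∃ l : Int, (l : Zt m) = ll ∧ (4 * (m:Int)) ∣ D - l ^ 2
lemma Vd_int {D l : Int} : Vd m D (l : Zt m) ↔ (4 * (m:Int)) ∣ D - l ^ 2 := by
  refine ⟨fun ⟨k, hk, h⟩ => ?_, fun h => ⟨l, rfl, h⟩⟩
  have h2 := dvd_add h (sq_congr m hk)
  grind
lemma Vd_neg {D : Int} {ll : Zt m} : Vd m D (-ll) ↔ Vd m D ll := by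
  obtain ⟨l, rfl⟩ := ZMod.intCast_surjective ll
  rw [← Int.cast_neg, Vd_int, Vd_int, neg_sq]
lemma PreVV.vd {C : Int → Zt m → Complex} (h : PreVV m C) {D : Int} {ll : Zt m} (hc : C (-D) ll ≠ 0) : Vd m D ll := by
  obtain ⟨l, rfl⟩ := ZMod.intCast_surjective ll
  rw [Vd_int]
  obtain ⟨k, hk⟩ := h.supp _ _ hc
  exact ⟨-k, by linear_combination -hk⟩
def ppf (c : Int → Zt m → Int) (x : Zt m × Int) : ℚ := if 0 < x.2 then (c (-x.2) x.1 : ℚ) else 0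
lemma ppf_fin {c : Int → Zt m → Int} (h : IntVV m 2 c) : (Function.support (ppf c)).Finite := by
  obtain ⟨B, hB⟩ := h.bdd
  refine (Set.finite_univ.prod (Set.finite_Icc 0 B)).subset fun x hx => ?_
  rw [Function.mem_support, ppf] at hx
  have h0 : 0 < x.2 := by by_contra h0; exact hx (if_neg h0)
  refine ⟨trivial, h0.le, ?_⟩
  by_contra hn
  simp_all
def Wp (m : Nat) [NeZero m] : Submodule ℚ (((Zt m) × Int) →₀ ℚ) :=
  Submodule.span ℚ {w | ∃ c, IntVV m 2 c ∧ ⇑w = ppf c}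
def wx (m : Nat) [NeZero m] : ((Zt m) × Int) →₀ ℚ :=
  ∑ ll : Zt m, if Vd m 1 ll then Finsupp.single (ll, 1) 1 else 0
lemma wx_mem : wx m ∈ Wp m := by
  by_contra hx
  obtain ⟨f, hf, hW⟩ := Submodule.exists_le_ker_of_notMem hx
  set b : Zt m × Int → ℚ := fun x => f (Finsupp.single x 1) with hb
  have hO : Ob m ℚ (fun D ll => if 0 < D ∧ Vd m D ll then b (ll, D) + b (-ll, D) else 0) := by
    refine ⟨fun D ll h => ?_, fun D l h => ?_, fun D ll => ?_, fun c hc => ?_⟩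
    · grind
    · rw [← Vd_int]; by_contra h0; exact h (if_neg fun h1 => h0 h1.2)
    · simp only [Vd_neg, neg_neg, add_comm]
    · set g : Zt m × Int → ℚ := fun x => ppf c x * b x with hg
      have hgf : (Function.support g).Finite := (ppf_fin hc).subset (Function.support_mul_subset_left _ _)
      let e : Zt m × Int ≃ Zt m × Int := (Equiv.neg _).prodCongr (Equiv.refl _)
      have h1 : pr c (fun D ll => if 0 < D ∧ Vd m D ll then b (ll, D) + b (-ll, D) else 0) = ∑ᶠ x, (g x + g (e x)) := by
        refine finsum_congr fun x => ?_
        obtain ⟨ll, D⟩ := x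
        have he : e (ll, D) = (-ll, D) := rfl
        rw [he]
        simp only [hg, ppf, hc.even, zsmul_eq_mul]
        by_cases hD : 0 < D
        · by_cases hc0 : c (-D) ll = 0
          · simp [hc0]
          · have : Vd m D ll := PreVV.vd (IsVV.toPreVV hc) (by exact_mod_cast hc0)
            grind
        · simp [hD]
      have h2 : ∑ᶠ x, g x = 0 := by
        let w : ((Zt m) × Int) →₀ ℚ := Finsupp.ofSupportFinite (ppf c) (ppf_fin hc)
        have hw : f w = 0 := hW (Submodule.subset_span ⟨c, hc, rfl⟩)
        nth_rewrite 1 [← Finsupp.sum_single w] at hw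
        rw [Finsupp.sum, map_sum] at hw
        rw [← hw, finsum_eq_sum_of_support_subset (s := w.support)]
        · refine Finset.sum_congr rfl fun x _ => ?_
          rw [← mul_one (w x), ← smul_eq_mul (w x) 1, ← Finsupp.smul_single, map_smul]
          rfl
        · intro x hx
          rw [Finset.mem_coe, Finsupp.mem_support_iff]
          exact fun h0 => hx (by show ppf c x * b x = 0; rw [show ppf c x = 0 from h0, zero_mul])
      rw [h1, finsum_add_distrib hgf (hgf.preimage e.injective.injOn), finsum_comp_equiv e (f := g), h2, add_zero]
  have ht := hO.totQ
  have hfx : f (wx m) = ∑ ll : Zt m, if Vd m 1 ll then b (ll, 1) else 0 := by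
    rw [wx, map_sum]
    grind
  have h2 : ∑ ll : Zt m, (if Vd m 1 ll then b (-ll, 1) else 0) = f (wx m) := by
    rw [hfx, ← Equiv.sum_comp (Equiv.neg _)]
    refine Finset.sum_congr rfl fun ll _ => ?_
    rw [Equiv.neg_apply, Vd_neg, neg_neg]
  apply hf
  have h3 : f (wx m) + f (wx m) = 0 := by
    nth_rewrite 1 [hfx]
    rw [← h2, ← Finset.sum_add_distrib]
    grind
  linarith
lemma Wp_real {w : ((Zt m) × Int) →₀ ℚ} (h : w ∈ Wp m) :
    ∃ C, IsVV 2 m C ∧ ∀ D : Int, 0 < D → ∀ ll, C (-D) ll = (w (ll, D) : Complex) := by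
  induction h using Submodule.span_induction with
  | mem w hw =>
    obtain ⟨c, hc, e⟩ := hw
    exact ⟨_, hc, fun D hD ll => by simp [e, ppf, hD]⟩
  | zero => exact ⟨_, isVV_zero 2 m, fun D _ ll => by simp⟩
  | add x y _ _ hx hy =>
    obtain ⟨C, h1, h2⟩ := hx
    obtain ⟨C', h1', h2'⟩ := hy
    exact ⟨_, h1.add h1', fun D hD ll => by simp [h2 D hD, h2' D hD]⟩
  | smul q x _ hx =>
    obtain ⟨C, h1, h2⟩ := hx
    exact ⟨_, h1.smul (q:Complex), fun D hD ll => by simp [h2 D hD]⟩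
lemma exists_polar (m : Nat) [NeZero m] : ∃ C : Int → Zt m → Complex, IsVV 2 m C ∧ (∀ Δ ll, Δ < -1 → C Δ ll = 0) ∧
    ∀ ll, Vd m 1 ll → C (-1) ll = 1 := by
  obtain ⟨C, h1, h2⟩ := Wp_real (wx_mem (m := m))
  have hw : ∀ D ll, wx m (ll, D) = if D = 1 ∧ Vd m 1 ll then 1 else 0 := by
    intro D ll
    rw [wx, Finsupp.finsetSum_apply, Finset.sum_eq_single ll]
    · grind
    · grind
    · simp
  refine ⟨C, h1, fun Δ ll hΔ => ?_, fun ll hll => ?_⟩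
  · have := h2 (-Δ) (by linarith) ll
    rw [neg_neg] at this
    rw [this, hw, if_neg (fun h => by linarith [h.1]), Rat.cast_zero]
  simp_all
end Du
section Fin
variable {m : Nat} [NeZero m]
lemma sum_t {t q : Nat} (htq : t * q = 2 * m) (F : Zt m → Complex) :
    ∑ s ∈ Finset.range q, F (s * t) = ∑ x with (q : Zt m) * x = 0, F x := by
  have hm : 0 < 2 * m := by have := NeZero.pos m; omega
  have ht : 0 < t := Nat.pos_of_ne_zero fun h => by rw [h, zero_mul] at htq; omega
  have hq : 0 < q := Nat.pos_of_ne_zero fun h => by rw [h, mul_zero] at htq; omega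
  have hlt : ∀ s, s < q → s * t < 2 * m := fun s hs => by rw [← htq, mul_comm]; gcongr
  refine Finset.sum_nbij (fun s => (s : Zt m) * t) (fun s _ => ?_) (fun s hs s' hs' e => ?_) (fun x hx => ?_) (fun _ _ => rfl)
  · rw [Finset.mem_filter]
    refine ⟨Finset.mem_univ _, ?_⟩
    have : ((t * q : Nat) : Zt m) = 0 := by rw [htq]; exact ZMod.natCast_self _
    grind
  · rw [Finset.coe_range, Set.mem_Iio] at hs hs'
    have e2 : ((s * t : Nat) : Zt m) = ((s' * t : Nat) : Zt m) := by push_cast; exact e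
    rw [ZMod.natCast_eq_natCast_iff', Nat.mod_eq_of_lt (hlt s hs), Nat.mod_eq_of_lt (hlt s' hs')] at e2
    nlinarith
  · rw [Finset.mem_coe, Finset.mem_filter] at hx
    have h1 : ((q * x.val : Nat) : Zt m) = 0 := by push_cast; rw [ZMod.natCast_zmod_val]; exact hx.2
    rw [ZMod.natCast_eq_zero_iff] at h1
    obtain ⟨k, hk⟩ := h1
    have h2 : x.val = t * k := Nat.eq_of_mul_eq_mul_left hq (by rw [hk]; nth_rewrite 1 [← htq]; ring)
    refine ⟨k, ?_, ?_⟩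
    · rw [Finset.coe_range, Set.mem_Iio]
      have := x.val_lt
      nlinarith
    · beta_reduce
      rw [← ZMod.natCast_zmod_val x, h2]; push_cast; exact mul_comm _ _
def Pq (m : Nat) [NeZero m] (q : Nat) (C : Int → Zt m → Complex) : Prop := ∀ Δ ll,
  ((2 * m / q : Nat) : Zt m) * ll = 0 → ∑ x with (q : Zt m) * x = 0, C Δ (ll + x) = 0
lemma tq {q : Nat} (hq : q ^ 2 ∣ m) : 2 * m / q * q = 2 * m :=
  Nat.div_mul_cancel (((dvd_pow_self q two_ne_zero).trans hq).trans (dvd_mul_left _ _))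
lemma Vd_sq {ll : Zt m} (h : Vd m 1 ll) : ll * ll = 1 := by
  obtain ⟨l, rfl, h⟩ := h
  have : ((1 - l ^ 2 : Int) : Zt m) = 0 := (zmod_dvd_iff m _).2 (dvd_trans ⟨2, by ring⟩ h)
  grind
lemma Vd_mul {ll ll' : Zt m} (h : Vd m 1 ll) (h' : Vd m 1 ll') : Vd m 1 (ll * ll') := by
  obtain ⟨l, rfl, k, hk⟩ := h
  obtain ⟨l', rfl, k', hk'⟩ := h'
  exact ⟨l * l', by push_cast; rfl, k + l ^ 2 * k', by linear_combination hk + l ^ 2 * hk'⟩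
structure Good (m : Nat) [NeZero m] (C : Int → Zt m → Complex) : Prop where
  vv : IsVV 2 m C
  og : ∀ Δ ll, Δ < -1 → C Δ ll = 0
  one : ∀ ll, Vd m 1 ll → C (-1) ll = 1
lemma killt {q x t : Zt m} {w : Nat} (ht : t = w * q) (hx : q * x = 0) (ll : Zt m) (h : t * ll = 0) : t * (ll + x) = 0 := by
  grind
lemma Good.step {C : Int → Zt m → Complex} (h : Good m C) {q : Nat} (hp : q.Prime) (hqm : q ^ 2 ∣ m) :
    ∃ C', Good m C' ∧ Pq m q C' ∧ ∀ p : Nat, p.Prime → p ^ 2 ∣ m → Pq m p C → Pq m p C' := by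
  set t := 2 * m / q with htd
  have htq : t * q = 2 * m := tq hqm
  have hA : ∀ Δ ll, Aq m t q C Δ ll = if (t : Zt m) * ll = 0 then ∑ x with (q : Zt m) * x = 0, C Δ (ll + x) else 0 := by
    intro Δ ll; rw [Aq, sum_t htq (fun x => C Δ (ll + x))]
  have hq0 : (q : Complex) ≠ 0 := by exact_mod_cast hp.ne_zero
  have key : ∀ p : Nat, p.Prime → p ^ 2 ∣ m → ∀ x, (p : Zt m) * x = 0 → ∀ ll, (t : Zt m) * (ll + x) = 0 ↔ (t : Zt m) * ll = 0 := by
    intro p hpp hpm x hx ll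
    have hd : ∃ w, t = w * p := by
      have h1 : p * q ∣ 2 * m := by
        by_cases e : p = q
        · rw [e, ← sq]; exact hqm.trans (dvd_mul_left _ _)
        · exact (((Nat.coprime_primes hpp hp).2 e).mul_dvd_of_dvd_of_dvd ((dvd_pow_self p two_ne_zero).trans hpm)
            ((dvd_pow_self q two_ne_zero).trans hqm)).trans (dvd_mul_left _ _)
      obtain ⟨w, hw⟩ := h1
      exact ⟨w, Nat.eq_of_mul_eq_mul_right hp.pos (by rw [htq, hw]; ring)⟩
    obtain ⟨w, hw⟩ := hd
    rw [mul_add, hw]; push_cast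
    grind
  refine ⟨fun Δ ll => C Δ ll + (-(q:Complex)⁻¹) * Aq m t q C Δ ll, ⟨h.vv.add ((h.vv.Aq hp.pos htq hqm).smul _), fun Δ ll hΔ => ?_, fun ll hll => ?_⟩, ?_, ?_⟩
  · simp [hA, h.og _ _ hΔ]
  · rw [hA, if_neg, mul_zero, add_zero, h.one ll hll]
    intro h0
    have h1 : (t : Zt m) = 0 := by linear_combination ll * h0 - t * Vd_sq hll
    rw [ZMod.natCast_eq_zero_iff] at h1
    have hm := NeZero.pos m
    have ht : 0 < t := Nat.pos_of_ne_zero fun h => by rw [h, zero_mul] at htq; omega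
    have := Nat.le_of_dvd ht h1
    have := hp.two_le
    nlinarith
  · intro Δ ll hll
    rw [Finset.sum_add_distrib, ← Finset.mul_sum]
    have : ∀ x ∈ Finset.univ.filter (fun x => (q : Zt m) * x = 0), Aq m t q C Δ (ll + x) =
        ∑ x with (q : Zt m) * x = 0, C Δ (ll + x) := by
      intro x hx
      rw [Finset.mem_filter] at hx
      rw [hA, if_pos ((key q hp hqm x hx.2 ll).2 hll)]
      refine Finset.sum_nbij' (fun y => x + y) (fun y => y - x) ?_ ?_ ?_ ?_ ?_
      · grind
      · grind
      · intro y _; ring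
      · intro y _; ring
      · intro y _; rw [add_assoc]
    rw [Finset.sum_congr rfl this, Finset.sum_const]
    have hc : (Finset.univ.filter (fun x => (q : Zt m) * x = 0)).card = q := by
      have := sum_t htq (fun _ => (1:Complex))
      simp only [Finset.sum_const, Finset.card_range, nsmul_eq_mul, mul_one] at this
      exact_mod_cast this.symm
    grind
  · intro p hpp hpm hC Δ ll hll
    rw [Finset.sum_add_distrib, hC Δ ll hll, zero_add, ← Finset.mul_sum]
    refine mul_eq_zero_of_right _ ?_
    by_cases h0 : (t : Zt m) * ll = 0
    · have : ∀ x ∈ Finset.univ.filter (fun x => (p : Zt m) * x = 0), Aq m t q C Δ (ll + x) =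
          ∑ y with (q : Zt m) * y = 0, C Δ (ll + y + x) := by
        grind
      rw [Finset.sum_congr rfl this, Finset.sum_comm]
      refine Finset.sum_eq_zero fun y hy => hC Δ _ ?_
      rw [Finset.mem_filter] at hy
      have hd : p * q ∣ 2 * m := by
        by_cases e : p = q
        · rw [e, ← sq]; exact hqm.trans (dvd_mul_left _ _)
        · exact (((Nat.coprime_primes hpp hp).2 e).mul_dvd_of_dvd_of_dvd ((dvd_pow_self p two_ne_zero).trans hpm)
            ((dvd_pow_self q two_ne_zero).trans hqm)).trans (dvd_mul_left _ _)
      obtain ⟨w, hw⟩ := hd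
      have h5 : 2 * m / p = w * q := by
        apply Nat.eq_of_mul_eq_mul_right hpp.pos
        rw [tq hpm, hw]; ring
      exact killt (w := w) (by rw [h5]; push_cast; rfl) hy.2 ll hll
    · refine Finset.sum_eq_zero fun x hx => ?_
      grind
lemma exists_prim (m : Nat) [NeZero m] (S : Finset Nat) (hS : ∀ q ∈ S, q.Prime ∧ q ^ 2 ∣ m) : ∃ C, Good m C ∧ ∀ q ∈ S, Pq m q C := by
  induction S using Finset.induction_on with
  | empty =>
    obtain ⟨C, h1, h2, h3⟩ := exists_polar m
    exact ⟨C, ⟨h1, h2, h3⟩, by simp⟩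
  | insert p S _ ih =>
    obtain ⟨C, h1, h2⟩ := ih fun q hq => hS q (Finset.mem_insert_of_mem hq)
    have hp := hS p (Finset.mem_insert_self p S)
    obtain ⟨C', h3, h4, h5⟩ := h1.step hp.1 hp.2
    refine ⟨C', h3, fun q hq => ?_⟩
    rcases Finset.mem_insert.1 hq with rfl | hq'
    · exact h4
    · exact h5 q (hS q hq).1 (hS q hq).2 (h2 q hq')
lemma exists_K (m : Nat) [NeZero m] : ∃ C, Good m C ∧ (∀ q : Nat, q.Prime → q ^ 2 ∣ m → Pq m q C) ∧
    ∀ ξ, Vd m 1 ξ → ∀ Δ ll, C Δ (ξ * ll) = C Δ ll := by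
  obtain ⟨C, h1, h2⟩ := exists_prim m ((Finset.range (m + 1)).filter fun q => q.Prime ∧ q ^ 2 ∣ m) (by simp)
  set G := Finset.univ.filter (fun ξ : Zt m => Vd m 1 ξ) with hG
  have hGm : ∀ ξ, ξ ∈ G ↔ Vd m 1 ξ := by simp [hG]
  have h1G : Vd m 1 (1 : Zt m) := ⟨1, by simp, by norm_num⟩
  have hN : (G.card : Complex) ≠ 0 := by
    rw [Nat.cast_ne_zero, Finset.card_ne_zero]; exact ⟨1, (hGm 1).2 h1G⟩
  refine ⟨fun Δ ll => (G.card : Complex)⁻¹ * ∑ ξ ∈ G, C Δ (ξ * ll), ⟨(IsVV.sum G (fun ξ Δ ll => C Δ (ξ * ll)) ?_).smul _, ?_, ?_⟩, ?_, ?_⟩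
  · intro ξ hξ
    obtain ⟨l, rfl, k, hk⟩ := (hGm ξ).1 hξ
    exact h1.vv.W l ⟨-k, by linear_combination -hk⟩
  · intro Δ ll hΔ
    simp [h1.og _ _ hΔ]
  · intro ll hll
    rw [Finset.sum_congr rfl fun ξ hξ => h1.one _ (Vd_mul ((hGm ξ).1 hξ) hll), Finset.sum_const, nsmul_eq_mul, mul_one, inv_mul_cancel₀ hN]
  · intro q hq hqm Δ ll hll
    rw [← Finset.mul_sum, Finset.sum_comm]
    refine mul_eq_zero_of_right _ (Finset.sum_eq_zero fun ξ hξ => ?_)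
    have hs := Vd_sq ((hGm ξ).1 hξ)
    have hqS : q ∈ (Finset.range (m + 1)).filter fun q => q.Prime ∧ q ^ 2 ∣ m := by
      rw [Finset.mem_filter, Finset.mem_range]
      refine ⟨Nat.lt_succ_of_le (Nat.le_of_dvd (NeZero.pos m) ((dvd_pow_self q two_ne_zero).trans hqm)), hq, hqm⟩
    rw [← h2 q hqS Δ (ξ * ll) (by linear_combination ξ * hll)]
    refine Finset.sum_nbij' (fun y => ξ * y) (fun y => ξ * y) ?_ ?_ ?_ ?_ ?_
    · grind
    · grind
    · grind
    · grind
    · intro y _; rw [mul_add]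
  · intro ξ hξ Δ ll
    have hs := Vd_sq hξ
    refine congrArg _ ?_
    refine Finset.sum_nbij' (fun y => y * ξ) (fun y => y * ξ) ?_ ?_ ?_ ?_ ?_
    · intro y hy; rw [hGm] at hy ⊢; exact Vd_mul hy hξ
    · intro y hy; rw [hGm] at hy ⊢; exact Vd_mul hy hξ
    · grind
    · grind
    · intro y _; rw [mul_assoc]
end Fin

/-- Theorem: for every `m ≥ 1` there exists a weak Jacobi form `K_m` of weight 2 and index
`m` with optimal growth, with polar coefficients `C(-1,r) = 1` for `r² ≡ 1 (mod 4m)`,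
`n = 0` coefficients `y - 2 + y^{-1}`, invariant under all Atkin–Lehner involutions and
primitive; it is not holomorphic, and every weak Jacobi form of weight 2 and index `m` with
optimal growth differs from a unique multiple of `K_m` by a holomorphic Jacobi form. -/
theorem exists_Km (m : ℕ) (hm : 0 < m) :
    ∃ K : EllFormData m, ModularLaw 2 m K.toFun ∧ IsWeakC m K.coeff ∧
      (∀ Δ l : ℤ, Δ < -1 → K.coeff Δ l = 0) ∧
      (∀ r : ℤ, (4 * (m : ℤ)) ∣ (r ^ 2 - 1) → K.coeff (-1) r = 1) ∧
      (K.coeff 0 0 = -2 ∧ K.coeff (-1) 1 = 1 ∧ K.coeff (-1) (-1) = 1 ∧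
        ∀ r : ℤ, 2 ≤ |r| → K.coeff (-(r ^ 2)) r = 0) ∧
      (∀ a b : ℕ, m = a * b → Nat.Coprime a b → ∀ Δ l ls : ℤ,
        (2 * (a : ℤ)) ∣ (ls + l) → (2 * (b : ℤ)) ∣ (ls - l) → K.coeff Δ ls = K.coeff Δ l) ∧
      (∀ q : ℕ, q.Prime → q ^ 2 ∣ m → ∀ Δ l : ℤ,
        ∑ j ∈ Finset.range q,
          K.coeff (Δ * (q : ℤ) ^ 2) ((l + 2 * (m : ℤ) / (q : ℤ) ^ 2 * (j : ℤ)) * (q : ℤ)) = 0) ∧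
      ¬ IsHolC K.coeff ∧
      (∀ φ : EllFormData m, ModularLaw 2 m φ.toFun → IsWeakC m φ.coeff →
        (∀ Δ l : ℤ, Δ < -1 → φ.coeff Δ l = 0) →
        ∃! lam : ℂ, ∀ Δ l : ℤ, Δ < 0 → φ.coeff Δ l = lam * K.coeff Δ l) := by
  haveI : NeZero m := ⟨hm.ne'⟩
  obtain ⟨C, hG, hP, hW⟩ := exists_K m
  have hv : ∀ r : Int, (4 * (m : Int)) ∣ (r ^ 2 - 1) → Vd m 1 (r : Zt m) := by
    rintro r ⟨k, hk⟩
    exact ⟨r, rfl, -k, by linear_combination -hk⟩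
  have hc : ∀ r : Int, (4 * (m : Int)) ∣ (r ^ 2 - 1) → C (-1) r = 1 := fun r hr => hG.one _ (hv r hr)
  have c1 : C (-1) 1 = 1 := by simpa using hc 1 (by norm_num)
  have c2 : C (-1) (-1) = 1 := by simpa using hc (-1) (by norm_num)
  have c0 : C 0 0 = -2 := by
    have := hG.vv.ct hG.og
    grind
  have hmz : (1:Int) ≤ m := by exact_mod_cast hm
  refine ⟨hG.vv.toPreVV.toEll, hG.vv.modular, fun n r hn => ?_, fun Δ l h => hG.og Δ _ h, hc, ⟨?_, ?_, ?_, fun r hr => ?_⟩, ?_, ?_, ?_, ?_⟩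
  · exact hG.og _ _ (by nlinarith [sq_nonneg r])
  · simpa [PreVV.toEll] using c0
  · simpa [PreVV.toEll] using c1
  · simpa [PreVV.toEll] using c2
  · exact hG.og _ _ (by nlinarith [sq_abs r])
  · rintro a b rfl hab Δ l ls ⟨x, hx⟩ ⟨y, hy⟩
    have hb : (a:Int) * a.gcdA b + b * a.gcdB b = 1 := by
      rw [← Nat.gcd_eq_gcd_ab, hab]; rfl
    set u := a.gcdA b
    set v := a.gcdB b
    show C Δ ls = C Δ l
    rw [← hW _ (hv (1 - 2 * v * b) ⟨-(u * v), by push_cast; linear_combination (4 * v * b) * hb⟩) Δ l]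
    congr 1
    rw [← sub_eq_zero, ← Int.cast_mul, ← Int.cast_sub, zmod_dvd_iff]
    refine ⟨u * (y + v * l) + v * (x - u * l), ?_⟩
    grind
  · intro q hq hqm Δ l
    obtain ⟨w, hw⟩ := hqm
    have hq0 : (q:Int) ≠ 0 := by exact_mod_cast hq.ne_zero
    have e1 : 2 * (m:Int) / (q:Int) ^ 2 = 2 * w := by
      rw [hw]; push_cast
      rw [show 2 * ((q:Int) ^ 2 * w) = 2 * w * q ^ 2 by ring, Int.mul_ediv_cancel _ (pow_ne_zero 2 hq0)]
    have e2 : 2 * m / q = 2 * w * q := by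
      apply Nat.eq_of_mul_eq_mul_right hq.pos
      rw [tq ⟨w, hw⟩]; nth_rewrite 1 [hw]; ring
    have htq := tq (m := m) ⟨w, hw⟩
    rw [← hP q hq ⟨w, hw⟩ (Δ * (q : Int) ^ 2) ((l * q : Int) : Zt m) ?_, ← sum_t htq (fun x => C _ (_ + x))]
    · refine Finset.sum_congr rfl fun j _ => ?_
      show C _ _ = C _ _
      rw [e1, e2]
      congr 1
      push_cast; ring
    · have : ((2 * m / q * q : Nat) : Zt m) = 0 := by rw [htq]; exact ZMod.natCast_self _
      push_cast at this ⊢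
      grind
  · intro h
    have := h (-1) 1 (by norm_num)
    have h1 : C (-1) ((1:Int) : Zt m) = 0 := this
    grind
  · intro φ hM hWk hog
    obtain ⟨F, hF, hFc⟩ := ell_toVV φ hM hWk
    have hFo : ∀ Δ ll, Δ < -1 → F Δ ll = 0 := by
      intro Δ ll hΔ
      obtain ⟨l, rfl⟩ := ZMod.intCast_surjective ll
      rw [hFc, hog _ _ hΔ]
    have hr : ∀ r : Int, (4 * (m : Int)) ∣ (r ^ 2 - 1) → F (-1) r = -F 0 0 / 2 := by
      intro r hr
      have h1 := (hF.W r hr).ct (fun Δ ll h => hFo Δ _ h)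
      beta_reduce at h1
      rw [mul_zero, mul_one, mul_neg, mul_one, hF.even (by decide)] at h1
      linear_combination h1 / 2
    refine ⟨-F 0 0 / 2, fun Δ l hΔ => ?_, fun lam hl => ?_⟩
    · show _ = _ * C Δ l
      rw [← hFc]
      rcases lt_or_eq_of_le (show Δ ≤ -1 by omega) with h | rfl
      · rw [hFo _ _ h, hG.og _ _ h, mul_zero]
      · by_cases hd : (4 * (m : Int)) ∣ (l ^ 2 - 1)
        · grind
        · have n1 : F (-1) l = 0 := by
            by_contra h; exact hd (by have := hF.supp _ _ h; rwa [neg_add_eq_sub] at this)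
          have n2 : C (-1) l = 0 := by
            by_contra h; exact hd (by have := hG.vv.supp _ _ h; rwa [neg_add_eq_sub] at this)
          rw [n1, n2, mul_zero]
    · have h1 : φ.coeff (-1) 1 = lam * C (-1) ((1:Int) : Zt m) := hl (-1) 1 (by norm_num)
      simp_all
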